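/- Assume the large sieve bound C₂(M,Q) ≪ (QM)^ε (M + Q^{3/2}) and C₁(M,Q) ≤ C₂(M,Q). Then the quartic Dirichlet character large sieve holds with the bound (QM)^ε min{Q^{3/2}+M, Q^{5/4}+Q^{1/2}M, Q^{7/6}+Q^{2/3}M, Q+Q^{1/3}M^{5/3}+M^{7/3}} times Σ*_{M<m≤2M} |a_m|², i.e., Σ_{Q<q≤2Q} Σ*_{χ mod q, χ⁴=χ₀} |Σ*_{M<m≤2M} a_m χ(m)|² is bounded by that quantity. -/

import Mathlib

noncomputable section
open Complex
open scoped ComplexConjugate Classical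

/-- `n` is primary: `n ≡ 1 mod (1+i)^3` in `ℤ[i]`. -/
def IsPrimary (n : GaussianInt) : Prop := (⟨1, 1⟩ : GaussianInt) ^ 3 ∣ n - 1

/-- The additive character `ẽ(z) = exp(2πi (z/(2i) - z̄/(2i)))` on `ℚ(i)`. -/
def echar (z : ℂ) : ℂ :=
  Complex.exp (2 * Real.pi * I * (z / (2 * I) - (conj z) / (2 * I)))

/-- The quartic residue symbol `(a/ϖ)₄` at a Gaussian prime `ϖ`: the unique fourth root of
unity `ζ ∈ {1, -1, i, -i}` with `a^((N(ϖ)-1)/4) ≡ ζ (mod ϖ)`, or `0` if `ϖ ∣ a`. -/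
def quarticSymbolPrime (a ϖ : GaussianInt) : GaussianInt :=
  if ϖ ∣ a then 0
  else if h : ∃ ζ : GaussianInt,
      ζ ∈ ({1, -1, ⟨0, 1⟩, ⟨0, -1⟩} : Set GaussianInt) ∧
      ϖ ∣ a ^ (((Zsqrtd.norm ϖ).natAbs - 1) / 4) - ζ
    then h.choose else 0

/-- The quartic residue symbol `(a/n)₄` for odd `n ∈ ℤ[i]`, extended multiplicatively from
Gaussian primes, with value `1` when `n` is a unit. -/
def quarticSymbol (a n : GaussianInt) : GaussianInt :=
  if n = 0 then 0
  else ((UniqueFactorizationMonoid.factors n).map fun ϖ => quarticSymbolPrime a ϖ).prod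

/-- The twisted quartic Gauss sum `g(k,n) = Σ_{x mod n} (x/n)₄ ẽ(kx/n)`. -/
def gaussSumK (k n : GaussianInt) : ℂ :=
  ∑ᶠ x : GaussianInt ⧸ Ideal.span {n},
    GaussianInt.toComplex (quarticSymbol x.out n) *
      echar (GaussianInt.toComplex k * GaussianInt.toComplex x.out / GaussianInt.toComplex n)

/-- The quartic Gauss sum `g(n) = g(1,n)`. -/
def quarticGaussSum (n : GaussianInt) : ℂ := gaussSumK 1 n


/-- The left-hand side of the quartic large sieve: the character sum over moduli
`Q < q ≤ 2Q` and primitive quartic characters mod `q` whose square remains primitive,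
of the squared modulus of `Σ*_{M < m ≤ 2M} a_m χ(m)` over square-free `m`. -/
def quartSieveSum (Q M : ℕ) (a : ℕ → ℂ) : ℝ :=
  ∑ q ∈ Finset.Ioc Q (2 * Q), ∑ᶠ χ : DirichletCharacter ℂ q,
    if χ.IsPrimitive ∧ (χ ^ 2).IsPrimitive ∧ χ ^ 4 = 1 then
      ‖∑ m ∈ Finset.Ioc M (2 * M), if Squarefree m then a m * χ (m : ZMod q) else 0‖ ^ 2
    else 0

theorem exists_card_divisors_le (ε : ℝ) (hε : 0 < ε) :
    ∃ C : ℝ, 1 ≤ C ∧ ∀ n : ℕ, n ≠ 0 → (n.divisors.card : ℝ) ≤ C * (n : ℝ) ^ ε := by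
  obtain ⟨P, hP⟩ := exists_nat_gt ((2 : ℝ) ^ (1 / ε))
  set D : ℝ := max 1 (1 / (ε * Real.log 2)) with hD
  have hlog : 0 < Real.log 2 := Real.log_pos (by norm_num)
  have hD1 : 1 ≤ D := le_max_left _ _
  have key : ∀ p a : ℕ, p.Prime →
      ((a : ℝ) + 1) ≤ (if p < P then D else 1) * ((p : ℝ) ^ a) ^ ε := by
    intro p a hp
    have hp2 : (2 : ℝ) ≤ p := by exact_mod_cast hp.two_le
    have hpp : ((p : ℝ) ^ a) ^ ε = ((p : ℝ) ^ ε) ^ a := by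
      rw [← Real.rpow_natCast, ← Real.rpow_mul (by positivity), mul_comm,
        Real.rpow_mul (by positivity), Real.rpow_natCast]
    split_ifs with h
    · have h1 : (a : ℝ) * (ε * Real.log 2) + 1 ≤ ((p : ℝ) ^ a) ^ ε := by
        calc (a : ℝ) * (ε * Real.log 2) + 1 ≤ Real.exp (a * (ε * Real.log 2)) :=
              Real.add_one_le_exp _
          _ = ((2 : ℝ) ^ a) ^ ε := by
              rw [← Real.rpow_natCast, ← Real.rpow_mul (by norm_num),
                Real.rpow_def_of_pos (by norm_num)]
              ring_nf
          _ ≤ _ := by gcongr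
      have h2 : 1 ≤ D * (ε * Real.log 2) := by
        have : 1 / (ε * Real.log 2) ≤ D := le_max_right _ _
        rwa [div_le_iff₀ (by positivity)] at this
      calc (a : ℝ) + 1 ≤ a * (D * (ε * Real.log 2)) + D := by nlinarith [a.cast_nonneg (α := ℝ)]
        _ = D * (a * (ε * Real.log 2) + 1) := by ring
        _ ≤ _ := by gcongr
    · have h3 : (2 : ℝ) ≤ (p : ℝ) ^ ε := by
        have h4 : (2 : ℝ) ^ (1 / ε) ≤ p := hP.le.trans (by exact_mod_cast not_lt.mp h)
        calc (2 : ℝ) = ((2 : ℝ) ^ (1 / ε)) ^ ε := by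
              rw [← Real.rpow_mul (by norm_num), one_div_mul_cancel hε.ne', Real.rpow_one]
          _ ≤ _ := by gcongr
      rw [hpp, one_mul]
      calc (a : ℝ) + 1 ≤ 2 ^ a := by exact_mod_cast Nat.succ_le_of_lt a.lt_two_pow_self
        _ ≤ _ := by gcongr
  refine ⟨D ^ P, one_le_pow₀ hD1, fun n hn => ?_⟩
  have hn' : (n : ℝ) ^ ε = ∏ p ∈ n.primeFactors, ((p : ℝ) ^ n.factorization p) ^ ε := by
    rw [Real.finsetProd_rpow _ _ (fun _ _ => by positivity)]
    congr 1
    conv_lhs => rw [← Nat.prod_factorization_pow_eq_self hn]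
    simp [Finsupp.prod]
  rw [Nat.card_divisors hn, hn']
  push_cast
  calc ∏ p ∈ n.primeFactors, ((n.factorization p : ℝ) + 1)
      ≤ ∏ p ∈ n.primeFactors, (if p < P then D else 1) * ((p : ℝ) ^ n.factorization p) ^ ε :=
        Finset.prod_le_prod (fun _ _ => by positivity)
          fun p hp => key p _ (Nat.prime_of_mem_primeFactors hp)
    _ ≤ _ := by
        rw [Finset.prod_mul_distrib]
        gcongr
        rw [← Finset.prod_filter, Finset.prod_const]
        refine pow_le_pow_right₀ hD1 ?_
        calc _ ≤ (Finset.range P).card := Finset.card_le_card fun p hp => by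
              simpa using (Finset.mem_filter.mp hp).2
          _ = P := Finset.card_range P

/-- The positive square-free integers up to `X`. -/
def squarefreeUpTo (X : ℕ) : Finset ℕ := (Finset.Icc 1 X).filter Squarefree

theorem mem_squarefreeUpTo {X m : ℕ} :
    m ∈ squarefreeUpTo X ↔ (1 ≤ m ∧ m ≤ X) ∧ Squarefree m := by
  simp [squarefreeUpTo]

/-- The `ℓ²` norm of `F` restricted to the finite set `s`. -/
def l2norm {ι : Type*} (s : Finset ι) (F : ι → ℂ) : ℝ := √(∑ i ∈ s, ‖F i‖ ^ 2)

theorem l2norm_nonneg {ι : Type*} (s : Finset ι) (F : ι → ℂ) : 0 ≤ l2norm s F :=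
  Real.sqrt_nonneg _

theorem l2norm_sq {ι : Type*} (s : Finset ι) (F : ι → ℂ) :
    l2norm s F ^ 2 = ∑ i ∈ s, ‖F i‖ ^ 2 :=
  Real.sq_sqrt (Finset.sum_nonneg fun _ _ => by positivity)

theorem l2norm_sum_le {ι κ : Type*} (s : Finset ι) (t : Finset κ) (F : κ → ι → ℂ) :
    l2norm s (fun i => ∑ k ∈ t, F k i) ≤ ∑ k ∈ t, l2norm s (F k) := by
  have h : ∀ G : ι → ℂ, l2norm s G = ‖(WithLp.toLp 2 (fun i : s => G i) : EuclideanSpace ℂ s)‖ := by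
    intro G
    rw [EuclideanSpace.norm_eq, l2norm]
    congr 1
    exact (Finset.sum_coe_sort s fun i => ‖G i‖ ^ 2).symm
  simp_rw [h]
  refine le_trans (le_of_eq ?_) (norm_sum_le _ _)
  congr 1
  ext i
  simp

theorem l2norm_mono {ι : Type*} {s : Finset ι} {F G : ι → ℂ} (h : ∀ i ∈ s, ‖F i‖ ≤ ‖G i‖) :
    l2norm s F ≤ l2norm s G := by
  apply Real.sqrt_le_sqrt
  exact Finset.sum_le_sum fun i hi => by gcongr; exact h i hi

/-- The large sieve inequality with constant `B` for the family `φ` over `s`, with coefficients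
supported on square-free integers up to `X`. -/
def LargeSieve {ι : Type*} (s : Finset ι) (φ : ι → ℕ → ℂ) (X : ℕ) (B : ℝ) : Prop :=
  ∀ a : ℕ → ℂ, ∑ i ∈ s, ‖∑ m ∈ squarefreeUpTo X, a m * φ i m‖ ^ 2 ≤
    B * ∑ m ∈ squarefreeUpTo X, ‖a m‖ ^ 2

theorem LargeSieve.l2norm_le {ι : Type*} {s : Finset ι} {φ : ι → ℕ → ℂ} {X : ℕ} {B : ℝ}
    (h : LargeSieve s φ X B) (a : ℕ → ℂ) :
    l2norm s (fun i => ∑ m ∈ squarefreeUpTo X, a m * φ i m) ≤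
      √B * l2norm (squarefreeUpTo X) a := by
  rcases le_or_gt 0 B with hB | hB
  · rw [l2norm, l2norm, ← Real.sqrt_mul hB]
    exact Real.sqrt_le_sqrt (h a)
  · have h1 := h a
    have h2 : (0 : ℝ) ≤ ∑ m ∈ squarefreeUpTo X, ‖a m‖ ^ 2 :=
      Finset.sum_nonneg fun _ _ => by positivity
    rw [l2norm, Real.sqrt_eq_zero_of_nonpos (h1.trans (by nlinarith))]
    exact mul_nonneg (Real.sqrt_nonneg _) (l2norm_nonneg _ _)

theorem sum_sum_dvd_le {X Y : ℕ} {T : ℝ} (a : ℕ → ℂ)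
    (hT : ∀ n ∈ Finset.Icc 1 X, (n.divisors.card : ℝ) ≤ T) :
    ∑ d ∈ Finset.Icc 1 Y, ∑ m ∈ squarefreeUpTo X with d ∣ m, ‖a m‖ ^ 2 ≤
      T * ∑ m ∈ squarefreeUpTo X, ‖a m‖ ^ 2 := by
  simp_rw [Finset.sum_filter]
  rw [Finset.sum_comm, Finset.mul_sum]
  refine Finset.sum_le_sum fun m hm => ?_
  obtain ⟨hm1, hm2⟩ := mem_squarefreeUpTo.mp hm
  rw [← Finset.sum_filter, Finset.sum_const, nsmul_eq_mul]
  gcongr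
  refine le_trans ?_ (hT m (Finset.mem_Icc.mpr hm1))
  norm_cast
  refine Finset.card_le_card fun d hd => ?_
  simp only [Finset.mem_filter, Nat.mem_divisors] at hd ⊢
  exact ⟨hd.2, by lia⟩

theorem exists_mul_expansion {X Y : ℕ} {T : ℝ} (hT1 : 1 ≤ T)
    (hT : ∀ n ∈ Finset.Icc 1 (X * Y), (n.divisors.card : ℝ) ≤ T) (a b : ℕ → ℂ) :
    ∃ c : ℕ → ℕ → ℂ,
      (∀ φ : ℕ → ℂ, (∀ m n, φ (m * n) = φ m * φ n) →
        (∑ m ∈ squarefreeUpTo X, a m * φ m) * (∑ n ∈ squarefreeUpTo Y, b n * φ n) =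
          ∑ d ∈ Finset.Icc 1 X, φ d ^ 2 * ∑ l ∈ squarefreeUpTo (X * Y), c d l * φ l) ∧
      ∑ d ∈ Finset.Icc 1 X, l2norm (squarefreeUpTo (X * Y)) (c d) ≤
        T ^ 2 * (l2norm (squarefreeUpTo X) a * l2norm (squarefreeUpTo Y) b) := by
  set P := squarefreeUpTo X ×ˢ squarefreeUpTo Y with hP
  set gl : ℕ × ℕ → ℕ × ℕ := fun p => (p.1.gcd p.2, (p.1 / p.1.gcd p.2) * (p.2 / p.1.gcd p.2))
  have hgl : ∀ p ∈ P, gl p ∈ Finset.Icc 1 X ×ˢ squarefreeUpTo (X * Y) := by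
    rintro ⟨m, n⟩ hp
    simp only [hP, Finset.mem_product, mem_squarefreeUpTo] at hp
    obtain ⟨⟨⟨hm1, hmX⟩, hms⟩, ⟨hn1, hnY⟩, hns⟩ := hp
    have hg : 0 < m.gcd n := Nat.gcd_pos_of_pos_left _ (by lia)
    simp only [gl, Finset.mem_product, mem_squarefreeUpTo, Finset.mem_Icc]
    refine ⟨⟨hg, (Nat.gcd_le_left _ (by lia)).trans hmX⟩, ⟨?_, ?_⟩, ?_⟩
    · exact Nat.mul_pos (Nat.div_pos (Nat.gcd_le_left _ (by lia)) hg)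
        (Nat.div_pos (Nat.gcd_le_right _ (by lia)) hg)
    · exact Nat.mul_le_mul ((Nat.div_le_self _ _).trans hmX) ((Nat.div_le_self _ _).trans hnY)
    · rw [Nat.squarefree_mul (Nat.coprime_div_gcd_div_gcd hg)]
      exact ⟨hms.squarefree_of_dvd (Nat.div_dvd_of_dvd (Nat.gcd_dvd_left _ _)),
        hns.squarefree_of_dvd (Nat.div_dvd_of_dvd (Nat.gcd_dvd_right _ _))⟩
  refine ⟨fun d l => ∑ p ∈ P with gl p = (d, l), a p.1 * b p.2, fun φ hφ => ?_, ?_⟩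
  · rw [Finset.sum_mul_sum, ← Finset.sum_product', ← Finset.sum_fiberwise_of_maps_to hgl,
      Finset.sum_product]
    refine Finset.sum_congr rfl fun d _ => ?_
    rw [Finset.mul_sum]
    refine Finset.sum_congr rfl fun l _ => ?_
    rw [Finset.sum_mul, Finset.mul_sum]
    refine Finset.sum_congr rfl ?_
    rintro ⟨m, n⟩ hp
    obtain ⟨-, h⟩ := Finset.mem_filter.mp hp
    obtain ⟨h1, h2⟩ := Prod.mk.inj h
    subst h1 h2
    have e1 : φ m = φ (m.gcd n) * φ (m / m.gcd n) := by
      rw [← hφ, Nat.mul_div_cancel' (Nat.gcd_dvd_left _ _)]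
    have e2 : φ n = φ (m.gcd n) * φ (n / m.gcd n) := by
      rw [← hφ, Nat.mul_div_cancel' (Nat.gcd_dvd_right _ _)]
    simp only [hφ]
    rw [e1, e2]
    ring
  · set A : ℕ → ℝ := fun d => ∑ m ∈ squarefreeUpTo X with d ∣ m, ‖a m‖ ^ 2
    set B : ℕ → ℝ := fun d => ∑ m ∈ squarefreeUpTo Y with d ∣ m, ‖b m‖ ^ 2
    have hA0 : ∀ d, 0 ≤ A d := fun d => Finset.sum_nonneg fun _ _ => by positivity
    have hB0 : ∀ d, 0 ≤ B d := fun d => Finset.sum_nonneg fun _ _ => by positivity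
    have hc : ∀ d ∈ Finset.Icc 1 X, l2norm (squarefreeUpTo (X * Y))
        (fun l => ∑ p ∈ P with gl p = (d, l), a p.1 * b p.2) ≤ T * (√(A d) * √(B d)) := by
      intro d hd
      have hd0 : 0 < d := (Finset.mem_Icc.mp hd).1
      have hT0 : 0 ≤ T := by linarith
      have : T * (√(A d) * √(B d)) = √(T ^ 2 * (A d * B d)) := by
        rw [Real.sqrt_mul (by positivity), Real.sqrt_sq hT0, Real.sqrt_mul (hA0 d)]
      rw [this]
      apply Real.sqrt_le_sqrt
      calc ∑ l ∈ squarefreeUpTo (X * Y), ‖∑ p ∈ P with gl p = (d, l), a p.1 * b p.2‖ ^ 2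
          ≤ ∑ l ∈ squarefreeUpTo (X * Y), T * ∑ p ∈ P with gl p = (d, l), ‖a p.1 * b p.2‖ ^ 2 := by
            refine Finset.sum_le_sum fun l hl => ?_
            calc _ ≤ (∑ p ∈ P with gl p = (d, l), ‖a p.1 * b p.2‖) ^ 2 := by
                  gcongr; exact norm_sum_le _ _
              _ ≤ (P.filter fun p => gl p = (d, l)).card *
                    ∑ p ∈ P with gl p = (d, l), ‖a p.1 * b p.2‖ ^ 2 := sq_sum_le_card_mul_sum_sq
              _ ≤ _ := by
                  gcongr
                  obtain ⟨hl1, -⟩ := mem_squarefreeUpTo.mp hl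
                  refine le_trans ?_ (hT l (Finset.mem_Icc.mpr hl1))
                  norm_cast
                  refine Finset.card_le_card_of_injOn (fun p => p.1 / d) ?_ ?_
                  · rintro ⟨m, n⟩ hp
                    obtain ⟨h1, h2⟩ := Prod.mk.inj (Finset.mem_filter.mp hp).2
                    subst h1
                    simp only [Finset.mem_coe, Nat.mem_divisors]
                    exact ⟨⟨_, h2.symm⟩, by lia⟩
                  · rintro ⟨m, n⟩ hp ⟨m', n'⟩ hp' he
                    obtain ⟨h1, h2⟩ := Prod.mk.inj (Finset.mem_filter.mp hp).2
                    obtain ⟨h1', h2'⟩ := Prod.mk.inj (Finset.mem_filter.mp hp').2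
                    simp only at h1 h2 h1' h2' he
                    rw [h1] at h2
                    rw [h1'] at h2'
                    have dm : d ∣ m := h1 ▸ Nat.gcd_dvd_left _ _
                    have dn : d ∣ n := h1 ▸ Nat.gcd_dvd_right _ _
                    have dm' : d ∣ m' := h1' ▸ Nat.gcd_dvd_left _ _
                    have dn' : d ∣ n' := h1' ▸ Nat.gcd_dvd_right _ _
                    have hm : m = m' := by
                      rw [← Nat.mul_div_cancel' dm, he, Nat.mul_div_cancel' dm']
                    have h0 : 0 < m / d := Nat.pos_of_ne_zero fun h0 => by
                      rw [h0, zero_mul] at h2; lia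
                    have : n / d = n' / d := by
                      rw [← he, ← h2] at h2'
                      exact (Nat.eq_of_mul_eq_mul_left h0 h2').symm
                    have hn : n = n' := by
                      rw [← Nat.mul_div_cancel' dn, this, Nat.mul_div_cancel' dn']
                    rw [hm, hn]
        _ = T * ∑ p ∈ P with (∃ l ∈ squarefreeUpTo (X * Y), gl p = (d, l)),
              ‖a p.1 * b p.2‖ ^ 2 := by
            rw [← Finset.mul_sum]
            congr 1
            rw [← Finset.sum_biUnion]
            · refine Finset.sum_congr ?_ fun _ _ => rfl
              ext p
              simp only [Finset.mem_biUnion, Finset.mem_filter]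
              tauto
            · intro l _ l' _ hll
              refine Finset.disjoint_left.mpr fun p hp hp' => hll ?_
              have h1 := (Finset.mem_filter.mp hp).2
              have h2 := (Finset.mem_filter.mp hp').2
              exact (Prod.mk.inj (h1.symm.trans h2)).2
        _ ≤ T * ∑ p ∈ P with (d ∣ p.1 ∧ d ∣ p.2), ‖a p.1 * b p.2‖ ^ 2 := by
            gcongr
            rintro ⟨l, -, hl⟩
            have := (Prod.mk.inj hl).1
            exact ⟨this ▸ Nat.gcd_dvd_left _ _, this ▸ Nat.gcd_dvd_right _ _⟩
        _ = T * (A d * B d) := by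
            rw [Finset.sum_mul_sum, ← Finset.sum_product', hP, ← Finset.filter_product]
            simp only [norm_mul, mul_pow]
        _ ≤ _ := by
            have := mul_nonneg (hA0 d) (hB0 d)
            gcongr
            nlinarith
    rcases Nat.eq_zero_or_pos X with rfl | hX
    · simpa using mul_nonneg (by positivity)
        (mul_nonneg (l2norm_nonneg (squarefreeUpTo 0) a) (l2norm_nonneg (squarefreeUpTo Y) b))
    rcases Nat.eq_zero_or_pos Y with rfl | hY
    · have : squarefreeUpTo 0 = ∅ := by simp [squarefreeUpTo]
      simp [this, l2norm]
    calc _ ≤ ∑ d ∈ Finset.Icc 1 X, T * (√(A d) * √(B d)) := Finset.sum_le_sum hc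
      _ = T * ∑ d ∈ Finset.Icc 1 X, √(A d) * √(B d) := by rw [Finset.mul_sum]
      _ ≤ T * (√(∑ d ∈ Finset.Icc 1 X, A d) * √(∑ d ∈ Finset.Icc 1 X, B d)) := by
          gcongr
          exact Real.sum_sqrt_mul_sqrt_le _ hA0 hB0
      _ ≤ T * (√(T * ∑ m ∈ squarefreeUpTo X, ‖a m‖ ^ 2) *
            √(T * ∑ m ∈ squarefreeUpTo Y, ‖b m‖ ^ 2)) := by
          gcongr
          · exact sum_sum_dvd_le a fun n hn => hT n (by
              simp only [Finset.mem_Icc] at hn ⊢; exact ⟨hn.1, by nlinarith⟩)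
          · exact sum_sum_dvd_le b fun n hn => hT n (by
              simp only [Finset.mem_Icc] at hn ⊢; exact ⟨hn.1, by nlinarith⟩)
      _ = _ := by
          rw [Real.sqrt_mul (by linarith), Real.sqrt_mul (by linarith), l2norm, l2norm]
          have := Real.mul_self_sqrt (show 0 ≤ T by linarith)
          linear_combination T * √(∑ m ∈ squarefreeUpTo X, ‖a m‖ ^ 2) *
            √(∑ m ∈ squarefreeUpTo Y, ‖b m‖ ^ 2) * this

section Moments

variable {ι : Type*} {s : Finset ι} {φ : ι → ℕ → ℂ} {B T : ℝ}

theorem LargeSieve.l2norm_mul_le {X Y : ℕ} (hφ : ∀ i m n, φ i (m * n) = φ i m * φ i n)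
    (hφ1 : ∀ i m, ‖φ i m‖ ≤ 1) (hT1 : 1 ≤ T)
    (hT : ∀ n ∈ Finset.Icc 1 (X * Y), (n.divisors.card : ℝ) ≤ T)
    (h : LargeSieve s φ (X * Y) B) (a b : ℕ → ℂ) :
    l2norm s (fun i => (∑ m ∈ squarefreeUpTo X, a m * φ i m) *
        ∑ m ∈ squarefreeUpTo Y, b m * φ i m) ≤
      T ^ 2 * √B * (l2norm (squarefreeUpTo X) a * l2norm (squarefreeUpTo Y) b) := by
  obtain ⟨c, hc, hcn⟩ := exists_mul_expansion hT1 hT a b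
  simp_rw [fun i => hc (φ i) (hφ i)]
  refine (l2norm_sum_le _ _ _).trans ?_
  calc _ ≤ ∑ d ∈ Finset.Icc 1 X, √B * l2norm (squarefreeUpTo (X * Y)) (c d) := by
        refine Finset.sum_le_sum fun d _ => le_trans (l2norm_mono fun i _ => ?_) (h.l2norm_le (c d))
        rw [norm_mul, norm_pow]
        exact mul_le_of_le_one_left (norm_nonneg _) (pow_le_one₀ (norm_nonneg _) (hφ1 i d))
    _ ≤ √B * (T ^ 2 * (l2norm (squarefreeUpTo X) a * l2norm (squarefreeUpTo Y) b)) := by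
        rw [← Finset.mul_sum]; gcongr
    _ = _ := by ring

theorem LargeSieve.l2norm_mul_mul_le {X Y Z : ℕ} (hφ : ∀ i m n, φ i (m * n) = φ i m * φ i n)
    (hφ1 : ∀ i m, ‖φ i m‖ ≤ 1) (hT1 : 1 ≤ T) (hZ : 1 ≤ Z)
    (hT : ∀ n ∈ Finset.Icc 1 (X * Y * Z), (n.divisors.card : ℝ) ≤ T)
    (h : LargeSieve s φ (X * Y * Z) B) (a b c : ℕ → ℂ) :
    l2norm s (fun i => (∑ m ∈ squarefreeUpTo X, a m * φ i m) *
        (∑ m ∈ squarefreeUpTo Y, b m * φ i m) * ∑ m ∈ squarefreeUpTo Z, c m * φ i m) ≤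
      T ^ 4 * √B * (l2norm (squarefreeUpTo X) a * l2norm (squarefreeUpTo Y) b *
        l2norm (squarefreeUpTo Z) c) := by
  obtain ⟨e, he, hen⟩ := exists_mul_expansion (X := X) (Y := Y) hT1 (fun n hn => hT n (by
    simp only [Finset.mem_Icc] at hn ⊢; exact ⟨hn.1, by nlinarith⟩)) a b
  simp_rw [fun i => he (φ i) (hφ i), Finset.sum_mul]
  refine (l2norm_sum_le _ _ _).trans ?_
  calc _ ≤ ∑ d ∈ Finset.Icc 1 X, T ^ 2 * √B * (l2norm (squarefreeUpTo (X * Y)) (e d) *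
          l2norm (squarefreeUpTo Z) c) := by
        refine Finset.sum_le_sum fun d _ =>
          le_trans (l2norm_mono fun i _ => ?_) (h.l2norm_mul_le hφ hφ1 hT1 hT (e d) c)
        rw [mul_assoc, norm_mul, norm_pow]
        exact mul_le_of_le_one_left (norm_nonneg _) (pow_le_one₀ (norm_nonneg _) (hφ1 i d))
    _ = T ^ 2 * √B * l2norm (squarefreeUpTo Z) c *
          ∑ d ∈ Finset.Icc 1 X, l2norm (squarefreeUpTo (X * Y)) (e d) := by
        rw [Finset.mul_sum]; exact Finset.sum_congr rfl fun _ _ => by ring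
    _ ≤ T ^ 2 * √B * l2norm (squarefreeUpTo Z) c *
          (T ^ 2 * (l2norm (squarefreeUpTo X) a * l2norm (squarefreeUpTo Y) b)) := by
        gcongr
        exact mul_nonneg (by positivity) (l2norm_nonneg _ _)
    _ = _ := by ring

theorem LargeSieve.sq_le {X : ℕ} (hφ : ∀ i m n, φ i (m * n) = φ i m * φ i n)
    (hφ1 : ∀ i m, ‖φ i m‖ ≤ 1) (hT1 : 1 ≤ T) (hB : 0 ≤ B)
    (hT : ∀ n ∈ Finset.Icc 1 (X * X), (n.divisors.card : ℝ) ≤ T)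
    (h : LargeSieve s φ (X * X) B) (a : ℕ → ℂ) :
    (∑ i ∈ s, ‖∑ m ∈ squarefreeUpTo X, a m * φ i m‖ ^ 2) ^ 2 ≤
      s.card * (T ^ 4 * B) * (∑ m ∈ squarefreeUpTo X, ‖a m‖ ^ 2) ^ 2 := by
  have h1 := h.l2norm_mul_le hφ hφ1 hT1 hT a a
  have h2 := pow_le_pow_left₀ (l2norm_nonneg _ _) h1 2
  rw [l2norm_sq] at h2
  refine sq_sum_le_card_mul_sum_sq.trans ?_
  rw [mul_assoc]
  gcongr
  refine le_trans (le_of_eq ?_) (h2.trans (le_of_eq ?_))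
  · refine Finset.sum_congr rfl fun i _ => ?_
    rw [norm_mul]; ring
  · rw [mul_pow, mul_pow, Real.sq_sqrt hB, mul_pow, l2norm_sq]; ring

theorem LargeSieve.cube_le {X : ℕ} (hφ : ∀ i m n, φ i (m * n) = φ i m * φ i n)
    (hφ1 : ∀ i m, ‖φ i m‖ ≤ 1) (hT1 : 1 ≤ T) (hX : 1 ≤ X) (hB : 0 ≤ B)
    (hT : ∀ n ∈ Finset.Icc 1 (X * X * X), (n.divisors.card : ℝ) ≤ T)
    (h : LargeSieve s φ (X * X * X) B) (a : ℕ → ℂ) :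
    (∑ i ∈ s, ‖∑ m ∈ squarefreeUpTo X, a m * φ i m‖ ^ 2) ^ 3 ≤
      s.card ^ 2 * (T ^ 8 * B) * (∑ m ∈ squarefreeUpTo X, ‖a m‖ ^ 2) ^ 3 := by
  have h1 := h.l2norm_mul_mul_le hφ hφ1 hT1 hX hT a a a
  have h2 := pow_le_pow_left₀ (l2norm_nonneg _ _) h1 2
  rw [l2norm_sq] at h2
  refine (pow_sum_le_card_mul_sum_pow (fun _ _ => by positivity) 2).trans ?_
  rw [mul_assoc]
  gcongr
  refine le_trans (le_of_eq ?_) (h2.trans (le_of_eq ?_))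
  · refine Finset.sum_congr rfl fun i _ => ?_
    rw [norm_mul, norm_mul]; ring
  · rw [mul_pow, mul_pow, Real.sq_sqrt hB, mul_pow, mul_pow, l2norm_sq]; ring

end Moments

section QuarticSymbol

/-- The fourth roots of unity in `ℤ[i]`. -/
def gaussUnits : Finset GaussianInt := {1, -1, ⟨0, 1⟩, ⟨0, -1⟩}

theorem mul_mem_gaussUnits {u v : GaussianInt} (hu : u ∈ gaussUnits) (hv : v ∈ gaussUnits) :
    u * v ∈ gaussUnits := by
  have : ∀ u ∈ gaussUnits, ∀ v ∈ gaussUnits, u * v ∈ gaussUnits := by decide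
  exact this u hu v hv

theorem star_mem_gaussUnits {u : GaussianInt} (hu : u ∈ gaussUnits) : star u ∈ gaussUnits := by
  revert u; decide

theorem mul_star_of_mem_gaussUnits {u : GaussianInt} (hu : u ∈ gaussUnits) : u * star u = 1 := by
  revert u; decide

theorem eq_of_mem_gaussUnits_of_dvd {ℓ : ℕ} (hℓ : 3 ≤ ℓ) {u v : GaussianInt}
    (hu : u ∈ gaussUnits) (hv : v ∈ gaussUnits) (h : ((ℓ : ℤ) : GaussianInt) ∣ u - v) : u = v := by
  rw [Zsqrtd.intCast_dvd] at h
  obtain ⟨h1, h2⟩ := h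
  have hb : ∀ z : ℤ, (ℓ : ℤ) ∣ z → |z| ≤ 2 → z = 0 := fun z hz hz2 =>
    Int.eq_zero_of_abs_lt_dvd hz (by lia)
  have hc : |(u - v).re| ≤ 2 ∧ |(u - v).im| ≤ 2 := by
    have : ∀ u ∈ gaussUnits, ∀ v ∈ gaussUnits, |(u - v).re| ≤ 2 ∧ |(u - v).im| ≤ 2 := by decide
    exact this u hu v hv
  have e1 := hb _ h1 hc.1
  have e2 := hb _ h2 hc.2
  have : u - v = 0 := Zsqrtd.ext e1 e2
  exact sub_eq_zero.mp this

theorem dvd_pow_sub_ite {ℓ : ℕ} (hℓ : ℓ.Prime) (hodd : ℓ ≠ 2) (x : GaussianInt) :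
    ((ℓ : ℤ) : GaussianInt) ∣ x ^ ℓ - if ℓ % 4 = 1 then x else star x := by
  have hmod : ℓ % 4 = 1 ∨ ℓ % 4 = 3 := by
    have := hℓ.eq_two_or_odd
    lia
  have := Fact.mk hℓ
  have key : ∀ a : ℤ, ((ℓ : ℤ) : GaussianInt) ∣ (a : GaussianInt) ^ ℓ - a := by
    intro a
    have : (ℓ : ℤ) ∣ a ^ ℓ - a := by
      rw [← ZMod.intCast_zmod_eq_zero_iff_dvd]
      push_cast
      rw [ZMod.pow_card, sub_self]
    obtain ⟨c, hc⟩ := this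
    exact ⟨c, by rw [← Int.cast_pow, ← Int.cast_sub, hc, Int.cast_mul]⟩
  set i : GaussianInt := ⟨0, 1⟩ with hi
  have hx : x = (x.re : GaussianInt) + x.im * i := by
    ext <;> simp [hi]
  have hsx : star x = (x.re : GaussianInt) - x.im * i := by
    ext <;> simp [hi]
  have hi4 : i ^ 4 = 1 := by decide
  have hi3 : i ^ 3 = -i := by decide
  obtain ⟨r, hr⟩ : ∃ r, ((x.re : GaussianInt) + x.im * i) ^ ℓ =
      (x.re : GaussianInt) ^ ℓ + (x.im * i) ^ ℓ + ℓ * r := by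
    obtain ⟨r, hr⟩ := exists_add_pow_prime_eq hℓ (x.re : GaussianInt) (x.im * i)
    exact ⟨x.re * (x.im * i) * r, by rw [hr]; ring⟩
  obtain ⟨c, hc⟩ := key x.re
  obtain ⟨d, hd⟩ := key x.im
  have hpow : x ^ ℓ = (x.re : GaussianInt) ^ ℓ + (x.im * i) ^ ℓ + ℓ * r := by
    rw [← hr, ← hx]
  have hl : ℓ = 4 * (ℓ / 4) + ℓ % 4 := (Nat.div_add_mod ℓ 4).symm
  rcases hmod with h | h
  · have hil : i ^ ℓ = i := by rw [hl, pow_add, pow_mul, hi4, one_pow, h]; ring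
    rw [if_pos h, hpow, mul_pow, hil]
    refine ⟨c + d * i + r, ?_⟩
    push_cast at hc hd ⊢
    linear_combination hc + i * hd - hx
  · have hil : i ^ ℓ = -i := by rw [hl, pow_add, pow_mul, hi4, one_pow, h, hi3]; ring
    rw [if_neg (by lia), hpow, mul_pow, hil, hsx]
    refine ⟨c - d * i + r, ?_⟩
    push_cast at hc hd ⊢
    linear_combination hc - i * hd

theorem gauss_dvd_of_dvd_norm_mul {ℓ : ℕ} (hℓ : ℓ.Prime) {x y : GaussianInt}
    (hx : ¬ (ℓ : ℤ) ∣ x.norm) (h : ((ℓ : ℤ) : GaussianInt) ∣ x * y) :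
    ((ℓ : ℤ) : GaussianInt) ∣ y := by
  have h1 : ((ℓ : ℤ) : GaussianInt) ∣ (x.norm : GaussianInt) * y := by
    rw [Zsqrtd.norm_eq_mul_conj]
    obtain ⟨c, hc⟩ := h
    exact ⟨star x * c, by linear_combination star x * hc⟩
  rw [Zsqrtd.intCast_dvd] at h1 ⊢
  have hp : Prime (ℓ : ℤ) := Nat.prime_iff_prime_int.mp hℓ
  simp only [Zsqrtd.re_mul, Zsqrtd.im_mul, Zsqrtd.re_intCast, Zsqrtd.im_intCast, mul_zero, zero_mul,
    add_zero] at h1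
  exact ⟨(hp.dvd_or_dvd h1.1).resolve_left hx, (hp.dvd_or_dvd h1.2).resolve_left hx⟩

/-- The power of `x` (or its conjugate) whose argument modulo `ℓ` determines `psiPrime ℓ x`. -/
def psiBase (ℓ : ℕ) (x : GaussianInt) : GaussianInt :=
  if ℓ % 4 = 1 then x ^ ((ℓ - 1) / 4) else star x ^ ((ℓ + 1) / 4)

/-- The quartic symbol `(x / x̄) ^ ((ℓ* - 1) / 4)` modulo the odd rational prime `ℓ`, where
`ℓ* = ±ℓ ≡ 1 mod 4`. -/
def psiPrime (ℓ : ℕ) (x : GaussianInt) : ℂ :=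
  if (ℓ : ℤ) ∣ x.norm then 0
  else if (ℓ : ℤ) ∣ (psiBase ℓ x).im then 1
  else if (ℓ : ℤ) ∣ (psiBase ℓ x).re then -1
  else if (ℓ : ℤ) ∣ (psiBase ℓ x).re - (psiBase ℓ x).im then I
  else -I

theorem psiBase_mul (ℓ : ℕ) (x y : GaussianInt) :
    psiBase ℓ (x * y) = psiBase ℓ x * psiBase ℓ y := by
  unfold psiBase
  split_ifs
  · rw [mul_pow]
  · rw [star_mul', mul_pow]

theorem gauss_norm_star (x : GaussianInt) : (star x).norm = x.norm := by
  simp [Zsqrtd.norm_def]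

theorem not_dvd_norm_psiBase {ℓ : ℕ} (hℓ : ℓ.Prime) {x : GaussianInt} (hx : ¬ (ℓ : ℤ) ∣ x.norm) :
    ¬ (ℓ : ℤ) ∣ (psiBase ℓ x).norm := by
  have hp : Prime (ℓ : ℤ) := Nat.prime_iff_prime_int.mp hℓ
  have hpow : ∀ (y : GaussianInt) (n : ℕ), (y ^ n).norm = y.norm ^ n := fun y n =>
    map_pow Zsqrtd.normMonoidHom y n
  unfold psiBase
  split_ifs
  · rw [hpow]; exact fun h => hx (hp.dvd_of_dvd_pow h)
  · rw [hpow, gauss_norm_star]; exact fun h => hx (hp.dvd_of_dvd_pow h)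

theorem dvd_pow_sub_norm {ℓ : ℕ} (hℓ : ℓ.Prime) (hodd : ℓ ≠ 2) {x : GaussianInt}
    (hx : ¬ (ℓ : ℤ) ∣ x.norm) :
    ((ℓ : ℤ) : GaussianInt) ∣ (if ℓ % 4 = 1 then x ^ (ℓ - 1) - 1 else x ^ (ℓ + 1) - x.norm) := by
  have h := dvd_pow_sub_ite hℓ hodd x
  split_ifs at h ⊢
  · apply gauss_dvd_of_dvd_norm_mul hℓ hx
    have : x * (x ^ (ℓ - 1) - 1) = x ^ ℓ - x := by
      rw [mul_sub, mul_one, mul_comm, ← pow_succ, Nat.sub_add_cancel hℓ.one_lt.le]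
    rwa [this]
  · rw [Zsqrtd.norm_eq_mul_conj, pow_succ, mul_comm x, ← sub_mul]
    exact h.mul_right _

theorem psiBase_pow_four {ℓ : ℕ} (hℓ : ℓ.Prime) (hodd : ℓ ≠ 2) {x : GaussianInt}
    (hx : ¬ (ℓ : ℤ) ∣ x.norm) :
    ((ℓ : ℤ) : GaussianInt) ∣ psiBase ℓ x ^ 4 - star (psiBase ℓ x) ^ 4 := by
  have h1 := dvd_pow_sub_norm hℓ hodd hx
  have h2 := dvd_pow_sub_norm hℓ hodd (x := star x) (by rwa [gauss_norm_star])
  have hmod : ℓ % 4 = 1 ∨ ℓ % 4 = 3 := by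
    have := hℓ.eq_two_or_odd
    lia
  rw [gauss_norm_star] at h2
  unfold psiBase
  rcases hmod with h | h
  · simp only [if_pos h] at h1 h2 ⊢
    rw [star_pow, ← pow_mul, ← pow_mul, show (ℓ - 1) / 4 * 4 = ℓ - 1 by lia]
    have := dvd_sub h1 h2
    rwa [sub_sub_sub_cancel_right] at this
  · have h' : ¬ ℓ % 4 = 1 := by lia
    simp only [if_neg h'] at h1 h2 ⊢
    rw [star_pow, star_star, ← pow_mul, ← pow_mul, show (ℓ + 1) / 4 * 4 = ℓ + 1 by lia]
    have := dvd_sub h2 h1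
    rwa [sub_sub_sub_cancel_right] at this

theorem exists_psiPrime {ℓ : ℕ} (hℓ : ℓ.Prime) (hodd : ℓ ≠ 2) {x : GaussianInt}
    (hx : ¬ (ℓ : ℤ) ∣ x.norm) :
    ∃ u ∈ gaussUnits, psiPrime ℓ x = GaussianInt.toComplex u ∧
      ((ℓ : ℤ) : GaussianInt) ∣ psiBase ℓ x - u * star (psiBase ℓ x) := by
  have h4 := psiBase_pow_four hℓ hodd hx
  unfold psiPrime
  rw [if_neg hx]
  set P := psiBase ℓ x
  obtain ⟨a, b⟩ := P
  have hp : Prime (ℓ : ℤ) := Nat.prime_iff_prime_int.mp hℓ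
  have h2 : ¬ (ℓ : ℤ) ∣ 8 := fun h => by
    have h8 : ℓ ∣ 2 ^ 3 := by exact_mod_cast h
    exact hodd ((Nat.prime_dvd_prime_iff_eq hℓ Nat.prime_two).mp (hℓ.dvd_of_dvd_pow h8))
  have h5 : (ℓ : ℤ) ∣ 8 * (a * b * (a - b) * (a + b)) := by
    have := ((Zsqrtd.intCast_dvd _ _).mp h4).2
    convert this using 1
    simp only [pow_succ, pow_zero, Zsqrtd.im_sub, Zsqrtd.im_mul, Zsqrtd.re_mul, Zsqrtd.re_star,
      Zsqrtd.im_star, Zsqrtd.re_one, Zsqrtd.im_one]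
    ring
  have h6 : (((ℓ : ℤ) ∣ a ∨ (ℓ : ℤ) ∣ b) ∨ (ℓ : ℤ) ∣ a - b) ∨ (ℓ : ℤ) ∣ a + b := by
    rcases hp.dvd_or_dvd h5 with h | h
    · exact absurd h h2
    · rcases hp.dvd_or_dvd h with h | h
      · rcases hp.dvd_or_dvd h with h | h
        · exact Or.inl (Or.inl (hp.dvd_or_dvd h))
        · exact Or.inl (Or.inr h)
      · exact Or.inr h
  simp only
  split_ifs with c1 c2 c3
  · refine ⟨1, by decide, by simp, ?_⟩
    rw [Zsqrtd.intCast_dvd]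
    simp only [one_mul, Zsqrtd.re_sub, Zsqrtd.re_star, sub_self, dvd_zero, Zsqrtd.im_sub,
      Zsqrtd.im_star, true_and]
    have := dvd_mul_of_dvd_left c1 2
    exact this.trans (dvd_of_eq (by ring))
  · refine ⟨-1, by decide, by simp, ?_⟩
    rw [Zsqrtd.intCast_dvd]
    simp only [neg_mul, one_mul, sub_neg_eq_add, Zsqrtd.re_add, Zsqrtd.re_star, Zsqrtd.im_add,
      Zsqrtd.im_star, add_neg_cancel, dvd_zero, and_true]
    have := dvd_mul_of_dvd_left c2 2
    exact this.trans (dvd_of_eq (by ring))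
  · refine ⟨⟨0, 1⟩, by decide, by simp [GaussianInt.toComplex_def], ?_⟩
    rw [Zsqrtd.intCast_dvd]
    simp only [Zsqrtd.re_sub, Zsqrtd.re_mul, Zsqrtd.re_star, Zsqrtd.im_sub, Zsqrtd.im_mul,
      Zsqrtd.im_star]
    refine ⟨?_, ?_⟩
    · exact c3.trans (dvd_of_eq (by ring))
    · exact (dvd_neg.mpr c3).trans (dvd_of_eq (by ring))
  · refine ⟨⟨0, -1⟩, by decide, by simp [GaussianInt.toComplex_def], ?_⟩
    have h7 : (ℓ : ℤ) ∣ a + b := by tauto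
    rw [Zsqrtd.intCast_dvd]
    simp only [Zsqrtd.re_sub, Zsqrtd.re_mul, Zsqrtd.re_star, Zsqrtd.im_sub, Zsqrtd.im_mul,
      Zsqrtd.im_star]
    refine ⟨?_, ?_⟩
    · exact h7.trans (dvd_of_eq (by ring))
    · exact h7.trans (dvd_of_eq (by ring))

theorem psiPrime_eq_of_dvd {ℓ : ℕ} (hℓ : ℓ.Prime) (hodd : ℓ ≠ 2) {x : GaussianInt}
    (hx : ¬ (ℓ : ℤ) ∣ x.norm) {u : GaussianInt} (hu : u ∈ gaussUnits)
    (h : ((ℓ : ℤ) : GaussianInt) ∣ psiBase ℓ x - u * star (psiBase ℓ x)) :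
    psiPrime ℓ x = GaussianInt.toComplex u := by
  obtain ⟨v, hv, he, hd⟩ := exists_psiPrime hℓ hodd hx
  rw [he]
  congr 1
  have h3 : 3 ≤ ℓ := by
    have := hℓ.two_le
    lia
  refine eq_of_mem_gaussUnits_of_dvd h3 hv hu ?_
  apply gauss_dvd_of_dvd_norm_mul hℓ (x := star (psiBase ℓ x))
  · rw [gauss_norm_star]; exact not_dvd_norm_psiBase hℓ hx
  · convert dvd_sub h hd using 1; ring

theorem psiPrime_of_dvd {ℓ : ℕ} {x : GaussianInt} (hx : (ℓ : ℤ) ∣ x.norm) : psiPrime ℓ x = 0 :=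
  if_pos hx

theorem norm_psiPrime {ℓ : ℕ} {x : GaussianInt} (hx : ¬ (ℓ : ℤ) ∣ x.norm) : ‖psiPrime ℓ x‖ = 1 := by
  unfold psiPrime
  rw [if_neg hx]
  split_ifs <;> simp

theorem norm_psiPrime_le (ℓ : ℕ) (x : GaussianInt) : ‖psiPrime ℓ x‖ ≤ 1 := by
  by_cases hx : (ℓ : ℤ) ∣ x.norm
  · simp [psiPrime_of_dvd hx]
  · exact (norm_psiPrime hx).le

theorem psiPrime_mul {ℓ : ℕ} (hℓ : ℓ.Prime) (hodd : ℓ ≠ 2) (x y : GaussianInt) :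
    psiPrime ℓ (x * y) = psiPrime ℓ x * psiPrime ℓ y := by
  have hp : Prime (ℓ : ℤ) := Nat.prime_iff_prime_int.mp hℓ
  by_cases hx : (ℓ : ℤ) ∣ x.norm
  · rw [psiPrime_of_dvd hx, zero_mul, psiPrime_of_dvd]
    rw [Zsqrtd.norm_mul]; exact hx.mul_right _
  by_cases hy : (ℓ : ℤ) ∣ y.norm
  · rw [psiPrime_of_dvd hy, mul_zero, psiPrime_of_dvd]
    rw [Zsqrtd.norm_mul]; exact hy.mul_left _
  obtain ⟨u, hu, eu, du⟩ := exists_psiPrime hℓ hodd hx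
  obtain ⟨v, hv, ev, dv⟩ := exists_psiPrime hℓ hodd hy
  rw [eu, ev, ← map_mul]
  refine psiPrime_eq_of_dvd hℓ hodd ?_ (mul_mem_gaussUnits hu hv) ?_
  · rw [Zsqrtd.norm_mul]; exact fun h => (hp.dvd_or_dvd h).elim hx hy
  · rw [psiBase_mul, star_mul']
    convert dvd_add (du.mul_right (psiBase ℓ y))
      (dv.mul_right (u * star (psiBase ℓ x))) using 1
    ring

theorem psiPrime_congr {ℓ : ℕ} (hℓ : ℓ.Prime) (hodd : ℓ ≠ 2) {x y : GaussianInt}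
    (h : ((ℓ : ℤ) : GaussianInt) ∣ x - y) : psiPrime ℓ x = psiPrime ℓ y := by
  have hs : ((ℓ : ℤ) : GaussianInt) ∣ star x - star y := by
    obtain ⟨c, hc⟩ := h
    exact ⟨star c, by rw [← star_sub, hc, star_mul']; simp⟩
  have hn : (ℓ : ℤ) ∣ x.norm - y.norm := by
    have : ((ℓ : ℤ) : GaussianInt) ∣ ((x.norm - y.norm : ℤ) : GaussianInt) := by
      rw [Int.cast_sub, Zsqrtd.norm_eq_mul_conj, Zsqrtd.norm_eq_mul_conj]
      convert dvd_add (h.mul_right (star x)) (hs.mul_right y) using 1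
      ring
    have := ((Zsqrtd.intCast_dvd _ _).mp this).1
    simpa using this
  by_cases hx : (ℓ : ℤ) ∣ x.norm
  · rw [psiPrime_of_dvd hx, psiPrime_of_dvd]
    exact (dvd_iff_dvd_of_dvd_sub hn).mp hx
  have hy : ¬ (ℓ : ℤ) ∣ y.norm := fun hy => hx ((dvd_iff_dvd_of_dvd_sub hn).mpr hy)
  obtain ⟨u, hu, eu, du⟩ := exists_psiPrime hℓ hodd hx
  have hP : ((ℓ : ℤ) : GaussianInt) ∣ psiBase ℓ x - psiBase ℓ y := by
    unfold psiBase
    split_ifs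
    · exact h.trans (sub_dvd_pow_sub_pow _ _ _)
    · exact hs.trans (sub_dvd_pow_sub_pow _ _ _)
  have hPs : ((ℓ : ℤ) : GaussianInt) ∣ star (psiBase ℓ x) - star (psiBase ℓ y) := by
    obtain ⟨c, hc⟩ := hP
    exact ⟨star c, by rw [← star_sub, hc, star_mul']; simp⟩
  rw [eu, eq_comm]
  refine psiPrime_eq_of_dvd hℓ hodd hy hu ?_
  convert dvd_sub (dvd_add du (hPs.mul_left u)) hP using 1; ring

theorem psiPrime_intCast {ℓ : ℕ} (hℓ : ℓ.Prime) {t : ℤ} (ht : ¬ (ℓ : ℤ) ∣ t) :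
    psiPrime ℓ (t : GaussianInt) = 1 := by
  have hp : Prime (ℓ : ℤ) := Nat.prime_iff_prime_int.mp hℓ
  unfold psiPrime
  rw [if_neg, if_pos]
  · have : psiBase ℓ (t : GaussianInt) = ((if ℓ % 4 = 1 then t ^ ((ℓ - 1) / 4)
        else t ^ ((ℓ + 1) / 4) : ℤ) : GaussianInt) := by
      unfold psiBase
      split_ifs <;> simp
    rw [this, Zsqrtd.im_intCast]
    exact dvd_zero _
  · rw [Zsqrtd.norm_intCast]
    exact fun h => ht ((hp.dvd_or_dvd h).elim id id)

end QuarticSymbol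

theorem exists_psiPrime_ne_one {ℓ : ℕ} (hℓ : ℓ.Prime) (hodd : ℓ ≠ 2) :
    ∃ x : GaussianInt, ¬ (ℓ : ℤ) ∣ x.norm ∧ psiPrime ℓ x ≠ 1 := by
  by_contra! hcon
  have := Fact.mk hℓ
  have hmod : ℓ % 4 = 1 ∨ ℓ % 4 = 3 := by
    have := hℓ.eq_two_or_odd
    lia
  have h3 : 3 ≤ ℓ := by have := hℓ.two_le; lia
  let K := AlgebraicClosure (ZMod ℓ)
  have : CharP K ℓ := charP_of_injective_algebraMap (algebraMap (ZMod ℓ) K).injective ℓ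
  obtain ⟨j, hj⟩ : ∃ j : K, j ^ 2 = -1 := IsAlgClosed.exists_pow_nat_eq (-1 : K) (by norm_num)
  have hj0 : j ≠ 0 := by rintro rfl; norm_num at hj
  have h2 : (2 : K) ≠ 0 := by
    have : ((2 : ℕ) : K) ≠ 0 := by
      rw [Ne, CharP.cast_eq_zero_iff K ℓ]
      exact fun h => by have := Nat.le_of_dvd (by norm_num) h; lia
    exact_mod_cast this
  let φ : GaussianInt →+* K := Zsqrtd.lift ⟨j, by rw [← sq, hj]; simp⟩
  have hφ : ∀ z : GaussianInt, φ z = z.re + z.im * j := fun z => rfl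
  set E := if ℓ % 4 = 1 then (ℓ - 1) / 4 else (ℓ + 1) / 4 with hE
  have hE1 : 1 ≤ E ∧ 4 * E ≤ ℓ + 1 := by
    rw [hE]; split_ifs <;> lia
  set f : Polynomial K := (Polynomial.X + Polynomial.C j) ^ E -
    (Polynomial.X + Polynomial.C (-j)) ^ E with hf
  have hdeg : f.degree < E := by
    rw [Polynomial.degree_lt_iff_coeff_zero]
    intro m hm
    rw [hf, Polynomial.coeff_sub, Polynomial.coeff_X_add_C_pow, Polynomial.coeff_X_add_C_pow]
    rcases hm.eq_or_lt with rfl | hm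
    · simp
    · simp [Nat.choose_eq_zero_of_lt hm]
  have hne : f ≠ 0 := by
    intro h0
    have h1 : f.coeff (E - 1) = 0 := by rw [h0]; simp
    rw [hf, Polynomial.coeff_sub, Polynomial.coeff_X_add_C_pow, Polynomial.coeff_X_add_C_pow,
      show E - (E - 1) = 1 by lia, Nat.choose_symm (show 1 ≤ E by lia), Nat.choose_one_right] at h1
    have hE0 : (E : K) ≠ 0 := by
      rw [Ne, CharP.cast_eq_zero_iff K ℓ]
      exact fun h => by have := Nat.le_of_dvd (by lia) h; lia
    have : 2 * j * E = 0 := by linear_combination h1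
    exact mul_ne_zero (mul_ne_zero h2 hj0) hE0 this
  set s : Finset (ZMod ℓ) := Finset.univ.filter fun a => a ^ 2 + 1 ≠ 0 with hs
  have hscard : ℓ ≤ s.card + 2 := by
    have h1 : (Finset.univ.filter fun a : ZMod ℓ => a ^ 2 + 1 = 0).card ≤ 2 := by
      have hd : (Polynomial.X ^ 2 + Polynomial.C 1 : Polynomial (ZMod ℓ)).natDegree = 2 :=
        Polynomial.natDegree_X_pow_add_C
      refine le_trans ?_ hd.le
      refine Polynomial.card_le_degree_of_subset_roots fun a ha => ?_
      have hn0 : (Polynomial.X ^ 2 + Polynomial.C 1 : Polynomial (ZMod ℓ)) ≠ 0 := by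
        intro h; rw [h] at hd; simp at hd
      rw [Polynomial.mem_roots hn0]
      simpa using ha
    have h4 := Finset.card_filter_add_card_filter_not (s := (Finset.univ : Finset (ZMod ℓ)))
      (fun a => a ^ 2 + 1 = 0)
    rw [Finset.card_univ, ZMod.card] at h4
    change _ + s.card = ℓ at h4
    lia
  refine hne (Polynomial.eq_zero_of_natDegree_lt_card_of_eval_eq_zero' f
    (s.map ⟨algebraMap (ZMod ℓ) K, (algebraMap (ZMod ℓ) K).injective⟩) ?_ ?_)
  · intro y hy
    obtain ⟨a, ha, rfl⟩ := Finset.mem_map.mp hy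
    simp only [Function.Embedding.coeFn_mk]
    set x : GaussianInt := ⟨a.val, 1⟩ with hx
    have hxn : ¬ (ℓ : ℤ) ∣ x.norm := by
      have : a ^ 2 + 1 ≠ 0 := (Finset.mem_filter.mp ha).2
      rw [← ZMod.intCast_zmod_eq_zero_iff_dvd]
      simpa [hx, Zsqrtd.norm_def, sq] using this
    have h1 := hcon x hxn
    have h5 : (ℓ : ℤ) ∣ (psiBase ℓ x).im := by
      by_contra h
      unfold psiPrime at h1
      rw [if_neg hxn, if_neg h] at h1
      split_ifs at h1
      · norm_num at h1
      · simp [Complex.ext_iff] at h1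
      · simp [Complex.ext_iff] at h1
    have h6 : (ℓ : ℤ) ∣ (x ^ E).im := by
      rw [hE]
      unfold psiBase at h5
      split_ifs at h5 ⊢
      · exact h5
      · rw [← star_pow, Zsqrtd.im_star, dvd_neg] at h5
        exact h5
    have h7 : (((x ^ E).im : ℤ) : K) = 0 := (CharP.intCast_eq_zero_iff K ℓ _).mpr h6
    have hax : (algebraMap (ZMod ℓ) K) a = (a.val : K) := by
      conv_lhs => rw [← ZMod.natCast_zmod_val a]
      rw [map_natCast]
    have e1 : (algebraMap (ZMod ℓ) K) a + j = φ x := by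
      rw [hφ, hax]; simp only [hx]; push_cast; ring
    have e2 : (algebraMap (ZMod ℓ) K) a + -j = φ (star x) := by
      rw [hφ, hax, Zsqrtd.re_star, Zsqrtd.im_star]; simp only [hx]; push_cast; ring
    rw [hf]
    simp only [Polynomial.eval_sub, Polynomial.eval_pow, Polynomial.eval_add, Polynomial.eval_X,
      Polynomial.eval_C]
    rw [e1, e2, ← map_pow, ← map_pow, ← star_pow, hφ, hφ, Zsqrtd.re_star, Zsqrtd.im_star]
    push_cast
    rw [h7]; ring
  · rw [Finset.card_map]
    have := (Polynomial.natDegree_lt_iff_degree_lt hne).mpr hdeg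
    lia

theorem ZMod.sum_val_eq_sum_range (m : ℕ) [NeZero m] (F : ℕ → ℂ) :
    ∑ x : ZMod m, F x.val = ∑ i ∈ Finset.range m, F i := by
  refine Finset.sum_nbij' (fun x => x.val) (fun i => (i : ZMod m)) ?_ ?_ ?_ ?_ ?_
  · exact fun x _ => Finset.mem_range.mpr x.val_lt
  · simp
  · exact fun x _ => by simp
  · exact fun i hi => ZMod.val_cast_of_lt (Finset.mem_range.mp hi)
  · simp

/-- The discrete Fourier transform modulo `m` of a function on `ℤ[i]`. -/
def gaussFT (m : ℕ) (f : GaussianInt → ℂ) (k : GaussianInt) : ℂ :=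
  ∑ a ∈ Finset.range m, ∑ b ∈ Finset.range m, f ⟨a, b⟩ *
    Complex.exp (2 * Real.pi * I * ((k.re * a + k.im * b : ℤ) / m))

theorem gaussFT_eq_sum_zmod (m : ℕ) [NeZero m] (f : GaussianInt → ℂ) (k : GaussianInt) :
    gaussFT m f k = ∑ a : ZMod m, ∑ b : ZMod m, f ⟨a.val, b.val⟩ *
      ZMod.stdAddChar (((k.re : ℤ) : ZMod m) * a + ((k.im : ℤ) : ZMod m) * b) := by
  unfold gaussFT
  rw [← ZMod.sum_val_eq_sum_range m]
  refine Finset.sum_congr rfl fun a _ => ?_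
  rw [← ZMod.sum_val_eq_sum_range m]
  refine Finset.sum_congr rfl fun b _ => ?_
  have : ((k.re : ℤ) : ZMod m) * a + ((k.im : ℤ) : ZMod m) * b = ((k.re * a.val + k.im * b.val : ℤ) : ZMod m) := by
    simp
  rw [this, ZMod.stdAddChar_coe]
  congr 2
  push_cast
  ring

theorem sum_mul_stdAddChar_of_homogeneous {ℓ : ℕ} [Fact ℓ.Prime] (h : ZMod ℓ → ZMod ℓ → ℂ)
    (hh : ∀ t a b, t ≠ 0 → h (t * a) (t * b) = h a b) (k l : ZMod ℓ) (hkl : k ≠ 0 ∨ l ≠ 0) :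
    ((ℓ : ℂ) - 1) * (∑ a, ∑ b, h a b * ZMod.stdAddChar (k * a + l * b)) + ∑ a, ∑ b, h a b =
      ℓ * (h 0 0 + ((ℓ : ℂ) - 1) * h (-l) k) := by
  have hprim := ZMod.isPrimitive_stdAddChar ℓ
  have horth : ∀ a b : ZMod ℓ, ∑ t : ZMod ℓ, (ZMod.stdAddChar (t * (k * a + l * b)) : ℂ) =
      if k * a + l * b = 0 then (ℓ : ℂ) else 0 := by
    intro a b
    rw [AddChar.sum_mulShift _ hprim]
    simp [ZMod.card]
  have h1 : ∑ t : ZMod ℓ, ∑ a, ∑ b, h a b * (ZMod.stdAddChar (t * (k * a + l * b)) : ℂ) =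
      ((ℓ : ℂ) - 1) * (∑ a, ∑ b, h a b * ZMod.stdAddChar (k * a + l * b)) + ∑ a, ∑ b, h a b := by
    rw [← Finset.sum_erase_add _ _ (Finset.mem_univ (0 : ZMod ℓ))]
    congr 1
    · rw [Finset.sum_congr rfl (g := fun _ => ∑ a, ∑ b, h a b * ZMod.stdAddChar (k * a + l * b))]
      · rw [Finset.sum_const, Finset.card_erase_of_mem (Finset.mem_univ _), Finset.card_univ,
          ZMod.card, nsmul_eq_mul, Nat.cast_sub (Fact.out : ℓ.Prime).one_le, Nat.cast_one]
      · intro t ht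
        have ht0 : t ≠ 0 := Finset.ne_of_mem_erase ht
        rw [← (mulLeft_bijective₀ t ht0).sum_comp (fun a => ∑ b, h a b *
          (ZMod.stdAddChar (k * a + l * b) : ℂ))]
        refine Finset.sum_congr rfl fun a _ => ?_
        rw [← (mulLeft_bijective₀ t ht0).sum_comp (fun b => h (t * a) b *
          (ZMod.stdAddChar (k * (t * a) + l * b) : ℂ))]
        refine Finset.sum_congr rfl fun b _ => ?_
        rw [hh t a b ht0]
        congr 2; ring
    · simp
  rw [← h1, Finset.sum_comm]
  have h2 : ∀ a, ∑ t : ZMod ℓ, ∑ b, h a b * (ZMod.stdAddChar (t * (k * a + l * b)) : ℂ) =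
      ∑ b, if k * a + l * b = 0 then ℓ * h a b else 0 := by
    intro a
    rw [Finset.sum_comm]
    refine Finset.sum_congr rfl fun b _ => ?_
    rw [← Finset.mul_sum, horth]
    split_ifs <;> ring
  simp_rw [h2]
  rw [← Finset.sum_product', Finset.univ_product_univ, ← Finset.sum_filter]
  have h3 : (Finset.univ.filter fun p : ZMod ℓ × ZMod ℓ => k * p.1 + l * p.2 = 0) =
      Finset.univ.image fun t : ZMod ℓ => (t * -l, t * k) := by
    ext ⟨a, b⟩
    simp only [Finset.mem_filter, Finset.mem_univ, true_and, Finset.mem_image, Prod.mk.injEq]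
    constructor
    · intro hab
      rcases hkl with hk | hl
      · refine ⟨b / k, ?_, by field_simp⟩
        field_simp
        linear_combination -hab
      · refine ⟨-a / l, by field_simp, ?_⟩
        field_simp
        linear_combination -hab
    · rintro ⟨t, rfl, rfl⟩; ring
  rw [h3, Finset.sum_image]
  · rw [← Finset.sum_erase_add _ _ (Finset.mem_univ (0 : ZMod ℓ)),
      Finset.sum_congr rfl (g := fun _ => ℓ * h (-l) k)]
    · rw [Finset.sum_const, Finset.card_erase_of_mem (Finset.mem_univ _), Finset.card_univ,
          ZMod.card, nsmul_eq_mul, Nat.cast_sub (Fact.out : ℓ.Prime).one_le, Nat.cast_one]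
      simp only [zero_mul]
      ring
    · intro t ht
      rw [hh t _ _ (Finset.ne_of_mem_erase ht)]
  · intro t _ t' _ he
    obtain ⟨e1, e2⟩ := Prod.mk.inj he
    rcases hkl with hk | hl
    · exact mul_right_cancel₀ hk e2
    · exact mul_right_cancel₀ (neg_ne_zero.mpr hl) e1

/-- `f` is a function on `ℤ[i]` that factors through the reduction modulo `ℓ` and is constant on
lines through the origin. -/
def HomogeneousMod (ℓ : ℕ) (f : GaussianInt → ℂ) : Prop :=
  (∀ x y : GaussianInt, ((ℓ : ℤ) : GaussianInt) ∣ x - y → f x = f y) ∧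
    ∀ (t : ℤ) (x : GaussianInt), ¬ (ℓ : ℤ) ∣ t → f (t * x) = f x

theorem homogeneousMod_psiPrime {ℓ : ℕ} (hℓ : ℓ.Prime) (hodd : ℓ ≠ 2) :
    HomogeneousMod ℓ (psiPrime ℓ) :=
  ⟨fun _ _ h => psiPrime_congr hℓ hodd h, fun t x ht => by
    rw [psiPrime_mul hℓ hodd, psiPrime_intCast hℓ ht, one_mul]⟩

theorem HomogeneousMod.conj {ℓ : ℕ} {f : GaussianInt → ℂ} (hf : HomogeneousMod ℓ f) :
    HomogeneousMod ℓ (fun x => conj (f x)) :=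
  ⟨fun x y h => by simp only [hf.1 x y h], fun t x ht => by simp only [hf.2 t x ht]⟩

theorem HomogeneousMod.mul {ℓ : ℕ} {f h : GaussianInt → ℂ} (hf : HomogeneousMod ℓ f)
    (hh : HomogeneousMod ℓ h) : HomogeneousMod ℓ (fun x => f x * h x) :=
  ⟨fun x y e => by simp only [hf.1 x y e, hh.1 x y e],
    fun t x ht => by simp only [hf.2 t x ht, hh.2 t x ht]⟩

theorem gaussInt_intCast_dvd_of_zmod {ℓ : ℕ} {x y : GaussianInt}
    (hre : (x.re : ZMod ℓ) = y.re) (him : (x.im : ZMod ℓ) = y.im) :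
    ((ℓ : ℤ) : GaussianInt) ∣ x - y := by
  rw [Zsqrtd.intCast_dvd]
  constructor
  · rw [Zsqrtd.re_sub, ← ZMod.intCast_zmod_eq_zero_iff_dvd]; push_cast; rw [hre, sub_self]
  · rw [Zsqrtd.im_sub, ← ZMod.intCast_zmod_eq_zero_iff_dvd]; push_cast; rw [him, sub_self]

theorem gaussFT_congr {m : ℕ} [NeZero m] (f : GaussianInt → ℂ) {k l : GaussianInt}
    (h : ((m : ℤ) : GaussianInt) ∣ k - l) : gaussFT m f k = gaussFT m f l := by
  rw [Zsqrtd.intCast_dvd, Zsqrtd.re_sub, Zsqrtd.im_sub, ← ZMod.intCast_zmod_eq_zero_iff_dvd,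
    ← ZMod.intCast_zmod_eq_zero_iff_dvd] at h
  push_cast at h
  rw [gaussFT_eq_sum_zmod, gaussFT_eq_sum_zmod, sub_eq_zero.mp h.1, sub_eq_zero.mp h.2]

theorem norm_gaussFT_le {m : ℕ} {f : GaussianInt → ℂ} (hf : ∀ x, ‖f x‖ ≤ 1) (k : GaussianInt) :
    ‖gaussFT m f k‖ ≤ (m : ℝ) ^ 2 := by
  unfold gaussFT
  refine (norm_sum_le _ _).trans ?_
  refine (Finset.sum_le_card_nsmul _ _ (m : ℝ) fun a _ => ?_).trans
    (by rw [Finset.card_range, nsmul_eq_mul, sq])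
  refine (norm_sum_le _ _).trans ?_
  refine (Finset.sum_le_card_nsmul _ _ (1 : ℝ) fun b _ => ?_).trans
    (by rw [Finset.card_range, nsmul_eq_mul, mul_one])
  rw [norm_mul]
  have : ‖Complex.exp (2 * Real.pi * I * ((k.re * a + k.im * b : ℤ) / m))‖ = 1 := by
    rw [Complex.norm_exp]
    rw [show (2 * Real.pi * I * ((k.re * a + k.im * b : ℤ) / m) : ℂ) =
      ((2 * Real.pi * ((k.re * a + k.im * b : ℤ) / m) : ℝ) : ℂ) * I by push_cast; ring]
    simp
  rw [this, mul_one]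
  exact hf _

theorem HomogeneousMod.gaussFT_eq {ℓ : ℕ} (hℓ : ℓ.Prime) {f : GaussianInt → ℂ}
    (hf : HomogeneousMod ℓ f) (h0 : f 0 = 0) (hs : gaussFT ℓ f 0 = 0) (k : GaussianInt) :
    gaussFT ℓ f k = ℓ * f (⟨0, 1⟩ * k) := by
  have := Fact.mk hℓ
  by_cases hk : ((ℓ : ℤ) : GaussianInt) ∣ k
  · rw [gaussFT_congr f (l := 0) (by simpa using hk), hs, hf.1 _ 0 (by simpa using hk.mul_left _),
      h0, mul_zero]
  have key := sum_mul_stdAddChar_of_homogeneous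
    (fun a b : ZMod ℓ => f ⟨a.val, b.val⟩) (fun t a b ht => ?_) (k.re : ZMod ℓ) k.im ?_
  · have e0 : ∑ a : ZMod ℓ, ∑ b : ZMod ℓ, f ⟨a.val, b.val⟩ = gaussFT ℓ f 0 := by
      rw [gaussFT_eq_sum_zmod]; simp
    rw [e0, hs, ← gaussFT_eq_sum_zmod] at key
    have e1 : f ⟨(0 : ZMod ℓ).val, (0 : ZMod ℓ).val⟩ = 0 := by
      rw [← h0]; simp; rfl
    have e2 : f ⟨(-(k.im : ZMod ℓ)).val, (k.re : ZMod ℓ).val⟩ = f (⟨0, 1⟩ * k) := by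
      apply hf.1
      apply gaussInt_intCast_dvd_of_zmod
      · simp [Zsqrtd.re_mul]
      · simp [Zsqrtd.im_mul]
    rw [e1, e2] at key
    have h1 : (ℓ : ℂ) - 1 ≠ 0 := by
      rw [sub_ne_zero]; exact_mod_cast hℓ.one_lt.ne'
    apply mul_left_cancel₀ h1
    linear_combination key
  · obtain ⟨t, rfl⟩ := ZMod.intCast_surjective t
    rw [← hf.2 t ⟨a.val, b.val⟩]
    · apply hf.1
      apply gaussInt_intCast_dvd_of_zmod
      · simp
      · simp
    · rw [← ZMod.intCast_zmod_eq_zero_iff_dvd]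
      exact ht
  · by_contra! hcon
    apply hk
    have := gaussInt_intCast_dvd_of_zmod (ℓ := ℓ) (x := k) (y := 0) (by simpa using hcon.1)
      (by simpa using hcon.2)
    simpa using this

theorem gaussFT_psiPrime_zero {ℓ : ℕ} (hℓ : ℓ.Prime) (hodd : ℓ ≠ 2) :
    gaussFT ℓ (psiPrime ℓ) 0 = 0 := by
  have := Fact.mk hℓ
  obtain ⟨x, hx, hx1⟩ := exists_psiPrime_ne_one hℓ hodd
  have hf := homogeneousMod_psiPrime hℓ hodd
  have e0 : gaussFT ℓ (psiPrime ℓ) 0 =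
      ∑ p : ZMod ℓ × ZMod ℓ, psiPrime ℓ ⟨p.1.val, p.2.val⟩ := by
    rw [gaussFT_eq_sum_zmod, Fintype.sum_prod_type]; simp
  set T : ZMod ℓ × ZMod ℓ → ZMod ℓ × ZMod ℓ := fun p =>
    (x.re * p.1 - x.im * p.2, x.im * p.1 + x.re * p.2) with hT
  have hn : (x.re : ZMod ℓ) ^ 2 + (x.im : ZMod ℓ) ^ 2 ≠ 0 := by
    intro h
    apply hx
    rw [← ZMod.intCast_zmod_eq_zero_iff_dvd, Zsqrtd.norm_def]
    push_cast
    linear_combination h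
  have hinj : Function.Injective T := by
    rintro ⟨a, b⟩ ⟨c, d⟩ h
    simp only [hT, Prod.mk.injEq] at h
    obtain ⟨h1, h2⟩ := h
    have e1 : ((x.re : ZMod ℓ) ^ 2 + (x.im : ZMod ℓ) ^ 2) * (a - c) = 0 := by
      linear_combination (x.re : ZMod ℓ) * h1 + (x.im : ZMod ℓ) * h2
    have e2 : ((x.re : ZMod ℓ) ^ 2 + (x.im : ZMod ℓ) ^ 2) * (b - d) = 0 := by
      linear_combination -(x.im : ZMod ℓ) * h1 + (x.re : ZMod ℓ) * h2
    rw [sub_eq_zero.mp ((mul_eq_zero.mp e1).resolve_left hn),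
      sub_eq_zero.mp ((mul_eq_zero.mp e2).resolve_left hn)]
  have hbij := Finite.injective_iff_bijective.mp hinj
  have h1 := hbij.sum_comp (fun p : ZMod ℓ × ZMod ℓ => psiPrime ℓ ⟨p.1.val, p.2.val⟩)
  have h2 : ∀ p, psiPrime ℓ ⟨(T p).1.val, (T p).2.val⟩ =
      psiPrime ℓ x * psiPrime ℓ ⟨p.1.val, p.2.val⟩ := by
    intro p
    rw [← psiPrime_mul hℓ hodd]
    apply hf.1
    apply gaussInt_intCast_dvd_of_zmod
    · simp [hT, Zsqrtd.re_mul, sub_eq_add_neg]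
    · simp [hT, Zsqrtd.im_mul]; ring
  simp_rw [h2] at h1
  rw [← Finset.mul_sum, ← e0] at h1
  have h3 : psiPrime ℓ x - 1 ≠ 0 := sub_ne_zero.mpr hx1
  apply mul_left_cancel₀ h3
  linear_combination h1

theorem psiPrime_zero (ℓ : ℕ) : psiPrime ℓ 0 = 0 := psiPrime_of_dvd (by simp)

theorem gaussFT_psiPrime {ℓ : ℕ} (hℓ : ℓ.Prime) (hodd : ℓ ≠ 2) (k : GaussianInt) :
    gaussFT ℓ (psiPrime ℓ) k = ℓ * psiPrime ℓ ⟨0, 1⟩ * psiPrime ℓ k := by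
  rw [(homogeneousMod_psiPrime hℓ hodd).gaussFT_eq hℓ (psiPrime_zero ℓ)
    (gaussFT_psiPrime_zero hℓ hodd), psiPrime_mul hℓ hodd, mul_assoc]

theorem gaussFT_conj_psiPrime {ℓ : ℕ} (hℓ : ℓ.Prime) (hodd : ℓ ≠ 2) (k : GaussianInt) :
    gaussFT ℓ (fun x => conj (psiPrime ℓ x)) k =
      ℓ * conj (psiPrime ℓ ⟨0, 1⟩) * conj (psiPrime ℓ k) := by
  rw [(homogeneousMod_psiPrime hℓ hodd).conj.gaussFT_eq hℓ (by simp [psiPrime_zero]),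
    psiPrime_mul hℓ hodd, map_mul, mul_assoc]
  have := Fact.mk hℓ
  have h := gaussFT_psiPrime_zero hℓ hodd
  rw [gaussFT_eq_sum_zmod] at h ⊢
  have h' := congrArg (starRingEnd ℂ) h
  simpa using h'

theorem sum_range_mul_of_coprime {a b : ℕ} (ha : 0 < a) (hb : 0 < b) (hab : a.Coprime b)
    {G : ℤ → ℂ} (hG : ∀ x y : ℤ, ((a * b : ℕ) : ℤ) ∣ x - y → G x = G y) :
    ∑ x ∈ Finset.range (a * b), G x =
      ∑ y ∈ Finset.range a, ∑ z ∈ Finset.range b, G (b * y + a * z) := by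
  have hinj : Set.InjOn (fun p : ℕ × ℕ => (b * p.1 + a * p.2) % (a * b))
      (Finset.range a ×ˢ Finset.range b : Finset (ℕ × ℕ)) := by
    rintro ⟨y, z⟩ h1 ⟨y', z'⟩ h2 h
    simp only [Finset.coe_product, Set.mem_prod, Finset.mem_coe, Finset.mem_range] at h1 h2
    change (b * y + a * z) ≡ (b * y' + a * z') [MOD (a * b)] at h
    have hy : y ≡ y' [MOD a] := by
      have h3 := h.of_mul_right b
      have h4 : b * y ≡ b * y' [MOD a] := by
        have e1 : b * y + a * z ≡ b * y [MOD a] := by simp [Nat.ModEq]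
        have e2 : b * y' + a * z' ≡ b * y' [MOD a] := by simp [Nat.ModEq]
        exact e1.symm.trans (h3.trans e2)
      exact Nat.ModEq.cancel_left_of_coprime hab h4
    have hz : z ≡ z' [MOD b] := by
      have h3 := h.of_mul_left a
      have h4 : a * z ≡ a * z' [MOD b] := by
        have e1 : b * y + a * z ≡ a * z [MOD b] := by simp [Nat.ModEq]
        have e2 : b * y' + a * z' ≡ a * z' [MOD b] := by simp [Nat.ModEq]
        exact e1.symm.trans (h3.trans e2)
      exact Nat.ModEq.cancel_left_of_coprime hab.symm h4
    rw [Prod.mk.injEq]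
    exact ⟨Nat.ModEq.eq_of_lt_of_lt hy h1.1 h2.1, Nat.ModEq.eq_of_lt_of_lt hz h1.2 h2.2⟩
  have himg : (Finset.range a ×ˢ Finset.range b).image
      (fun p : ℕ × ℕ => (b * p.1 + a * p.2) % (a * b)) = Finset.range (a * b) := by
    apply Finset.eq_of_subset_of_card_le
    · intro x hx
      obtain ⟨p, _, rfl⟩ := Finset.mem_image.mp hx
      exact Finset.mem_range.mpr (Nat.mod_lt _ (Nat.mul_pos ha hb))
    · rw [Finset.card_image_of_injOn hinj, Finset.card_product]; simp
  rw [← himg, Finset.sum_image hinj, Finset.sum_product]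
  refine Finset.sum_congr rfl fun y _ => Finset.sum_congr rfl fun z _ => hG _ _ ?_
  have := (Int.mod_modEq (b * y + a * z : ℤ) ((a * b : ℕ) : ℤ)).symm.dvd
  exact_mod_cast this

theorem gaussFT_mul {a b : ℕ} (ha : 0 < a) (hb : 0 < b) (hab : a.Coprime b)
    {F H : GaussianInt → ℂ}
    (hF : ∀ x y : GaussianInt, ((a : ℤ) : GaussianInt) ∣ x - y → F x = F y)
    (hH : ∀ x y : GaussianInt, ((b : ℤ) : GaussianInt) ∣ x - y → H x = H y)
    (hFb : ∀ x : GaussianInt, F ((b : ℤ) * x) = F x)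
    (hHa : ∀ x : GaussianInt, H ((a : ℤ) * x) = H x) (k : GaussianInt) :
    gaussFT (a * b) (fun x => F x * H x) k = gaussFT a F k * gaussFT b H k := by
  have ha0 : (a : ℂ) ≠ 0 := by exact_mod_cast ha.ne'
  have hb0 : (b : ℂ) ≠ 0 := by exact_mod_cast hb.ne'
  set e : ℕ → ℤ → ℂ := fun m t => Complex.exp (2 * Real.pi * I * (t / m)) with he
  have heper : ∀ (m : ℕ) (s t : ℤ), 0 < m → (m : ℤ) ∣ s - t → e m s = e m t := by
    intro m s t hm ⟨c, hc⟩
    have hm0 : (m : ℂ) ≠ 0 := by exact_mod_cast hm.ne'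
    simp only [he]
    rw [Complex.exp_eq_exp_iff_exists_int]
    refine ⟨c, ?_⟩
    have hs : (s : ℂ) = t + m * c := by
      have : s = t + m * c := by linear_combination hc
      exact_mod_cast this
    rw [hs]; field_simp
  have hcast : ∀ (m : ℕ) (p q x y : ℤ), (m : ℤ) ∣ p - x → (m : ℤ) ∣ q - y →
      ((m : ℤ) : GaussianInt) ∣ (⟨p, q⟩ : GaussianInt) - ⟨x, y⟩ := by
    intro m p q x y h1 h2
    rw [Zsqrtd.intCast_dvd]
    exact ⟨by simpa using h1, by simpa using h2⟩
  have hG : ∀ p q x y : ℤ, ((a * b : ℕ) : ℤ) ∣ p - x → ((a * b : ℕ) : ℤ) ∣ q - y →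
      F ⟨p, q⟩ * H ⟨p, q⟩ * e (a * b) (k.re * p + k.im * q) =
      F ⟨x, y⟩ * H ⟨x, y⟩ * e (a * b) (k.re * x + k.im * y) := by
    intro p q x y h1 h2
    have hda : (a : ℤ) ∣ ((a * b : ℕ) : ℤ) := by exact_mod_cast dvd_mul_right a b
    have hdb : (b : ℤ) ∣ ((a * b : ℕ) : ℤ) := by exact_mod_cast dvd_mul_left b a
    rw [hF ⟨p, q⟩ ⟨x, y⟩ (hcast _ _ _ _ _ (hda.trans h1) (hda.trans h2)),
      hH ⟨p, q⟩ ⟨x, y⟩ (hcast _ _ _ _ _ (hdb.trans h1) (hdb.trans h2)),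
      heper (a * b) _ (k.re * x + k.im * y) (Nat.mul_pos ha hb)]
    have : k.re * p + k.im * q - (k.re * x + k.im * y) = k.re * (p - x) + k.im * (q - y) := by ring
    rw [this]
    exact dvd_add (h1.mul_left _) (h2.mul_left _)
  have h0 : gaussFT (a * b) (fun x => F x * H x) k = ∑ p ∈ Finset.range (a * b),
      ∑ q ∈ Finset.range (a * b), F ⟨p, q⟩ * H ⟨p, q⟩ * e (a * b) (k.re * p + k.im * q) := rfl
  have h1 : ∀ p : ℤ, ∑ q ∈ Finset.range (a * b), F ⟨p, q⟩ * H ⟨p, q⟩ *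
      e (a * b) (k.re * p + k.im * q) = ∑ y ∈ Finset.range a, ∑ z ∈ Finset.range b,
      F ⟨p, b * y + a * z⟩ * H ⟨p, b * y + a * z⟩ *
        e (a * b) (k.re * p + k.im * (b * y + a * z)) := fun p =>
    sum_range_mul_of_coprime ha hb hab
      (G := fun q => F ⟨p, q⟩ * H ⟨p, q⟩ * e (a * b) (k.re * p + k.im * q))
      fun q q' hq => hG p q p q' (by simp) hq
  rw [h0]
  simp_rw [h1]
  rw [sum_range_mul_of_coprime ha hb hab (G := fun p => ∑ y ∈ Finset.range a,
    ∑ z ∈ Finset.range b, F ⟨p, b * y + a * z⟩ * H ⟨p, b * y + a * z⟩ *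
        e (a * b) (k.re * p + k.im * (b * y + a * z)))
    fun p p' hp => Finset.sum_congr rfl fun y _ => Finset.sum_congr rfl fun z _ =>
      hG p _ p' _ hp (by simp)]
  have hFT : ∀ m f, gaussFT m f k = ∑ p ∈ Finset.range m, ∑ q ∈ Finset.range m, f ⟨p, q⟩ *
    e m (k.re * p + k.im * q) := fun _ _ => rfl
  rw [hFT, hFT, Finset.sum_mul_sum]
  refine Finset.sum_congr rfl fun y1 _ => Finset.sum_congr rfl fun z1 _ => ?_
  rw [Finset.sum_mul_sum]
  refine Finset.sum_congr rfl fun y2 _ => Finset.sum_congr rfl fun z2 _ => ?_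
  have eF : F ⟨b * y1 + a * z1, b * y2 + a * z2⟩ = F ⟨y1, y2⟩ := by
    rw [← hFb ⟨y1, y2⟩]
    apply hF
    rw [Zsqrtd.intCast_dvd]
    exact ⟨by simp, by simp⟩
  have eH : H ⟨b * y1 + a * z1, b * y2 + a * z2⟩ = H ⟨z1, z2⟩ := by
    rw [← hHa ⟨z1, z2⟩]
    apply hH
    rw [Zsqrtd.intCast_dvd]
    exact ⟨by simp, by simp⟩
  have ee : e (a * b) (k.re * (b * y1 + a * z1) + k.im * (b * y2 + a * z2)) =
      e a (k.re * y1 + k.im * y2) * e b (k.re * z1 + k.im * z2) := by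
    simp only [he]
    rw [← Complex.exp_add]
    congr 1
    push_cast
    field_simp
    ring
  rw [eF, eH, ee]
  ring

theorem gaussFT_prod {S : Finset ℕ} (hS : ∀ ℓ ∈ S, ℓ.Prime) {f : ℕ → GaussianInt → ℂ}
    (hf : ∀ ℓ ∈ S, HomogeneousMod ℓ (f ℓ)) (k : GaussianInt) :
    gaussFT (∏ ℓ ∈ S, ℓ) (fun x => ∏ ℓ ∈ S, f ℓ x) k = ∏ ℓ ∈ S, gaussFT ℓ (f ℓ) k := by
  induction S using Finset.induction_on with
  | empty => simp [gaussFT]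
  | insert p S hp ih =>
    have hpp := hS p (Finset.mem_insert_self _ _)
    have hS' : ∀ ℓ ∈ S, ℓ.Prime := fun ℓ hℓ => hS ℓ (Finset.mem_insert_of_mem hℓ)
    have hf' : ∀ ℓ ∈ S, HomogeneousMod ℓ (f ℓ) := fun ℓ hℓ => hf ℓ (Finset.mem_insert_of_mem hℓ)
    have hcop : ∀ ℓ ∈ S, p.Coprime ℓ := fun ℓ hℓ =>
      (Nat.coprime_primes hpp (hS' ℓ hℓ)).mpr fun h => hp (h ▸ hℓ)
    rw [Finset.prod_insert hp, Finset.prod_insert hp, ← ih hS' hf']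
    simp_rw [Finset.prod_insert hp]
    refine gaussFT_mul hpp.pos (Finset.prod_pos fun ℓ hℓ => (hS' ℓ hℓ).pos)
      (Nat.Coprime.prod_right hcop) (hf p (Finset.mem_insert_self _ _)).1 ?_ ?_ ?_ k
    · intro x y hxy
      refine Finset.prod_congr rfl fun ℓ hℓ => (hf' ℓ hℓ).1 x y (dvd_trans ?_ hxy)
      exact map_dvd (Int.castRingHom GaussianInt) (Int.natCast_dvd_natCast.mpr
        (Finset.dvd_prod_of_mem (fun ℓ => ℓ) hℓ))
    · intro x
      apply (hf p (Finset.mem_insert_self _ _)).2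
      rw [Int.natCast_dvd_natCast]
      exact fun h => hpp.one_lt.ne' (Nat.Coprime.eq_one_of_dvd (Nat.Coprime.prod_right hcop) h)
    · intro x
      refine Finset.prod_congr rfl fun ℓ hℓ => (hf' ℓ hℓ).2 _ _ ?_
      rw [Int.natCast_dvd_natCast]
      exact fun h => (hS' ℓ hℓ).one_lt.ne'
        (Nat.Coprime.eq_one_of_dvd (hcop ℓ hℓ).symm h)

/-- The multiplicative extension of `psiPrime` to odd squarefree moduli. -/
def psi (m : ℕ) (x : GaussianInt) : ℂ := ∏ ℓ ∈ m.primeFactors, psiPrime ℓ x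

theorem ne_two_of_mem_primeFactors {m ℓ : ℕ} (hm : Odd m) (h : ℓ ∈ m.primeFactors) : ℓ ≠ 2 := by
  rintro rfl
  exact (Nat.not_even_iff_odd.mpr hm) (even_iff_two_dvd.mpr (Nat.dvd_of_mem_primeFactors h))

theorem psi_mul {m : ℕ} (hm : Odd m) (x y : GaussianInt) : psi m (x * y) = psi m x * psi m y := by
  unfold psi
  rw [← Finset.prod_mul_distrib]
  exact Finset.prod_congr rfl fun ℓ hℓ =>
    psiPrime_mul (Nat.prime_of_mem_primeFactors hℓ) (ne_two_of_mem_primeFactors hm hℓ) x y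

theorem prod_primeFactors_mul_of_coprime {m n : ℕ} (h : m.Coprime n) (f : ℕ → ℂ) :
    ∏ ℓ ∈ (m * n).primeFactors, f ℓ = (∏ ℓ ∈ m.primeFactors, f ℓ) * ∏ ℓ ∈ n.primeFactors, f ℓ := by
  rw [h.primeFactors_mul, Finset.prod_union h.disjoint_primeFactors]

theorem psi_coprime_mul {m n : ℕ} (h : m.Coprime n) (x : GaussianInt) :
    psi (m * n) x = psi m x * psi n x :=
  prod_primeFactors_mul_of_coprime h _

theorem norm_psi_le (m : ℕ) (x : GaussianInt) : ‖psi m x‖ ≤ 1 := by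
  unfold psi
  rw [norm_prod]
  exact Finset.prod_le_one (fun _ _ => norm_nonneg _) fun ℓ _ => norm_psiPrime_le ℓ x

theorem psi_zero {m : ℕ} (hm : 1 < m) : psi m 0 = 0 := by
  obtain ⟨p, hp⟩ := Nat.nonempty_primeFactors.mpr hm
  exact Finset.prod_eq_zero hp (psiPrime_zero p)

theorem psi_congr {m : ℕ} (hm : Odd m) {x y : GaussianInt}
    (h : ((m : ℤ) : GaussianInt) ∣ x - y) : psi m x = psi m y := by
  refine Finset.prod_congr rfl fun ℓ hℓ => psiPrime_congr (Nat.prime_of_mem_primeFactors hℓ)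
    (ne_two_of_mem_primeFactors hm hℓ) (dvd_trans ?_ h)
  exact map_dvd (Int.castRingHom GaussianInt)
    (Int.natCast_dvd_natCast.mpr (Nat.dvd_of_mem_primeFactors hℓ))

theorem norm_psi_I_le (m : ℕ) : ‖psi m ⟨0, 1⟩‖ ≤ 1 := norm_psi_le m _

/-- The Fourier transform of `|ψ_g|²`, as a product over the primes dividing `g`. -/
def psiNormFT (g : ℕ) (k : GaussianInt) : ℂ :=
  ∏ ℓ ∈ g.primeFactors, gaussFT ℓ (fun x => psiPrime ℓ x * conj (psiPrime ℓ x)) k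

theorem norm_psiNormFT_le {g : ℕ} (hg : Squarefree g) (k : GaussianInt) :
    ‖psiNormFT g k‖ ≤ (g : ℝ) ^ 2 := by
  unfold psiNormFT
  rw [norm_prod]
  calc _ ≤ ∏ ℓ ∈ g.primeFactors, (ℓ : ℝ) ^ 2 := by
        refine Finset.prod_le_prod (fun _ _ => norm_nonneg _) fun ℓ _ => ?_
        refine norm_gaussFT_le (fun x => ?_) k
        rw [norm_mul, RCLike.norm_conj]
        exact mul_le_one₀ (norm_psiPrime_le ℓ x) (norm_nonneg _) (norm_psiPrime_le ℓ x)
    _ = (g : ℝ) ^ 2 := by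
        rw [Finset.prod_pow]
        congr 1
        rw [← Nat.cast_prod, Nat.prod_primeFactors_of_squarefree hg]

theorem gaussFT_psi_mul_conj_psi {g p q : ℕ} (hsq : Squarefree (g * p * q)) (hodd : Odd (g * p * q))
    (k : GaussianInt) :
    gaussFT (g * p * q) (fun x => psi (g * p) x * conj (psi (g * q) x)) k =
      psiNormFT g k * (p * psi p ⟨0, 1⟩ * psi p k) * (q * conj (psi q ⟨0, 1⟩) * conj (psi q k)) := by
  have hgpq : (g * p).Coprime q := Nat.coprime_of_squarefree_mul hsq
  have hgp : g.Coprime p := Nat.coprime_of_squarefree_mul (hsq.squarefree_of_dvd ⟨q, rfl⟩)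
  have hgq : g.Coprime q := hgpq.coprime_dvd_left ⟨p, rfl⟩
  have hpq : p.Coprime q := hgpq.coprime_dvd_left ⟨g, mul_comm _ _⟩
  have hp2 : ∀ ℓ ∈ (g * p * q).primeFactors, ℓ ≠ 2 := fun ℓ => ne_two_of_mem_primeFactors hodd
  set f : ℕ → GaussianInt → ℂ := fun ℓ => if ℓ ∣ g then fun x => psiPrime ℓ x * conj (psiPrime ℓ x)
    else if ℓ ∣ p then psiPrime ℓ else fun x => conj (psiPrime ℓ x) with hf
  have hp0 : ∀ {m ℓ : ℕ}, ℓ ∈ m.primeFactors → ℓ.Prime := Nat.prime_of_mem_primeFactors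
  have hnd : ∀ {a b ℓ : ℕ}, a.Coprime b → ℓ ∈ b.primeFactors → ¬ ℓ ∣ a := fun hab hℓ hd =>
    (hp0 hℓ).one_lt.ne' (Nat.eq_one_of_dvd_coprimes hab hd (Nat.dvd_of_mem_primeFactors hℓ))
  have fg : ∀ ℓ ∈ g.primeFactors, f ℓ = fun x => psiPrime ℓ x * conj (psiPrime ℓ x) := fun ℓ hℓ =>
    if_pos (Nat.dvd_of_mem_primeFactors hℓ)
  have fp : ∀ ℓ ∈ p.primeFactors, f ℓ = psiPrime ℓ := fun ℓ hℓ => by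
    simp only [hf]
    rw [if_neg (hnd hgp hℓ), if_pos (Nat.dvd_of_mem_primeFactors hℓ)]
  have fq : ∀ ℓ ∈ q.primeFactors, f ℓ = fun x => conj (psiPrime ℓ x) := fun ℓ hℓ => by
    simp only [hf]
    rw [if_neg (hnd hgq hℓ), if_neg (hnd hpq hℓ)]
  have hmain := gaussFT_prod (S := (g * p * q).primeFactors) (fun _ => hp0) (f := f) (fun ℓ hℓ => ?_) k
  · rw [Nat.prod_primeFactors_of_squarefree hsq] at hmain
    simp_rw [prod_primeFactors_mul_of_coprime hgpq, prod_primeFactors_mul_of_coprime hgp] at hmain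
    have h1 : (fun x => ((∏ ℓ ∈ g.primeFactors, f ℓ x) * ∏ ℓ ∈ p.primeFactors, f ℓ x) *
        ∏ ℓ ∈ q.primeFactors, f ℓ x) = fun x => psi (g * p) x * conj (psi (g * q) x) := by
      funext x
      rw [psi_coprime_mul hgp, psi_coprime_mul hgq]
      have e1 : ∏ ℓ ∈ g.primeFactors, f ℓ x = psi g x * conj (psi g x) := by
        unfold psi
        rw [map_prod, ← Finset.prod_mul_distrib]
        exact Finset.prod_congr rfl fun ℓ hℓ => by rw [fg ℓ hℓ]
      have e2 : ∏ ℓ ∈ p.primeFactors, f ℓ x = psi p x :=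
        Finset.prod_congr rfl fun ℓ hℓ => by rw [fp ℓ hℓ]
      have e3 : ∏ ℓ ∈ q.primeFactors, f ℓ x = conj (psi q x) := by
        unfold psi
        rw [map_prod]
        exact Finset.prod_congr rfl fun ℓ hℓ => by rw [fq ℓ hℓ]
      rw [e1, e2, e3, map_mul]
      ring
    rw [← h1, hmain]
    have hp2' : ∀ {a ℓ : ℕ}, a ∣ g * p * q → ℓ ∈ a.primeFactors → ℓ ≠ 2 := fun ha hℓ =>
      hp2 _ (Nat.primeFactors_mono ha hsq.ne_zero hℓ)
    have hsqp : Squarefree p := hsq.squarefree_of_dvd ⟨g * q, by ring⟩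
    have hsqq : Squarefree q := hsq.squarefree_of_dvd ⟨g * p, by ring⟩
    have hprod : ∀ {m : ℕ}, Squarefree m → (m : ℂ) = ∏ ℓ ∈ m.primeFactors, (ℓ : ℂ) := fun hm => by
      rw [← Nat.cast_prod, Nat.prod_primeFactors_of_squarefree hm]
    congr 1
    · congr 1
      · exact Finset.prod_congr rfl fun ℓ hℓ => by rw [fg ℓ hℓ]
      · rw [hprod hsqp]
        unfold psi
        rw [← Finset.prod_mul_distrib, ← Finset.prod_mul_distrib]
        exact Finset.prod_congr rfl fun ℓ hℓ => by
          rw [fp ℓ hℓ, gaussFT_psiPrime (hp0 hℓ) (hp2' ⟨g * q, by ring⟩ hℓ)]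
    · rw [hprod hsqq]
      unfold psi
      rw [map_prod, map_prod, ← Finset.prod_mul_distrib, ← Finset.prod_mul_distrib]
      exact Finset.prod_congr rfl fun ℓ hℓ => by
        rw [fq ℓ hℓ, gaussFT_conj_psiPrime (hp0 hℓ) (hp2' ⟨g * p, by ring⟩ hℓ)]
  · have := homogeneousMod_psiPrime (hp0 hℓ) (hp2 ℓ hℓ)
    simp only [hf]
    split_ifs
    · exact this.mul this.conj
    · exact this
    · exact this.conj

/-- A primitive quartic Dirichlet character whose square is primitive. -/
def IsPrimitiveQuartic {q : ℕ} (χ : DirichletCharacter ℂ q) : Prop :=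
  χ.IsPrimitive ∧ (χ ^ 2).IsPrimitive ∧ χ ^ 4 = 1

theorem gaussSum_mul_conj_of_isPrimitive {q : ℕ} [NeZero q] {χ : DirichletCharacter ℂ q}
    (hχ : χ.IsPrimitive) :
    gaussSum χ ZMod.stdAddChar * conj (gaussSum χ ZMod.stdAddChar) = q := by
  have hprim := ZMod.isPrimitive_stdAddChar q
  have h1 : conj (gaussSum χ ZMod.stdAddChar) =
      ∑ a, χ⁻¹ a * (ZMod.stdAddChar (-a) : ℂ) := by
    rw [starRingEnd_apply, star_gaussSum_eq, gaussSum]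
    simp [AddChar.inv_apply]
  rw [h1, Finset.mul_sum]
  have h2 : ∀ a : ZMod q, gaussSum χ ZMod.stdAddChar * (χ⁻¹ a * (ZMod.stdAddChar (-a) : ℂ)) =
      ∑ x, χ x * (ZMod.stdAddChar (a * (x - 1)) : ℂ) := by
    intro a
    rw [← mul_assoc, mul_comm _ (χ⁻¹ a), ← gaussSum_mulShift_of_isPrimitive _ hχ, gaussSum,
      Finset.sum_mul]
    refine Finset.sum_congr rfl fun x _ => ?_
    rw [AddChar.mulShift_apply, mul_assoc, ← AddChar.map_add_eq_mul]
    congr 2; ring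
  simp_rw [h2]
  rw [Finset.sum_comm]
  simp_rw [← Finset.mul_sum, AddChar.sum_mulShift _ hprim, sub_eq_zero]
  simp [ZMod.card]

theorem pow_two_inv_of_pow_four {q : ℕ} {χ : DirichletCharacter ℂ q} (h4 : χ ^ 4 = 1) :
    (χ ^ 2)⁻¹ = χ ^ 2 := by
  rw [inv_eq_iff_mul_eq_one, ← pow_add]; exact h4

theorem sq_apply_neg_one {q : ℕ} (χ : DirichletCharacter ℂ q) : (χ ^ 2) (-1) = 1 := by
  rw [MulChar.pow_apply' _ two_ne_zero, ← map_pow]; simp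

theorem IsPrimitiveQuartic.mul_jacobiSum {q : ℕ} [NeZero q] {χ : DirichletCharacter ℂ q}
    (hχ : IsPrimitiveQuartic χ) :
    q * jacobiSum χ χ = gaussSum χ ZMod.stdAddChar ^ 2 * gaussSum (χ ^ 2) ZMod.stdAddChar := by
  have hprim := ZMod.isPrimitive_stdAddChar q
  have h1 : gaussSum (χ ^ 2) ZMod.stdAddChar =
      ∑ k, (χ⁻¹ k) ^ 2 * (ZMod.stdAddChar (-k) : ℂ) := by
    have := gaussSum_mulShift_of_isPrimitive (e := ZMod.stdAddChar) hχ.2.1 (-1)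
    rw [pow_two_inv_of_pow_four hχ.2.2, sq_apply_neg_one, one_mul] at this
    rw [← this, gaussSum]
    refine Finset.sum_congr rfl fun k _ => ?_
    rw [AddChar.mulShift_apply, neg_one_mul]
    congr 1
    rw [← MulChar.pow_apply' _ two_ne_zero, inv_pow, pow_two_inv_of_pow_four hχ.2.2]
  rw [h1, Finset.mul_sum]
  have h2 : ∀ k : ZMod q, gaussSum χ ZMod.stdAddChar ^ 2 *
      ((χ⁻¹ k) ^ 2 * (ZMod.stdAddChar (-k) : ℂ)) =
      ∑ x, ∑ y, χ x * χ y * (ZMod.stdAddChar (k * (x + y - 1)) : ℂ) := by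
    intro k
    rw [← mul_assoc, ← mul_pow, mul_comm _ (χ⁻¹ k), ← gaussSum_mulShift_of_isPrimitive _ hχ.1,
      gaussSum, sq, Finset.sum_mul_sum, Finset.sum_mul]
    refine Finset.sum_congr rfl fun x _ => ?_
    rw [Finset.sum_mul]
    refine Finset.sum_congr rfl fun y _ => ?_
    rw [AddChar.mulShift_apply, AddChar.mulShift_apply,
      show k * (x + y - 1) = k * x + k * y + -k by ring, AddChar.map_add_eq_mul,
      AddChar.map_add_eq_mul]
    ring
  simp_rw [h2]
  rw [Finset.sum_comm, jacobiSum, Finset.mul_sum]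
  refine Finset.sum_congr rfl fun x _ => ?_
  rw [Finset.sum_comm]
  simp_rw [← Finset.mul_sum, AddChar.sum_mulShift _ hprim]
  rw [Finset.sum_eq_single (1 - x)]
  · rw [if_pos (by ring), ZMod.card]; ring
  · intro y _ hy
    rw [if_neg, Nat.cast_zero, mul_zero]
    intro h
    exact hy (by linear_combination h)
  · simp

theorem IsPrimitiveQuartic.conj_gaussSum_sq {q : ℕ} [NeZero q] {χ : DirichletCharacter ℂ q}
    (hχ : IsPrimitiveQuartic χ) :
    conj (gaussSum (χ ^ 2) ZMod.stdAddChar) = gaussSum (χ ^ 2) ZMod.stdAddChar := by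
  rw [starRingEnd_apply, star_gaussSum_eq, AddChar.inv_mulShift,
    gaussSum_mulShift_of_isPrimitive _ (by rw [pow_two_inv_of_pow_four hχ.2.2]; exact hχ.2.1),
    inv_inv, sq_apply_neg_one, one_mul, pow_two_inv_of_pow_four hχ.2.2]

theorem IsPrimitiveQuartic.jacobiSum_mul_conj {q : ℕ} [NeZero q] {χ : DirichletCharacter ℂ q}
    (hχ : IsPrimitiveQuartic χ) : jacobiSum χ χ * conj (jacobiSum χ χ) = q := by
  have h1 := hχ.mul_jacobiSum
  have h2 := congrArg (starRingEnd ℂ) h1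
  simp only [map_mul, map_pow, map_natCast] at h2
  have h3 := gaussSum_mul_conj_of_isPrimitive hχ.1
  have h4 := gaussSum_mul_conj_of_isPrimitive hχ.2.1
  have hq : (q : ℂ) ≠ 0 := Nat.cast_ne_zero.mpr (NeZero.ne q)
  apply mul_left_cancel₀ (pow_ne_zero 2 hq)
  calc (q : ℂ) ^ 2 * (jacobiSum χ χ * conj (jacobiSum χ χ)) =
      (q * jacobiSum χ χ) * (q * conj (jacobiSum χ χ)) := by ring
    _ = (gaussSum χ ZMod.stdAddChar * conj (gaussSum χ ZMod.stdAddChar)) ^ 2 *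
      (gaussSum (χ ^ 2) ZMod.stdAddChar * conj (gaussSum (χ ^ 2) ZMod.stdAddChar)) := by
        rw [h1, h2]; ring
    _ = q ^ 2 * q := by rw [h3, h4]

theorem IsPrimitiveQuartic.gaussSum_pow_four {q : ℕ} [NeZero q] {χ : DirichletCharacter ℂ q}
    (hχ : IsPrimitiveQuartic χ) :
    gaussSum χ ZMod.stdAddChar ^ 4 = jacobiSum χ χ ^ 3 * conj (jacobiSum χ χ) := by
  have h1 := hχ.mul_jacobiSum
  have h4 := gaussSum_mul_conj_of_isPrimitive hχ.2.1
  rw [hχ.conj_gaussSum_sq] at h4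
  have hq : (q : ℂ) ≠ 0 := Nat.cast_ne_zero.mpr (NeZero.ne q)
  apply mul_left_cancel₀ hq
  calc (q : ℂ) * gaussSum χ ZMod.stdAddChar ^ 4 =
      (gaussSum χ ZMod.stdAddChar ^ 2 * gaussSum (χ ^ 2) ZMod.stdAddChar) ^ 2 := by
        linear_combination - gaussSum χ ZMod.stdAddChar ^ 4 * h4
    _ = q ^ 2 * jacobiSum χ χ ^ 2 := by rw [← h1]; ring
    _ = _ := by rw [← hχ.jacobiSum_mul_conj]; ring

theorem exists_gaussUnits_eq_apply {q : ℕ} {χ : DirichletCharacter ℂ q} (h4 : χ ^ 4 = 1)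
    {x : ZMod q} (hx : IsUnit x) : ∃ u ∈ gaussUnits, χ x = GaussianInt.toComplex u := by
  have h : χ x ^ 4 = 1 := by
    rw [← MulChar.pow_apply' _ four_ne_zero, h4, MulChar.one_apply hx]
  have h' : (χ x - 1) * (χ x + 1) * (χ x - I) * (χ x + I) = 0 := by
    linear_combination h + (- χ x ^ 2 + 1) * Complex.I_sq
  rcases mul_eq_zero.mp h' with h' | h'
  · rcases mul_eq_zero.mp h' with h' | h'
    · rcases mul_eq_zero.mp h' with h' | h'
      · exact ⟨1, by decide, by simpa using sub_eq_zero.mp h'⟩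
      · exact ⟨-1, by decide, by simpa using eq_neg_of_add_eq_zero_left h'⟩
    · exact ⟨⟨0, 1⟩, by decide, by simpa [GaussianInt.toComplex_def] using sub_eq_zero.mp h'⟩
  · exact ⟨⟨0, -1⟩, by decide, by
      simpa [GaussianInt.toComplex_def] using eq_neg_of_add_eq_zero_left h'⟩

theorem exists_toComplex_eq_apply {q : ℕ} {χ : DirichletCharacter ℂ q} (h4 : χ ^ 4 = 1)
    (x : ZMod q) : ∃ u : GaussianInt, GaussianInt.toComplex u = χ x := by
  by_cases hx : IsUnit x
  · obtain ⟨u, _, hu⟩ := exists_gaussUnits_eq_apply h4 hx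
    exact ⟨u, hu.symm⟩
  · exact ⟨0, by rw [MulChar.map_nonunit _ hx, map_zero]⟩

theorem exists_toComplex_eq_jacobiSum {q : ℕ} [NeZero q] {χ : DirichletCharacter ℂ q}
    (h4 : χ ^ 4 = 1) : ∃ n : GaussianInt, GaussianInt.toComplex n = jacobiSum χ χ := by
  choose u hu using exists_toComplex_eq_apply h4
  exact ⟨∑ x, u x * u (1 - x), by simp [jacobiSum, hu]⟩

/-- The Jacobi sum `J(χ, χ)` of a quartic character, as a Gaussian integer. -/
def jacobiGauss {q : ℕ} (χ : DirichletCharacter ℂ q) : GaussianInt :=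
  if hq : q = 0 then 0
  else have : NeZero q := ⟨hq⟩
    if h : ∃ n : GaussianInt, GaussianInt.toComplex n = jacobiSum χ χ then h.choose else 0

theorem toComplex_jacobiGauss {q : ℕ} [NeZero q] {χ : DirichletCharacter ℂ q} (h4 : χ ^ 4 = 1) :
    GaussianInt.toComplex (jacobiGauss χ) = jacobiSum χ χ := by
  unfold jacobiGauss
  rw [dif_neg (NeZero.ne q)]
  have h := exists_toComplex_eq_jacobiSum h4
  simp only [dif_pos h]
  exact h.choose_spec

theorem IsPrimitiveQuartic.norm_jacobiGauss {q : ℕ} [NeZero q] {χ : DirichletCharacter ℂ q}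
    (hχ : IsPrimitiveQuartic χ) : (jacobiGauss χ).norm = q := by
  have h := hχ.jacobiSum_mul_conj
  rw [← toComplex_jacobiGauss hχ.2.2, ← GaussianInt.toComplex_star, ← map_mul,
    ← Zsqrtd.norm_eq_mul_conj] at h
  have h' : (((jacobiGauss χ).norm : ℤ) : ℂ) = (q : ℤ) := by simpa using h
  exact_mod_cast h'

theorem IsPrimitiveQuartic.odd {q : ℕ} [NeZero q] {χ : DirichletCharacter ℂ q}
    (hχ : IsPrimitiveQuartic χ) : Odd q := by
  by_contra hq
  rw [Nat.not_odd_iff_even] at hq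
  have h0 : jacobiSum χ χ = 0 := by
    refine Finset.sum_eq_zero fun x _ => ?_
    by_cases hx : IsUnit x
    · rw [MulChar.map_nonunit χ (a := 1 - x), mul_zero]
      intro hx'
      have key : ∀ y : ZMod q, IsUnit y → ZMod.castHom (even_iff_two_dvd.mp hq) (ZMod 2) y = 1 := by
        intro y hy
        have h1 : IsUnit (ZMod.castHom (even_iff_two_dvd.mp hq) (ZMod 2) y) := hy.map _
        have h2 : ∀ z ∈ (Finset.univ : Finset (ZMod 2)), z = 0 ∨ z = 1 := by decide
        rcases h2 _ (Finset.mem_univ (ZMod.castHom (even_iff_two_dvd.mp hq) (ZMod 2) y)) with h | h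
        · rw [h] at h1; exact absurd h1 (by simp)
        · exact h
      have h1 := key x hx
      have h2 := key _ hx'
      rw [map_sub, map_one, h1, sub_self] at h2
      exact absurd h2 (by simp)
    · rw [MulChar.map_nonunit χ hx, zero_mul]
  have := hχ.jacobiSum_mul_conj
  rw [h0, zero_mul] at this
  exact NeZero.ne q (by exact_mod_cast this.symm)

theorem natCast_dvd_sum_pow_sub {R ι : Type*} [CommRing R] {p : ℕ} (hp : p.Prime) (s : Finset ι)
    (f : ι → R) : (p : R) ∣ (∑ i ∈ s, f i) ^ p - ∑ i ∈ s, f i ^ p := by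
  induction s using Finset.induction_on with
  | empty => simp [hp.ne_zero]
  | insert a s ha ih =>
    rw [Finset.sum_insert ha, Finset.sum_insert ha]
    obtain ⟨r, hr⟩ := exists_add_pow_prime_eq hp (f a) (∑ i ∈ s, f i)
    obtain ⟨c, hc⟩ := ih
    exact ⟨f a * (∑ i ∈ s, f i) * r + c, by linear_combination hr + hc⟩

theorem int_dvd_of_isIntegral_div {ℓ : ℕ} (hℓ : ℓ ≠ 0) {a : ℤ} {w : ℂ} (hw : IsIntegral ℤ w)
    (h : (a : ℂ) = ℓ * w) : (ℓ : ℤ) ∣ a := by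
  have hℓ0 : (ℓ : ℂ) ≠ 0 := Nat.cast_ne_zero.mpr hℓ
  have hwr : w = algebraMap ℚ ℂ (a / ℓ) := by
    simp only [eq_ratCast]; push_cast; field_simp; rw [h]; ring
  rw [hwr, isIntegral_algebraMap_iff (algebraMap ℚ ℂ).injective,
    IsIntegrallyClosed.isIntegral_iff] at hw
  obtain ⟨y, hy⟩ := hw
  refine ⟨y, ?_⟩
  have hℓ1 : (ℓ : ℚ) ≠ 0 := Nat.cast_ne_zero.mpr hℓ
  simp only [eq_intCast] at hy
  have : (a : ℚ) = ℓ * y := by rw [hy]; field_simp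
  exact_mod_cast this

theorem gaussInt_dvd_of_isIntegral {ℓ : ℕ} (hℓ : ℓ.Prime) (hodd : ℓ ≠ 2) {z : GaussianInt} {w : ℂ}
    (hw : IsIntegral ℤ w) (h : GaussianInt.toComplex z = ℓ * w) :
    ((ℓ : ℤ) : GaussianInt) ∣ z := by
  have hwc : IsIntegral ℤ (conj w) := by
    have := hw.map (Complex.conjAe.toAlgHom.restrictScalars ℤ)
    simpa using this
  have hI : IsIntegral ℤ I := by
    refine ⟨Polynomial.X ^ 2 + 1, by monicity!, by simp⟩
  have hc := congrArg (starRingEnd ℂ) h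
  rw [map_mul, map_natCast] at hc
  rw [GaussianInt.toComplex_def] at h hc
  simp only [map_add, map_mul, Complex.conj_I, map_intCast] at hc
  have hp : Prime (ℓ : ℤ) := Nat.prime_iff_prime_int.mp hℓ
  have h2 : ¬ (ℓ : ℤ) ∣ 2 := by
    intro h2
    have : ℓ ∣ 2 := by exact_mod_cast h2
    exact hodd ((Nat.prime_dvd_prime_iff_eq hℓ Nat.prime_two).mp this)
  rw [Zsqrtd.intCast_dvd]
  constructor
  · have : (ℓ : ℤ) ∣ 2 * z.re := int_dvd_of_isIntegral_div hℓ.ne_zero (hw.add hwc)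
      (by push_cast; linear_combination h + hc)
    exact (hp.dvd_or_dvd this).resolve_left h2
  · have : (ℓ : ℤ) ∣ 2 * z.im := int_dvd_of_isIntegral_div hℓ.ne_zero
      ((hwc.sub hw).mul hI)
      (by push_cast; linear_combination I * hc - I * h + 2 * z.im * Complex.I_sq)
    exact (hp.dvd_or_dvd this).resolve_left h2

theorem isIntegral_toComplex (z : GaussianInt) : IsIntegral ℤ (GaussianInt.toComplex z) := by
  have hI : IsIntegral ℤ I := by
    refine ⟨Polynomial.X ^ 2 + 1, by monicity!, by simp⟩
  rw [GaussianInt.toComplex_def]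
  exact (isIntegral_intCast (z.re)).add ((isIntegral_intCast z.im).mul hI)

theorem isIntegral_stdAddChar {q : ℕ} [NeZero q] (a : ZMod q) :
    IsIntegral ℤ (ZMod.stdAddChar a : ℂ) := by
  have h : (ZMod.stdAddChar a : ℂ) ^ q = 1 := by
    rw [← AddChar.map_nsmul_eq_pow]; simp
  refine ⟨Polynomial.X ^ q - 1, Polynomial.monic_X_pow_sub_C 1 (NeZero.ne q), by simp [h]⟩

theorem exists_gaussSum_pow_prime {q : ℕ} [NeZero q] {χ : DirichletCharacter ℂ q} (h4 : χ ^ 4 = 1)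
    {ℓ : ℕ} (hℓ : ℓ.Prime) : ∃ w : ℂ, IsIntegral ℤ w ∧
      gaussSum χ ZMod.stdAddChar ^ ℓ - gaussSum (χ ^ ℓ) (ZMod.stdAddChar.mulShift ℓ) = ℓ * w := by
  have hw_int : ∀ a, χ a * (ZMod.stdAddChar a : ℂ) ∈ integralClosure ℤ ℂ := by
    intro a
    obtain ⟨u, hu⟩ := exists_toComplex_eq_apply h4 a
    rw [← hu]
    exact (isIntegral_toComplex u).mul (isIntegral_stdAddChar a)
  obtain ⟨w, hw⟩ := natCast_dvd_sum_pow_sub hℓ (Finset.univ : Finset (ZMod q))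
    (fun a => (⟨_, hw_int a⟩ : integralClosure ℤ ℂ))
  refine ⟨w, w.2, ?_⟩
  have := congrArg (fun z : integralClosure ℤ ℂ => (z : ℂ)) hw
  simp only [AddSubgroupClass.coe_sub, SubmonoidClass.coe_pow, AddSubmonoidClass.coe_finsetSum,
    MulMemClass.coe_mul] at this
  rw [gaussSum, gaussSum]
  refine Eq.trans ?_ (this.trans rfl)
  congr 1
  refine Finset.sum_congr rfl fun a _ => ?_
  rw [mul_pow, MulChar.pow_apply' _ hℓ.ne_zero, AddChar.mulShift_apply, ← AddChar.map_nsmul_eq_pow,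
    nsmul_eq_mul]

theorem isIntegral_gaussSum {q : ℕ} [NeZero q] {χ : DirichletCharacter ℂ q} (h4 : χ ^ 4 = 1) :
    IsIntegral ℤ (gaussSum χ ZMod.stdAddChar) := by
  refine IsIntegral.sum _ fun a _ => ?_
  obtain ⟨u, hu⟩ := exists_toComplex_eq_apply h4 a
  rw [← hu]
  exact (isIntegral_toComplex u).mul (isIntegral_stdAddChar a)

theorem inv_eq_pow_three {q : ℕ} {χ : DirichletCharacter ℂ q} (h4 : χ ^ 4 = 1) : χ⁻¹ = χ ^ 3 := by
  rw [inv_eq_iff_mul_eq_one, ← pow_succ']; exact h4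

theorem conj_gaussSum_eq {q : ℕ} [NeZero q] {χ : DirichletCharacter ℂ q} (hχ : χ.IsPrimitive) :
    conj (gaussSum χ ZMod.stdAddChar) = χ (-1) * gaussSum χ⁻¹ ZMod.stdAddChar := by
  rw [starRingEnd_apply, star_gaussSum_eq, AddChar.inv_mulShift, gaussSum_mulShift_of_isPrimitive,
    inv_inv]
  rw [DirichletCharacter.isPrimitive_def, DirichletCharacter.conductor_inv]
  exact hχ

theorem IsPrimitiveQuartic.psiPrime_jacobiGauss {q : ℕ} [NeZero q] {χ : DirichletCharacter ℂ q}
    (hχ : IsPrimitiveQuartic χ) {ℓ : ℕ} (hℓ : ℓ.Prime) (hodd : ℓ ≠ 2) :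
    psiPrime ℓ (jacobiGauss χ) = χ ℓ * if ℓ % 4 = 1 then 1 else χ (-1) := by
  have hnorm := hχ.norm_jacobiGauss
  set n := jacobiGauss χ with hn
  by_cases hq : (ℓ : ℤ) ∣ n.norm
  · rw [psiPrime_of_dvd hq, MulChar.map_nonunit χ, zero_mul]
    rw [hnorm] at hq
    rw [ZMod.isUnit_iff_coprime]
    intro h
    exact hℓ.one_lt.ne' (Nat.Coprime.eq_one_of_dvd h (by exact_mod_cast hq))
  have hlu : IsUnit (ℓ : ZMod q) := by
    rw [ZMod.isUnit_iff_coprime, hℓ.coprime_iff_not_dvd]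
    rw [hnorm] at hq
    exact_mod_cast hq
  have hmod : ℓ % 4 = 1 ∨ ℓ % 4 = 3 := by
    have := hℓ.eq_two_or_odd
    lia
  obtain ⟨u, hu, hue⟩ := exists_gaussUnits_eq_apply hχ.2.2 hlu
  obtain ⟨s, hs, hse⟩ := exists_gaussUnits_eq_apply hχ.2.2 (x := (-1 : ZMod q)) (by simp)
  obtain ⟨w, hw, hwe⟩ := exists_gaussSum_pow_prime hχ.2.2 hℓ
  have hg4 := hχ.gaussSum_pow_four
  have hgc := gaussSum_mul_conj_of_isPrimitive hχ.1
  have hgi := isIntegral_gaussSum hχ.2.2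
  have hcg := conj_gaussSum_eq hχ.1
  have hJ := toComplex_jacobiGauss hχ.2.2
  rw [← hn] at hJ
  have hgci : IsIntegral ℤ (conj (gaussSum χ ZMod.stdAddChar)) := by
    have := hgi.map (Complex.conjAe.toAlgHom.restrictScalars ℤ)
    simpa using this
  rw [← hJ, ← GaussianInt.toComplex_star, ← map_pow, ← map_mul] at hg4
  have hfer := dvd_pow_sub_norm hℓ hodd hq
  have hqn : (q : GaussianInt) = n * star n := by
    rw [← Zsqrtd.norm_eq_mul_conj, hnorm]; simp
  set g := gaussSum χ ZMod.stdAddChar with hg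
  rcases hmod with h1 | h3
  · rw [if_pos h1, mul_one]
    rw [if_pos h1] at hfer
    have hχℓ : χ ^ ℓ = χ := by
      rw [show ℓ = 4 * (ℓ / 4) + 1 by lia, pow_add, pow_mul, hχ.2.2, one_pow, one_mul, pow_one]
    rw [hχℓ, gaussSum_mulShift_of_isPrimitive _ hχ.1] at hwe
    have hinv : χ⁻¹ (ℓ : ZMod q) = GaussianInt.toComplex (star u) := by
      rw [← MulChar.star_apply', hue, GaussianInt.toComplex_star]; rfl
    rw [hinv] at hwe
    have hE : ℓ = 4 * ((ℓ - 1) / 4) + 1 := by lia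
    set E := (ℓ - 1) / 4 with hEdef
    have hd : ((ℓ : ℤ) : GaussianInt) ∣ q * ((n ^ 3 * star n) ^ E - star u) := by
      refine gaussInt_dvd_of_isIntegral hℓ hodd (hw.mul hgci) ?_
      rw [map_mul, map_sub, map_natCast, map_pow, ← hg4, ← pow_mul]
      have : g ^ ℓ = g ^ (4 * E) * g := by
        conv_lhs => rw [hE]
        rw [pow_succ]
      linear_combination conj g * hwe - (g ^ (4 * E) - GaussianInt.toComplex (star u)) * hgc -
        conj g * this
    have hd2 : ((ℓ : ℤ) : GaussianInt) ∣ (n ^ 3 * star n) ^ E - star u := by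
      have h5 : ((ℓ : ℤ) : GaussianInt) ∣ n * (star n * ((n ^ 3 * star n) ^ E - star u)) := by
        rw [← mul_assoc, ← hqn]; exact hd
      exact gauss_dvd_of_dvd_norm_mul hℓ (by rwa [gauss_norm_star])
        (gauss_dvd_of_dvd_norm_mul hℓ hq h5)
    rw [hue]
    refine psiPrime_eq_of_dvd hℓ hodd hq hu ?_
    rw [psiBase, if_pos h1, ← hEdef, star_pow]
    have h6 : n ^ (ℓ - 1) = n ^ (4 * E) := by congr 1; lia
    rw [h6] at hfer
    obtain ⟨c, hc⟩ := hd2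
    obtain ⟨d, hdd⟩ := hfer
    have huu := mul_star_of_mem_gaussUnits hu
    refine ⟨u * star n ^ E * d - u * n ^ E * c, ?_⟩
    rw [mul_pow, ← pow_mul] at hc
    rw [pow_mul'] at hdd
    rw [pow_mul'] at hc
    linear_combination (-(u * n ^ E)) * hc + (u * star n ^ E) * hdd - n ^ E * huu
  · have h1 : ¬ ℓ % 4 = 1 := by lia
    rw [if_neg h1]
    rw [if_neg h1] at hfer
    have hχℓ : χ ^ ℓ = χ⁻¹ := by
      rw [inv_eq_pow_three hχ.2.2, show ℓ = 4 * (ℓ / 4) + 3 by lia, pow_add, pow_mul, hχ.2.2,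
        one_pow, one_mul]
    have hpi : χ⁻¹.IsPrimitive := by
      rw [DirichletCharacter.isPrimitive_def, DirichletCharacter.conductor_inv]
      exact hχ.1
    rw [hχℓ, gaussSum_mulShift_of_isPrimitive _ hpi, inv_inv] at hwe
    have hE : ℓ + 1 = 4 * ((ℓ + 1) / 4) := by lia
    set E := (ℓ + 1) / 4 with hEdef
    have hss : χ (-1) * χ (-1) = 1 := by rw [← map_mul]; simp
    have hd : ((ℓ : ℤ) : GaussianInt) ∣ (n ^ 3 * star n) ^ E - u * s * q := by
      refine gaussInt_dvd_of_isIntegral hℓ hodd (hw.mul hgi) ?_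
      rw [map_sub, map_pow, ← hg4, ← pow_mul, ← hE, map_mul, map_mul, map_natCast, ← hue, ← hse]
      linear_combination g * hwe + χ ℓ * χ (-1) * hgc - χ ℓ * χ (-1) * g * hcg -
        χ ℓ * g * gaussSum χ⁻¹ ZMod.stdAddChar * hss
    rw [hue, hse, ← map_mul]
    refine psiPrime_eq_of_dvd hℓ hodd hq (mul_mem_gaussUnits hu hs) ?_
    rw [psiBase, if_neg h1, ← hEdef, star_pow, star_star]
    rw [hE, hnorm] at hfer
    obtain ⟨c, hc⟩ := hd
    obtain ⟨d, hdd⟩ := hfer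
    rw [mul_pow, ← pow_mul, pow_mul'] at hc
    rw [pow_mul'] at hdd
    have h5 : ((ℓ : ℤ) : GaussianInt) ∣ n * (star n * (star n ^ E - u * s * n ^ E)) := by
      rw [← mul_assoc, ← hqn]
      refine ⟨n ^ E * c - star n ^ E * d, ?_⟩
      have hq' : (((q : ℕ) : ℤ) : GaussianInt) = q := by simp
      rw [hq'] at hdd
      linear_combination n ^ E * hc - star n ^ E * hdd
    exact gauss_dvd_of_dvd_norm_mul hℓ (by rwa [gauss_norm_star])
      (gauss_dvd_of_dvd_norm_mul hℓ hq h5)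

theorem IsPrimitiveQuartic.psi_jacobiGauss {q : ℕ} [NeZero q] {χ : DirichletCharacter ℂ q}
    (hχ : IsPrimitiveQuartic χ) {m : ℕ} (hm : Odd m) (hsq : Squarefree m) :
    psi m (jacobiGauss χ) = χ m * if m % 4 = 1 then 1 else χ (-1) := by
  have hss : χ (-1) * χ (-1) = 1 := by rw [← map_mul]; simp
  have key : ∀ S : Finset ℕ, (∀ ℓ ∈ S, ℓ.Prime ∧ ℓ ≠ 2) → Odd (∏ ℓ ∈ S, ℓ) ∧
      ∏ ℓ ∈ S, psiPrime ℓ (jacobiGauss χ) =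
        χ ((∏ ℓ ∈ S, ℓ : ℕ) : ZMod q) * if (∏ ℓ ∈ S, ℓ) % 4 = 1 then 1 else χ (-1) := by
    intro S
    induction S using Finset.induction_on with
    | empty => simp
    | insert p S hp ih =>
      intro hS
      obtain ⟨h1, h2⟩ := ih fun ℓ hℓ => hS ℓ (Finset.mem_insert_of_mem hℓ)
      obtain ⟨hpp, hp2⟩ := hS p (Finset.mem_insert_self _ _)
      have hpo := hpp.odd_of_ne_two hp2
      rw [Finset.prod_insert hp, Finset.prod_insert hp, h2, hχ.psiPrime_jacobiGauss hpp hp2]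
      refine ⟨hpo.mul h1, ?_⟩
      set N := ∏ ℓ ∈ S, ℓ
      rw [Nat.cast_mul, map_mul]
      have hp4 : p % 4 = 1 ∨ p % 4 = 3 := by rcases hpo with ⟨k, rfl⟩; lia
      have hN4 : N % 4 = 1 ∨ N % 4 = 3 := by rcases h1 with ⟨k, hk⟩; lia
      rcases hp4 with a | a <;> rcases hN4 with b | b <;> simp [Nat.mul_mod, a, b]
      · ring
      · ring
      · linear_combination (χ p * χ N) * hss
  have := (key m.primeFactors fun ℓ hℓ =>
    ⟨Nat.prime_of_mem_primeFactors hℓ, ne_two_of_mem_primeFactors hm hℓ⟩).2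
  rwa [Nat.prod_primeFactors_of_squarefree hsq] at this

theorem IsPrimitiveQuartic.eq_of_jacobiGauss_eq {q : ℕ} [NeZero q] {χ χ' : DirichletCharacter ℂ q}
    (hχ : IsPrimitiveQuartic χ) (hχ' : IsPrimitiveQuartic χ')
    (h : jacobiGauss χ = jacobiGauss χ') : χ = χ' := by
  have hcop : Nat.Coprime q 4 := by
    have h2 : Nat.Coprime 2 q := Nat.coprime_two_left.mpr hχ.odd
    exact (Nat.Coprime.pow_left 2 h2).symm
  have : NeZero (q * 4) := ⟨mul_ne_zero (NeZero.ne q) four_ne_zero⟩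
  refine MulChar.ext fun a => ?_
  obtain ⟨N, hN1, hN2⟩ := Nat.chineseRemainder hcop (a : ZMod q).val 1
  have haN : ((N : ℕ) : ZMod q) = a := by
    rw [(ZMod.natCast_eq_natCast_iff _ _ _).mpr hN1, ZMod.natCast_zmod_val]
  have hunit : IsUnit ((N : ℕ) : ZMod (q * 4)) := by
    rw [ZMod.isUnit_iff_coprime]
    refine Nat.Coprime.mul_right ?_ ?_
    · rw [← ZMod.isUnit_iff_coprime, haN]; exact a.isUnit
    · have : N % 4 = 1 := hN2
      rw [Nat.Coprime, Nat.gcd_comm, Nat.gcd_rec, this, Nat.gcd_one_left]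
  obtain ⟨p, -, hp, hpN⟩ := Nat.forall_exists_prime_gt_and_eq_mod hunit 0
  have hmod := (ZMod.natCast_eq_natCast_iff _ _ _).mp hpN
  have hp4 : p % 4 = 1 := (hmod.of_mul_left q).trans hN2
  have hpq : ((p : ℕ) : ZMod q) = a := by
    rw [(ZMod.natCast_eq_natCast_iff _ _ _).mpr (hmod.of_mul_right 4), haN]
  have hp2 : p ≠ 2 := by rintro rfl; lia
  have h1 := hχ.psiPrime_jacobiGauss hp hp2
  have h2 := hχ'.psiPrime_jacobiGauss hp hp2
  rw [if_pos hp4, mul_one, hpq] at h1 h2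
  rw [← h1, ← h2, h]

/-- The Gaussian integers of norm at most `Y`. -/
def gaussBall (Y : ℕ) : Finset GaussianInt :=
  ((Finset.Icc (-(Y.sqrt : ℤ)) Y.sqrt ×ˢ Finset.Icc (-(Y.sqrt : ℤ)) Y.sqrt).image
    fun p => (⟨p.1, p.2⟩ : GaussianInt)).filter fun n => n.norm ≤ Y

theorem mem_gaussBall {Y : ℕ} {n : GaussianInt} : n ∈ gaussBall Y ↔ n.norm ≤ Y := by
  refine ⟨fun h => (Finset.mem_filter.mp h).2, fun h => Finset.mem_filter.mpr ⟨?_, h⟩⟩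
  have hn : n.norm = n.re * n.re + n.im * n.im := by rw [Zsqrtd.norm_def]; ring
  have key : ∀ x y : ℤ, x * x + y * y ≤ Y → -(Y.sqrt : ℤ) ≤ x ∧ x ≤ Y.sqrt := by
    intro x y hxy
    have h1 : x.natAbs ≤ Y.sqrt := by
      rw [Nat.le_sqrt]
      have h2 : ((x.natAbs * x.natAbs : ℕ) : ℤ) = x * x := by
        rw [Nat.cast_mul]; exact Int.natAbs_mul_self
      have := mul_self_nonneg y
      zify
      rw [Nat.cast_mul] at h2
      simp only [Int.natCast_natAbs] at h2 ⊢
      linarith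
    lia
  rw [hn] at h
  exact Finset.mem_image.mpr ⟨(n.re, n.im), Finset.mem_product.mpr
    ⟨Finset.mem_Icc.mpr (key _ _ h), Finset.mem_Icc.mpr (key _ _ (by rwa [add_comm] at h))⟩, rfl⟩

theorem card_gaussBall_le {Y : ℕ} (hY : 1 ≤ Y) : (gaussBall Y).card ≤ 9 * Y := by
  refine (Finset.card_filter_le _ _).trans (Finset.card_image_le.trans ?_)
  rw [Finset.card_product, Int.card_Icc]
  have h1 : (Y.sqrt + 1 - -(Y.sqrt : ℤ)).toNat = 2 * Y.sqrt + 1 := by lia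
  have h2 := Nat.sqrt_le Y
  have h3 : 1 ≤ Y.sqrt := Nat.le_sqrt.mpr (by simpa using hY)
  rw [show ((Y.sqrt : ℤ) + 1 - -(Y.sqrt : ℤ)).toNat = 2 * Y.sqrt + 1 by lia]
  nlinarith

/-- The primitive quartic characters modulo `q` whose square is primitive. -/
def primitiveQuartics (q : ℕ) : Finset (DirichletCharacter ℂ q) :=
  if h : Set.Finite {χ : DirichletCharacter ℂ q | IsPrimitiveQuartic χ} then h.toFinset else ∅

theorem finite_dirichletCharacter {q : ℕ} (hq : q ≠ 0) : Finite (DirichletCharacter ℂ q) := by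
  have : NeZero q := ⟨hq⟩
  infer_instance

theorem mem_primitiveQuartics {q : ℕ} (hq : q ≠ 0) {χ : DirichletCharacter ℂ q} :
    χ ∈ primitiveQuartics q ↔ IsPrimitiveQuartic χ := by
  have := finite_dirichletCharacter hq
  rw [primitiveQuartics, dif_pos (Set.toFinite _)]
  simp

/-- The pairs of a modulus `q ≤ Y` and a primitive quartic character modulo `q`. -/
def quarticFamily (Y : ℕ) : Finset (Σ q : ℕ, DirichletCharacter ℂ q) :=
  (Finset.Icc 1 Y).sigma primitiveQuartics

theorem mem_quarticFamily {Y : ℕ} {i : Σ q : ℕ, DirichletCharacter ℂ q} :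
    i ∈ quarticFamily Y ↔ 1 ≤ i.1 ∧ i.1 ≤ Y ∧ IsPrimitiveQuartic i.2 := by
  rw [quarticFamily, Finset.mem_sigma, Finset.mem_Icc, and_assoc]
  exact and_congr_right fun h => and_congr_right fun _ =>
    mem_primitiveQuartics (Nat.one_le_iff_ne_zero.mp h)

theorem card_quarticFamily_le {Y : ℕ} (hY : 1 ≤ Y) : (quarticFamily Y).card ≤ 9 * Y := by
  refine (Finset.card_le_card_of_injOn (fun i => jacobiGauss i.2) ?_ ?_).trans
    (card_gaussBall_le hY)
  · intro i hi
    obtain ⟨h1, h2, h3⟩ := mem_quarticFamily.mp hi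
    have : NeZero i.1 := ⟨Nat.one_le_iff_ne_zero.mp h1⟩
    rw [Finset.mem_coe, mem_gaussBall, h3.norm_jacobiGauss]
    exact_mod_cast h2
  · rintro ⟨q, χ⟩ hi ⟨q', χ'⟩ hj h
    obtain ⟨h1, h2, h3⟩ := mem_quarticFamily.mp hi
    obtain ⟨h1', h2', h3'⟩ := mem_quarticFamily.mp hj
    have : NeZero q := ⟨Nat.one_le_iff_ne_zero.mp h1⟩
    have : NeZero q' := ⟨Nat.one_le_iff_ne_zero.mp h1'⟩
    have hn := h3.norm_jacobiGauss
    simp only at h hn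
    rw [h, h3'.norm_jacobiGauss] at hn
    obtain rfl : q' = q := by exact_mod_cast hn
    exact congrArg (Sigma.mk q') (h3.eq_of_jacobiGauss_eq h3' h)

open DirichletCharacter in
theorem isPrimitive_changeLevel_mul {m n : ℕ} [NeZero m] [NeZero n] (h : m.Coprime n)
    {η : DirichletCharacter ℂ m} {χ : DirichletCharacter ℂ n} (hη : η.IsPrimitive)
    (hχ : χ.IsPrimitive) :
    (changeLevel (dvd_mul_right m n) η * changeLevel (dvd_mul_left n m) χ).IsPrimitive := by
  have : NeZero (m * n) := ⟨mul_ne_zero (NeZero.ne m) (NeZero.ne n)⟩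
  set A := changeLevel (dvd_mul_right m n) η
  set B := changeLevel (dvd_mul_left n m) χ
  have hA : A.conductor = m := by rw [conductor_changeLevel]; exact hη
  have hB : B.conductor = n := by rw [conductor_changeLevel]; exact hχ
  have h1 : m ∣ (A * B).conductor := by
    have := conductor_mul_dvd_lcm_conductor (A * B) B⁻¹
    rw [mul_inv_cancel_right, hA, conductor_inv, hB] at this
    exact h.dvd_of_dvd_mul_right (this.trans (Nat.lcm_dvd_mul _ _))
  have h2 : n ∣ (A * B).conductor := by
    have := conductor_mul_dvd_lcm_conductor (A * B) A⁻¹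
    rw [mul_comm A B, mul_inv_cancel_right, hB, conductor_inv, hA] at this
    rw [mul_comm A B]
    exact h.symm.dvd_of_dvd_mul_right (this.trans (Nat.lcm_dvd_mul _ _))
  exact Nat.dvd_antisymm (conductor_dvd_level _) (h.mul_dvd_of_dvd_of_dvd h1 h2)

open DirichletCharacter in
theorem IsPrimitiveQuartic.changeLevel_mul {m n : ℕ} [NeZero m] [NeZero n] (h : m.Coprime n)
    {η : DirichletCharacter ℂ m} {χ : DirichletCharacter ℂ n} (hη : IsPrimitiveQuartic η)
    (hχ : IsPrimitiveQuartic χ) :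
    IsPrimitiveQuartic
      (changeLevel (dvd_mul_right m n) η * changeLevel (dvd_mul_left n m) χ) := by
  refine ⟨isPrimitive_changeLevel_mul h hη.1 hχ.1, ?_, ?_⟩
  · rw [mul_pow, ← map_pow, ← map_pow]
    exact isPrimitive_changeLevel_mul h hη.2.1 hχ.2.1
  · rw [mul_pow, ← map_pow, ← map_pow, hη.2.2, hχ.2.2, map_one, map_one, one_mul]

open DirichletCharacter in
theorem changeLevel_mul_apply {m n : ℕ} (h : m.Coprime n)
    (η : DirichletCharacter ℂ m) (χ : DirichletCharacter ℂ n) (x : ZMod (m * n)) :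
    (changeLevel (dvd_mul_right m n) η * changeLevel (dvd_mul_left n m) χ) x =
      η (ZMod.chineseRemainder h x).1 * χ (ZMod.chineseRemainder h x).2 := by
  have hx1 : (ZMod.chineseRemainder h x).1 = ZMod.cast x := by
    change (ZMod.cast x : ZMod m × ZMod n).1 = _
    exact Prod.fst_zmod_cast x
  have hx2 : (ZMod.chineseRemainder h x).2 = ZMod.cast x := by
    change (ZMod.cast x : ZMod m × ZMod n).2 = _
    exact Prod.snd_zmod_cast x
  by_cases hx : IsUnit x
  · obtain ⟨u, rfl⟩ := hx
    rw [MulChar.mul_apply, changeLevel_eq_cast_of_dvd, changeLevel_eq_cast_of_dvd, hx1, hx2]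
  · rw [MulChar.map_nonunit _ hx]
    by_contra hne
    have h1 : IsUnit (ZMod.chineseRemainder h x).1 := by
      by_contra h'; rw [MulChar.map_nonunit _ h', zero_mul] at hne; exact hne rfl
    have h2 : IsUnit (ZMod.chineseRemainder h x).2 := by
      by_contra h'; rw [MulChar.map_nonunit _ h', mul_zero] at hne; exact hne rfl
    exact hx ((MulEquiv.isUnit_map (ZMod.chineseRemainder h)).mp (Prod.isUnit_iff.mpr ⟨h1, h2⟩))

open DirichletCharacter in
theorem jacobiSum_changeLevel_mul {m n : ℕ} [NeZero m] [NeZero n] [NeZero (m * n)]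
    (h : m.Coprime n) (η : DirichletCharacter ℂ m) (χ : DirichletCharacter ℂ n) :
    jacobiSum (changeLevel (dvd_mul_right m n) η * changeLevel (dvd_mul_left n m) χ)
      (changeLevel (dvd_mul_right m n) η * changeLevel (dvd_mul_left n m) χ) =
      jacobiSum η η * jacobiSum χ χ := by
  unfold jacobiSum
  simp_rw [changeLevel_mul_apply h, map_sub, map_one]
  refine (Equiv.sum_comp (ZMod.chineseRemainder h).toEquiv
    (fun y => η y.1 * χ y.2 * (η (1 - y).1 * χ (1 - y).2))).trans ?_
  rw [Fintype.sum_prod_type, Finset.sum_mul_sum]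
  refine Finset.sum_congr rfl fun x _ => Finset.sum_congr rfl fun y _ => ?_
  simp only [Prod.fst_sub, Prod.snd_sub, Prod.fst_one, Prod.snd_one]
  ring

open DirichletCharacter in
theorem jacobiGauss_changeLevel_mul {m n : ℕ} [NeZero m] [NeZero n] (h : m.Coprime n)
    {η : DirichletCharacter ℂ m} {χ : DirichletCharacter ℂ n} (hη : IsPrimitiveQuartic η)
    (hχ : IsPrimitiveQuartic χ) :
    jacobiGauss (changeLevel (dvd_mul_right m n) η * changeLevel (dvd_mul_left n m) χ) =
      jacobiGauss η * jacobiGauss χ := by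
  have : NeZero (m * n) := ⟨mul_ne_zero (NeZero.ne m) (NeZero.ne n)⟩
  apply GaussianInt.toComplex_inj.mp
  rw [map_mul, toComplex_jacobiGauss hη.2.2, toComplex_jacobiGauss hχ.2.2,
    toComplex_jacobiGauss (hη.changeLevel_mul h hχ).2.2, jacobiSum_changeLevel_mul h]

theorem DirichletCharacter.isPrimitive_of_prime {p : ℕ} (hp : p.Prime)
    {χ : DirichletCharacter ℂ p} (hχ : χ ≠ 1) : χ.IsPrimitive := by
  have : NeZero p := ⟨hp.ne_zero⟩
  rcases (Nat.dvd_prime hp).mp χ.conductor_dvd_level with h | h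
  · exact absurd ((DirichletCharacter.eq_one_iff_conductor_eq_one).mpr h) hχ
  · exact h

theorem exists_isPrimitiveQuartic_of_prime {p : ℕ} (hp : p.Prime) (h4 : p % 4 = 1) :
    ∃ χ : DirichletCharacter ℂ p, IsPrimitiveQuartic χ := by
  have : Fact p.Prime := ⟨hp⟩
  obtain ⟨χ, hχ⟩ := MulChar.exists_mulChar_orderOf (ZMod p) (n := 4)
    (by rw [ZMod.card]; lia) (Complex.isPrimitiveRoot_exp 4 (by norm_num))
  refine ⟨χ, DirichletCharacter.isPrimitive_of_prime hp ?_,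
    DirichletCharacter.isPrimitive_of_prime hp ?_, hχ ▸ pow_orderOf_eq_one χ⟩
  · rintro rfl; simp at hχ
  · intro h
    have := orderOf_dvd_of_pow_eq_one h
    rw [hχ] at this
    norm_num at this

theorem IsPrimitiveQuartic.inv {q : ℕ} {χ : DirichletCharacter ℂ q}
    (hχ : IsPrimitiveQuartic χ) : IsPrimitiveQuartic χ⁻¹ := by
  refine ⟨?_, ?_, by rw [inv_pow, hχ.2.2, inv_one]⟩
  · rw [DirichletCharacter.isPrimitive_def, DirichletCharacter.conductor_inv]; exact hχ.1
  · rw [inv_pow, DirichletCharacter.isPrimitive_def, DirichletCharacter.conductor_inv]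
    exact hχ.2.1

theorem IsPrimitiveQuartic.jacobiGauss_inv {q : ℕ} [NeZero q] {χ : DirichletCharacter ℂ q}
    (hχ : IsPrimitiveQuartic χ) : jacobiGauss χ⁻¹ = star (jacobiGauss χ) := by
  apply GaussianInt.toComplex_inj.mp
  rw [GaussianInt.toComplex_star, toComplex_jacobiGauss hχ.2.2, toComplex_jacobiGauss hχ.inv.2.2,
    jacobiSum, jacobiSum, map_sum]
  refine Finset.sum_congr rfl fun x _ => ?_
  rw [map_mul, starRingEnd_apply, starRingEnd_apply, MulChar.star_apply', MulChar.star_apply']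

theorem gauss_norm_pos {k : GaussianInt} (hk : k ≠ 0) : 0 < k.norm := GaussianInt.norm_pos.mpr hk

theorem gauss_prime_of_norm {p : ℕ} (hp : p.Prime) {π : GaussianInt} (h : π.norm = p) :
    Prime π := by
  rw [← irreducible_iff_prime]
  refine ⟨fun hu => ?_, fun a b hab => ?_⟩
  · rw [← Zsqrtd.norm_eq_one_iff, h] at hu
    exact hp.one_lt.ne' (by simpa using hu)
  · have h1 : a.norm.natAbs * b.norm.natAbs = p := by
      rw [← Int.natAbs_mul, ← Zsqrtd.norm_mul, ← hab, h, Int.natAbs_natCast]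
    rw [← Zsqrtd.norm_eq_one_iff, ← Zsqrtd.norm_eq_one_iff]
    rcases (Nat.dvd_prime hp).mp (Dvd.intro _ h1) with h2 | h2
    · exact Or.inl h2
    · exact Or.inr (Nat.eq_of_mul_eq_mul_left hp.pos (by rw [← h2, h1, h2, mul_one]))

theorem star_dvd_of_dvd_star {a b : GaussianInt} (h : a ∣ star b) : star a ∣ b := by
  obtain ⟨c, hc⟩ := h
  exact ⟨star c, by rw [← star_star b, hc, star_mul, mul_comm]⟩

theorem intCast_dvd_mul_star {d : ℤ} {k : GaussianInt} (h : d ∣ k.norm) :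
    (d : GaussianInt) ∣ k * star k := by
  rw [← Zsqrtd.norm_eq_mul_conj]
  exact map_dvd (Int.castRingHom GaussianInt) h

theorem exists_jacobiGauss_eq (q : ℕ) : Odd q → Squarefree q → ∀ n : GaussianInt, n.norm = q →
    ∃ u ∈ gaussUnits, ∃ χ : DirichletCharacter ℂ q,
      IsPrimitiveQuartic χ ∧ n = u * jacobiGauss χ := by
  have unit_mem : ∀ u : GaussianInt, u.norm = 1 → u ∈ gaussUnits := by
    rintro ⟨a, b⟩ hu
    have hu : a * a + b * b = 1 := by rw [← hu, Zsqrtd.norm_def]; ring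
    have ha : -1 ≤ a ∧ a ≤ 1 := by constructor <;> nlinarith
    have hb : -1 ≤ b ∧ b ≤ 1 := by constructor <;> nlinarith
    obtain ⟨ha1, ha2⟩ := ha
    obtain ⟨hb1, hb2⟩ := hb
    interval_cases a <;> interval_cases b <;> first | (exfalso; revert hu; norm_num; done) | decide
  induction q using induction_on_primes with
  | zero => intro h; simp at h
  | one =>
    intro _ _ n hn
    have hg : IsPrimitiveQuartic (1 : DirichletCharacter ℂ 1) :=
      ⟨DirichletCharacter.isPrimitive_one_level_one, by
        rw [one_pow]; exact DirichletCharacter.isPrimitive_one_level_one, one_pow 4⟩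
    have hJ := hg.norm_jacobiGauss
    set J := jacobiGauss (1 : DirichletCharacter ℂ 1)
    have hJu : J ∈ gaussUnits := unit_mem _ (by simpa using hJ)
    refine ⟨n * star J, mul_mem_gaussUnits (unit_mem _ (by simpa using hn))
      (star_mem_gaussUnits hJu), 1, hg, ?_⟩
    rw [mul_assoc, mul_comm (star J), mul_star_of_mem_gaussUnits hJu, mul_one]
  | prime_mul p a hp ih =>
    intro ho hsq n hn
    have hcop : p.Coprime a := Nat.coprime_of_squarefree_mul hsq
    obtain ⟨hpo, hao⟩ := Nat.odd_mul.mp ho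
    have : NeZero p := ⟨hp.ne_zero⟩
    have : NeZero a := ⟨hao.pos.ne'⟩
    have hdvd : ((p : ℤ) : GaussianInt) ∣ n * star n :=
      intCast_dvd_mul_star (by rw [hn]; exact_mod_cast dvd_mul_right p a)
    have hp4 : p % 4 = 1 := by
      by_contra h4
      have hp3 : p % 4 = 3 := by rcases hpo with ⟨k, rfl⟩; lia
      have : Fact p.Prime := ⟨hp⟩
      have hprime := GaussianInt.prime_of_nat_prime_of_mod_four_eq_three p hp3
      have hdn : (p : GaussianInt) ∣ n := by
        rcases hprime.dvd_or_dvd (by simpa using hdvd) with h | h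
        · exact h
        · simpa using star_dvd_of_dvd_star h
      obtain ⟨c, rfl⟩ := hdn
      rw [Zsqrtd.norm_mul, show (p : GaussianInt).norm = p * p by
        rw [Zsqrtd.norm_natCast], mul_assoc] at hn
      push_cast at hn
      have h3 := mul_left_cancel₀ (by exact_mod_cast hp.ne_zero) hn
      have h4 : (p : ℤ) ∣ a := ⟨_, h3.symm⟩
      have h5 : p ∣ a := by exact_mod_cast h4
      exact hp.one_lt.ne' (Nat.Coprime.eq_one_of_dvd hcop h5)
    obtain ⟨η, hη⟩ := exists_isPrimitiveQuartic_of_prime hp hp4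
    have key : ∃ η : DirichletCharacter ℂ p, IsPrimitiveQuartic η ∧ jacobiGauss η ∣ n := by
      have h1 : jacobiGauss η ∣ n * star n := by
        refine dvd_trans ?_ hdvd
        rw [← hη.norm_jacobiGauss, Zsqrtd.norm_eq_mul_conj]
        exact dvd_mul_right _ _
      rcases (gauss_prime_of_norm hp hη.norm_jacobiGauss).dvd_or_dvd h1 with h | h
      · exact ⟨η, hη, h⟩
      · exact ⟨η⁻¹, hη.inv, by rw [hη.jacobiGauss_inv]; exact star_dvd_of_dvd_star h⟩
    obtain ⟨η, hη, c, rfl⟩ := key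
    rw [Zsqrtd.norm_mul, hη.norm_jacobiGauss, Nat.cast_mul] at hn
    obtain ⟨u, hu, χ, hχ, rfl⟩ := ih hao (hsq.of_mul_right) c
      (mul_left_cancel₀ (by exact_mod_cast hp.ne_zero) hn)
    refine ⟨u, hu, _, hη.changeLevel_mul hcop hχ, ?_⟩
    rw [jacobiGauss_changeLevel_mul hcop hη hχ]
    ring

theorem dvd_or_sq_dvd_of_prime_norm {p : ℕ} (hp : p.Prime) {π k : GaussianInt}
    (hπ : π.norm = p) (hk : ((p * p : ℕ) : ℤ) ∣ k.norm) (h : π ∣ k) :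
    (p : GaussianInt) ∣ k ∨ π ^ 2 ∣ k := by
  have hprime := gauss_prime_of_norm hp hπ
  have hpp : (p : GaussianInt) = π * star π := by
    rw [← Zsqrtd.norm_eq_mul_conj, hπ]; simp
  obtain ⟨c, rfl⟩ := h
  rw [Zsqrtd.norm_mul, hπ, Nat.cast_mul] at hk
  have h1 := intCast_dvd_mul_star
    ((mul_dvd_mul_iff_left (by exact_mod_cast hp.ne_zero)).mp hk)
  have h2 : π ∣ c * star c := by
    refine dvd_trans ?_ h1
    rw [← hπ, Zsqrtd.norm_eq_mul_conj]
    exact dvd_mul_right _ _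
  rcases hprime.dvd_or_dvd h2 with h | h
  · right; rw [sq]; exact mul_dvd_mul_left _ h
  · left; rw [hpp]; exact mul_dvd_mul_left _ (star_dvd_of_dvd_star h)

theorem natCast_dvd_or_sq_dvd {p : ℕ} (hp : p.Prime) {k : GaussianInt}
    (hk : ((p * p : ℕ) : ℤ) ∣ k.norm) :
    (p : GaussianInt) ∣ k ∨ ∃ π : GaussianInt, π.norm = p ∧ π ^ 2 ∣ k := by
  have : Fact p.Prime := ⟨hp⟩
  have h1 : (p : GaussianInt) ∣ k * star k := by
    have := intCast_dvd_mul_star ((dvd_mul_right (p : ℤ) p).trans (by exact_mod_cast hk))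
    simpa using this
  by_cases hirr : Irreducible (p : GaussianInt)
  · left
    rcases hirr.prime.dvd_or_dvd h1 with h | h
    · exact h
    · simpa using star_dvd_of_dvd_star h
  · obtain ⟨a, b, hab⟩ := GaussianInt.sq_add_sq_of_nat_prime_of_not_irreducible p hirr
    have hπ : (⟨a, b⟩ : GaussianInt).norm = p := by
      rw [Zsqrtd.norm_def, ← hab]; push_cast; ring
    set π : GaussianInt := ⟨a, b⟩
    have h2 : π ∣ k * star k := by
      refine dvd_trans ?_ h1
      rw [show (p : GaussianInt) = π * star π by rw [← Zsqrtd.norm_eq_mul_conj, hπ]; simp]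
      exact dvd_mul_right _ _
    rcases (gauss_prime_of_norm hp hπ).dvd_or_dvd h2 with h | h
    · exact (dvd_or_sq_dvd_of_prime_norm hp hπ hk h).imp_right fun h => ⟨_, hπ, h⟩
    · have hπ' : (star π).norm = p := by rw [gauss_norm_star, hπ]
      exact (dvd_or_sq_dvd_of_prime_norm hp hπ' hk (star_dvd_of_dvd_star h)).imp_right
        fun h => ⟨_, hπ', h⟩

theorem exists_decomposition_aux (N : ℕ) : ∀ k : GaussianInt, k ≠ 0 → k.norm.natAbs ≤ N →
    ∃ (e t : ℕ) (w n : GaussianInt), 1 ≤ t ∧ w ≠ 0 ∧ Odd n.norm.natAbs ∧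
      Squarefree n.norm.natAbs ∧ k = (⟨1, 1⟩ : GaussianInt) ^ e * t * w ^ 2 * n := by
  induction N with
  | zero =>
    intro k hk h
    have := gauss_norm_pos hk
    lia
  | succ N ih =>
    intro k hk h
    have step : ∀ c d : GaussianInt, k = c * d → 1 < c.norm → d ≠ 0 ∧ d.norm.natAbs ≤ N := by
      rintro c d rfl hc
      have hd : d ≠ 0 := right_ne_zero_of_mul hk
      have := gauss_norm_pos hd
      rw [Zsqrtd.norm_mul, Int.natAbs_mul] at h
      refine ⟨hd, ?_⟩
      have h2 : 2 ≤ c.norm.natAbs := by lia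
      have h3 : 1 ≤ d.norm.natAbs := by lia
      nlinarith
    by_cases ho : Odd k.norm.natAbs
    · by_cases hsq : Squarefree k.norm.natAbs
      · exact ⟨0, 1, 1, k, le_rfl, one_ne_zero, ho, hsq, by simp⟩
      · rw [Nat.squarefree_iff_prime_squarefree] at hsq
        push Not at hsq
        obtain ⟨p, hp, hpk⟩ := hsq
        have hp1 := hp.one_lt
        rcases natCast_dvd_or_sq_dvd hp (Int.natCast_dvd.mpr hpk) with ⟨d, hd⟩ | ⟨π, hπ, d, hd⟩
        · obtain ⟨h1, h2⟩ := step _ _ hd (by rw [Zsqrtd.norm_natCast]; norm_cast; nlinarith)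
          obtain ⟨e, t, w, n, ht, hw, hn1, hn2, rfl⟩ := ih d h1 h2
          refine ⟨e, p * t, w, n, Nat.mul_pos hp.pos ht, hw, hn1, hn2, ?_⟩
          rw [hd]; push_cast; ring
        · obtain ⟨h1, h2⟩ := step _ _ hd (by
            rw [sq, Zsqrtd.norm_mul, hπ]; norm_cast; nlinarith)
          obtain ⟨e, t, w, n, ht, hw, hn1, hn2, rfl⟩ := ih d h1 h2
          refine ⟨e, t, π * w, n, ht, mul_ne_zero ?_ hw, hn1, hn2, ?_⟩
          · exact (gauss_prime_of_norm hp hπ).ne_zero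
          · rw [hd]; ring
    · have hk2 : ∃ d, k = (⟨1, 1⟩ : GaussianInt) * d := by
        obtain ⟨x, y⟩ := k
        have h2 : (2 : ℤ) ∣ x * x + y * y := by
          rw [Nat.not_odd_iff_even, even_iff_two_dvd, ← Int.natCast_dvd] at ho
          rw [Zsqrtd.norm_def] at ho
          exact ho.trans (dvd_of_eq (by ring))
        have h3 : (x + y) % 2 = 0 := by
          rcases Int.emod_two_eq_zero_or_one x with hx | hx <;>
          rcases Int.emod_two_eq_zero_or_one y with hy | hy
          · lia
          · rw [Int.dvd_iff_emod_eq_zero, Int.add_emod, Int.mul_emod, Int.mul_emod y, hx, hy] at h2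
            norm_num at h2
          · rw [Int.dvd_iff_emod_eq_zero, Int.add_emod, Int.mul_emod, Int.mul_emod y, hx, hy] at h2
            norm_num at h2
          · lia
        refine ⟨⟨(x + y) / 2, (y - x) / 2⟩, ?_⟩
        ext
        · simp; lia
        · simp; lia
      obtain ⟨d, hd⟩ := hk2
      obtain ⟨h1, h2⟩ := step _ _ hd (by decide)
      obtain ⟨e, t, w, n, ht, hw, hn1, hn2, rfl⟩ := ih d h1 h2
      exact ⟨e + 1, t, w, n, ht, hw, hn1, hn2, by rw [hd]; ring⟩

/-- Every nonzero Gaussian integer is, up to a unit, a power of `1 + i` times a rational integer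
times a square times the Jacobi sum of a primitive quartic character. -/
theorem exists_decomposition {k : GaussianInt} (hk : k ≠ 0) :
    ∃ u ∈ gaussUnits, ∃ (e t : ℕ) (w : GaussianInt) (i : Σ q : ℕ, DirichletCharacter ℂ q),
      1 ≤ t ∧ w ≠ 0 ∧ 1 ≤ i.1 ∧ IsPrimitiveQuartic i.2 ∧
        k = u * (⟨1, 1⟩ : GaussianInt) ^ e * t * w ^ 2 * jacobiGauss i.2 := by
  obtain ⟨e, t, w, n, ht, hw, hn1, hn2, rfl⟩ := exists_decomposition_aux _ k hk le_rfl
  have hn : n.norm = (n.norm.natAbs : ℕ) := by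
    rw [Int.natCast_natAbs, abs_of_nonneg (GaussianInt.norm_nonneg n)]
  obtain ⟨u, hu, χ, hχ, hnu⟩ := exists_jacobiGauss_eq _ hn1 hn2 n hn
  refine ⟨u, hu, e, t, w, ⟨_, χ⟩, ht, hw, hn1.pos, hχ, ?_⟩
  conv_lhs => rw [hnu]
  ring

theorem LargeSieve.mono {ι : Type*} {s s' : Finset ι} {φ : ι → ℕ → ℂ} {X X' : ℕ} {B B' : ℝ}
    (h : LargeSieve s' φ X' B) (hs : s ⊆ s') (hX : X ≤ X') (hB : B ≤ B') :
    LargeSieve s φ X B' := by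
  intro a
  have hsub : squarefreeUpTo X ⊆ squarefreeUpTo X' := fun m hm => by
    obtain ⟨⟨h1, h2⟩, h3⟩ := mem_squarefreeUpTo.mp hm
    exact mem_squarefreeUpTo.mpr ⟨⟨h1, h2.trans hX⟩, h3⟩
  have hfil : (squarefreeUpTo X').filter (· ≤ X) = squarefreeUpTo X := by
    ext m
    simp only [Finset.mem_filter, mem_squarefreeUpTo]
    constructor
    · rintro ⟨⟨⟨h1, _⟩, h2⟩, h3⟩; exact ⟨⟨h1, h3⟩, h2⟩
    · rintro ⟨⟨h1, h3⟩, h2⟩; exact ⟨⟨⟨h1, h3.trans hX⟩, h2⟩, h3⟩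
  have h1 := h fun m => if m ≤ X then a m else 0
  have e1 : ∀ i, ∑ m ∈ squarefreeUpTo X', (if m ≤ X then a m else 0) * φ i m =
      ∑ m ∈ squarefreeUpTo X, a m * φ i m := by
    intro i
    rw [← hfil, Finset.sum_filter]
    exact Finset.sum_congr rfl fun m _ => by split_ifs <;> simp
  have e2 : ∑ m ∈ squarefreeUpTo X', ‖if m ≤ X then a m else 0‖ ^ 2 =
      ∑ m ∈ squarefreeUpTo X, ‖a m‖ ^ 2 := by
    rw [← hfil, Finset.sum_filter]
    exact Finset.sum_congr rfl fun m _ => by split_ifs <;> simp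
  simp only [e1, e2] at h1
  have h2 : (0 : ℝ) ≤ ∑ m ∈ squarefreeUpTo X, ‖a m‖ ^ 2 :=
    Finset.sum_nonneg fun _ _ => by positivity
  exact (Finset.sum_le_sum_of_subset_of_nonneg hs fun _ _ _ => by positivity).trans
    (h1.trans (by gcongr))

theorem sum_Icc_two_pow {M : Type*} [AddCommMonoid M] (f : ℕ → M) (J : ℕ) :
    ∑ m ∈ Finset.Icc 1 (2 ^ J), f m =
      f 1 + ∑ j ∈ Finset.range J, ∑ m ∈ Finset.Ioc (2 ^ j) (2 * 2 ^ j), f m := by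
  induction J with
  | zero => simp
  | succ J ih =>
    rw [Finset.sum_range_succ, ← add_assoc, ← ih, pow_succ, mul_comm _ 2]
    rw [← Finset.sum_union]
    · congr 1
      ext m
      have := Nat.one_le_two_pow (n := J)
      simp only [Finset.mem_Icc, Finset.mem_union, Finset.mem_Ioc]
      lia
    · rw [Finset.disjoint_left]
      intro m hm
      simp only [Finset.mem_Icc, Finset.mem_Ioc] at hm ⊢
      lia

theorem exists_log_le (ε : ℝ) (hε : 0 < ε) :
    ∃ C : ℝ, 1 ≤ C ∧ ∀ J : ℕ, (J : ℝ) ≤ C * ((2 ^ J : ℕ) : ℝ) ^ ε := by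
  obtain ⟨C, hC1, hC⟩ := exists_card_divisors_le ε hε
  refine ⟨C, hC1, fun J => ?_⟩
  have h := hC (2 ^ J) (by positivity)
  rw [Nat.divisors_prime_pow Nat.prime_two, Finset.card_map, Finset.card_range] at h
  push_cast at h ⊢
  linarith

/-- The value at `m` of a Dirichlet character of unspecified modulus. -/
def charEval (i : Σ q : ℕ, DirichletCharacter ℂ q) (m : ℕ) : ℂ := i.2 (m : ZMod i.1)

theorem charEval_mul (i : Σ q : ℕ, DirichletCharacter ℂ q) (m n : ℕ) :
    charEval i (m * n) = charEval i m * charEval i n := by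
  rw [charEval, Nat.cast_mul, map_mul]; rfl

theorem norm_charEval_le (i : Σ q : ℕ, DirichletCharacter ℂ q) (m : ℕ) : ‖charEval i m‖ ≤ 1 :=
  DirichletCharacter.norm_le_one _ _

theorem quartSieveSum_eq (Q M : ℕ) (a : ℕ → ℂ) :
    quartSieveSum Q M a = ∑ q ∈ Finset.Ioc Q (2 * Q), ∑ χ ∈ primitiveQuartics q,
      ‖∑ m ∈ (Finset.Ioc M (2 * M)).filter Squarefree, a m * charEval ⟨q, χ⟩ m‖ ^ 2 := by
  refine Finset.sum_congr rfl fun q hq => ?_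
  have hq0 : q ≠ 0 := by have := (Finset.mem_Ioc.mp hq).1; lia
  have := finite_dirichletCharacter hq0
  have := Fintype.ofFinite (DirichletCharacter ℂ q)
  rw [finsum_eq_sum_of_fintype, ← Finset.sum_filter]
  have hset : (Finset.univ.filter fun χ : DirichletCharacter ℂ q =>
      χ.IsPrimitive ∧ (χ ^ 2).IsPrimitive ∧ χ ^ 4 = 1) = primitiveQuartics q := by
    ext χ
    rw [mem_primitiveQuartics hq0, Finset.mem_filter]
    simp [IsPrimitiveQuartic]
  rw [hset]
  refine Finset.sum_congr rfl fun χ _ => ?_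
  rw [Finset.sum_filter]
  rfl

theorem largeSieve_two_pow {ε K : ℝ} (hε : 0 < ε) (hK : 0 ≤ K)
    (h : ∀ Q M : ℕ, 1 ≤ M → 1 ≤ Q → ∀ a : ℕ → ℂ, quartSieveSum Q M a ≤
      K * ((Q : ℝ) * M) ^ ε * ((M : ℝ) + (Q : ℝ) ^ ((3 : ℝ) / 2)) *
        ∑ m ∈ Finset.Ioc M (2 * M), if Squarefree m then ‖a m‖ ^ 2 else 0) (J R : ℕ) :
    LargeSieve (quarticFamily (2 ^ R)) charEval (2 ^ J)
      (18 * 2 ^ R + 2 * J * (9 * 2 ^ J + R * (K * ((2 : ℝ) ^ J * 2 ^ R) ^ ε *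
        (2 ^ J + ((2 : ℝ) ^ R) ^ ((3 : ℝ) / 2))))) := by
  intro a
  set W := K * ((2 : ℝ) ^ J * 2 ^ R) ^ ε * (2 ^ J + ((2 : ℝ) ^ R) ^ ((3 : ℝ) / 2)) with hW
  set A : ℕ → ℝ := fun j => ∑ m ∈ (Finset.Ioc (2 ^ j) (2 * 2 ^ j)).filter Squarefree, ‖a m‖ ^ 2
    with hA
  set S : ℕ → (Σ q : ℕ, DirichletCharacter ℂ q) → ℂ := fun j i =>
    ∑ m ∈ (Finset.Ioc (2 ^ j) (2 * 2 ^ j)).filter Squarefree, a m * charEval i m with hS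
  have hA0 : ∀ j, 0 ≤ A j := fun j => Finset.sum_nonneg fun _ _ => by positivity
  have hdec : ∀ i, ∑ m ∈ squarefreeUpTo (2 ^ J), a m * charEval i m =
      a 1 * charEval i 1 + ∑ j ∈ Finset.range J, S j i := by
    intro i
    simp only [squarefreeUpTo, hS, Finset.sum_filter]
    rw [sum_Icc_two_pow, if_pos squarefree_one]
  have hdecA : ∑ m ∈ squarefreeUpTo (2 ^ J), ‖a m‖ ^ 2 = ‖a 1‖ ^ 2 +
      ∑ j ∈ Finset.range J, A j := by
    simp only [squarefreeUpTo, hA, Finset.sum_filter]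
    rw [sum_Icc_two_pow, if_pos squarefree_one]
  have hpt : ∀ i, ‖∑ m ∈ squarefreeUpTo (2 ^ J), a m * charEval i m‖ ^ 2 ≤
      2 * ‖a 1‖ ^ 2 + 2 * (J * ∑ j ∈ Finset.range J, ‖S j i‖ ^ 2) := by
    intro i
    rw [hdec]
    have h1 : ‖a 1 * charEval i 1‖ ≤ ‖a 1‖ := by
      rw [norm_mul]
      exact mul_le_of_le_one_right (norm_nonneg _) (norm_charEval_le _ _)
    have h2 : ‖∑ j ∈ Finset.range J, S j i‖ ^ 2 ≤ J * ∑ j ∈ Finset.range J, ‖S j i‖ ^ 2 := by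
      have := sq_sum_le_card_mul_sum_sq (s := Finset.range J) (f := fun j => ‖S j i‖)
      rw [Finset.card_range] at this
      exact (pow_le_pow_left₀ (norm_nonneg _) (norm_sum_le _ _) 2).trans this
    calc _ ≤ (‖a 1 * charEval i 1‖ + ‖∑ j ∈ Finset.range J, S j i‖) ^ 2 := by
          gcongr; exact norm_add_le _ _
      _ ≤ 2 * ‖a 1 * charEval i 1‖ ^ 2 + 2 * ‖∑ j ∈ Finset.range J, S j i‖ ^ 2 := by
          nlinarith [sq_nonneg (‖a 1 * charEval i 1‖ - ‖∑ j ∈ Finset.range J, S j i‖)]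
      _ ≤ _ := by gcongr
  have hj : ∀ j ∈ Finset.range J, ∑ i ∈ quarticFamily (2 ^ R), ‖S j i‖ ^ 2 ≤
      (9 * 2 ^ J + R * W) * A j := by
    intro j hj
    have hjJ : j + 1 ≤ J := Finset.mem_range.mp hj
    have hpow : (2 : ℝ) * 2 ^ j ≤ 2 ^ J := by
      rw [← pow_succ']; exact pow_le_pow_right₀ (by norm_num) hjJ
    rw [quarticFamily, Finset.sum_sigma, sum_Icc_two_pow, add_mul]
    refine add_le_add ?_ ?_
    · have hc : (primitiveQuartics 1).card ≤ 9 := by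
        have := card_quarticFamily_le le_rfl
        rw [quarticFamily, Finset.card_sigma] at this
        simpa using this
      have hS1 : ∀ χ ∈ primitiveQuartics 1, ‖S j ⟨1, χ⟩‖ ^ 2 ≤ 2 ^ J * A j := by
        intro χ _
        have h1 : ‖S j ⟨1, χ⟩‖ ≤
            ∑ m ∈ (Finset.Ioc (2 ^ j) (2 * 2 ^ j)).filter Squarefree, ‖a m‖ := by
          refine (norm_sum_le _ _).trans (Finset.sum_le_sum fun m _ => ?_)
          rw [norm_mul]
          exact mul_le_of_le_one_right (norm_nonneg _) (norm_charEval_le _ _)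
        have h2 := sq_sum_le_card_mul_sum_sq
          (s := (Finset.Ioc (2 ^ j) (2 * 2 ^ j)).filter Squarefree) (f := fun m => ‖a m‖)
        have h3 : (((Finset.Ioc (2 ^ j) (2 * 2 ^ j)).filter Squarefree).card : ℝ) ≤ 2 ^ J := by
          refine le_trans ?_ hpow
          have : ((Finset.Ioc (2 ^ j) (2 * 2 ^ j)).filter Squarefree).card ≤ 2 * 2 ^ j :=
            (Finset.card_filter_le _ _).trans (by rw [Nat.card_Ioc]; lia)
          exact_mod_cast this
        exact (pow_le_pow_left₀ (norm_nonneg _) h1 2).trans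
          (h2.trans (mul_le_mul_of_nonneg_right h3 (hA0 j)))
      refine (Finset.sum_le_card_nsmul _ _ _ hS1).trans ?_
      rw [nsmul_eq_mul, mul_assoc]
      have : ((primitiveQuartics 1).card : ℝ) ≤ 9 := by exact_mod_cast hc
      gcongr
    · have hr : ∀ r ∈ Finset.range R, ∑ q ∈ Finset.Ioc (2 ^ r) (2 * 2 ^ r),
          ∑ χ ∈ primitiveQuartics q, ‖S j ⟨q, χ⟩‖ ^ 2 ≤ W * A j := by
        intro r hr
        have h1 := h (2 ^ r) (2 ^ j) Nat.one_le_two_pow Nat.one_le_two_pow a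
        rw [quartSieveSum_eq, ← Finset.sum_filter] at h1
        refine h1.trans (mul_le_mul_of_nonneg_right ?_ (hA0 j))
        have hj' : (2 : ℝ) ^ j ≤ 2 ^ J := pow_le_pow_right₀ (by norm_num) (by lia)
        have hr' : (2 : ℝ) ^ r ≤ 2 ^ R :=
          pow_le_pow_right₀ (by norm_num) (Finset.mem_range.mp hr).le
        push_cast
        rw [hW, mul_comm ((2 : ℝ) ^ r)]
        gcongr
      refine (Finset.sum_le_card_nsmul _ _ _ hr).trans ?_
      rw [nsmul_eq_mul, Finset.card_range]
      exact (mul_assoc _ _ _).symm.le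
  have hcard : ((quarticFamily (2 ^ R)).card : ℝ) ≤ 9 * 2 ^ R := by
    exact_mod_cast card_quarticFamily_le Nat.one_le_two_pow
  have hAsum : 0 ≤ ∑ j ∈ Finset.range J, A j := Finset.sum_nonneg fun j _ => hA0 j
  have hW0 : 0 ≤ W := by positivity
  calc _ ≤ ∑ i ∈ quarticFamily (2 ^ R),
        (2 * ‖a 1‖ ^ 2 + 2 * (J * ∑ j ∈ Finset.range J, ‖S j i‖ ^ 2)) :=
        Finset.sum_le_sum fun i _ => hpt i
    _ = (quarticFamily (2 ^ R)).card * (2 * ‖a 1‖ ^ 2) +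
        2 * (J * ∑ j ∈ Finset.range J, ∑ i ∈ quarticFamily (2 ^ R), ‖S j i‖ ^ 2) := by
        rw [Finset.sum_add_distrib, Finset.sum_const, nsmul_eq_mul, ← Finset.mul_sum,
          ← Finset.mul_sum, Finset.sum_comm]
    _ ≤ 9 * 2 ^ R * (2 * ‖a 1‖ ^ 2) +
        2 * (J * ∑ j ∈ Finset.range J, (9 * 2 ^ J + R * W) * A j) := by
        gcongr with j hj'
        exact hj j hj'
    _ ≤ _ := by
        rw [← Finset.mul_sum, hdecA]
        have h1 : 0 ≤ 18 * (2 : ℝ) ^ R * ∑ j ∈ Finset.range J, A j := by positivity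
        have h2 : 0 ≤ 2 * (J : ℝ) * (9 * 2 ^ J + R * W) * ‖a 1‖ ^ 2 := by positivity
        linarith

theorem exists_largeSieve_base
    (h : ∀ ε : ℝ, 0 < ε → ∃ K : ℝ, 0 ≤ K ∧
      ∀ Q M : ℕ, 1 ≤ M → 1 ≤ Q → ∀ a : ℕ → ℂ, quartSieveSum Q M a ≤
        K * ((Q : ℝ) * M) ^ ε * ((M : ℝ) + (Q : ℝ) ^ ((3 : ℝ) / 2)) *
          ∑ m ∈ Finset.Ioc M (2 * M), if Squarefree m then ‖a m‖ ^ 2 else 0)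
    {ε : ℝ} (hε : 0 < ε) :
    ∃ K : ℝ, 0 ≤ K ∧ ∀ X Y : ℕ, 1 ≤ X → 1 ≤ Y →
      LargeSieve (quarticFamily Y) charEval X
        (K * ((X : ℝ) * Y) ^ ε * (X + (Y : ℝ) ^ ((3 : ℝ) / 2))) := by
  obtain ⟨K, hK, h⟩ := h (ε / 2) (by positivity)
  obtain ⟨C, hC1, hC⟩ := exists_log_le (ε / 2) (by positivity)
  refine ⟨(18 + 18 * C + 2 * C ^ 2 * K) * ((4 : ℝ) ^ ε * 4), by positivity, fun X Y hX hY => ?_⟩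
  have hpow : ∀ n : ℕ, 1 ≤ n → n ≤ 2 ^ Nat.clog 2 n ∧ (2 : ℝ) ^ Nat.clog 2 n ≤ 2 * n := by
    intro n hn
    refine ⟨Nat.le_pow_clog one_lt_two n, ?_⟩
    rcases hn.eq_or_lt with rfl | hn
    · simp
    · have h1 := Nat.pow_pred_clog_lt_self one_lt_two hn
      have h2 := Nat.clog_pos one_lt_two hn
      have h3 : 2 ^ Nat.clog 2 n = 2 * 2 ^ (Nat.clog 2 n).pred := by
        rw [← pow_succ']
        exact congrArg _ (Nat.succ_pred_eq_of_pos h2).symm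
      have h4 : 2 ^ Nat.clog 2 n ≤ 2 * n := by rw [h3]; gcongr
      exact_mod_cast h4
  obtain ⟨hX1, hX2⟩ := hpow X hX
  obtain ⟨hY1, hY2⟩ := hpow Y hY
  set J := Nat.clog 2 X
  set R := Nat.clog 2 Y
  refine (largeSieve_two_pow (by positivity) hK h J R).mono (fun i hi => ?_) hX1 ?_
  · obtain ⟨h1, h2, h3⟩ := mem_quarticFamily.mp hi
    exact mem_quarticFamily.mpr ⟨h1, h2.trans hY1, h3⟩
  have hJ := hC J
  have hR := hC R
  push_cast at hJ hR
  set x := (2 : ℝ) ^ J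
  set y := (2 : ℝ) ^ R
  have hx1 : 1 ≤ x := one_le_pow₀ (by norm_num)
  have hy1 : 1 ≤ y := one_le_pow₀ (by norm_num)
  have hxε : 1 ≤ x ^ (ε / 2) := Real.one_le_rpow hx1 (by positivity)
  have hyε : 1 ≤ y ^ (ε / 2) := Real.one_le_rpow hy1 (by positivity)
  have hyy : y ≤ y ^ ((3 : ℝ) / 2) := by
    conv_lhs => rw [← Real.rpow_one y]
    exact Real.rpow_le_rpow_of_exponent_le hy1 (by norm_num)
  have hxy : (x * y) ^ (ε / 2) = x ^ (ε / 2) * y ^ (ε / 2) :=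
    Real.mul_rpow (by positivity) (by positivity)
  have hxyε : (x * y) ^ ε = (x ^ (ε / 2) * y ^ (ε / 2)) * (x ^ (ε / 2) * y ^ (ε / 2)) := by
    rw [← hxy, ← Real.rpow_add (by positivity)]
    congr 1; ring
  have step1 : 18 * y + 2 * J * (9 * x + R * (K * (x * y) ^ (ε / 2) *
      (x + y ^ ((3 : ℝ) / 2)))) ≤ (18 + 18 * C + 2 * C ^ 2 * K) * ((x * y) ^ ε *
        (x + y ^ ((3 : ℝ) / 2))) := by
    rw [hxyε, hxy]
    set u := x ^ (ε / 2)
    set v := y ^ (ε / 2)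
    set z := y ^ ((3 : ℝ) / 2)
    have hz : 0 ≤ z := by positivity
    have huv : 1 ≤ u * v := one_le_mul_of_one_le_of_one_le hxε hyε
    have huv2 : 1 ≤ u * v * (u * v) := one_le_mul_of_one_le_of_one_le huv huv
    have t1 : y ≤ u * v * (u * v) * (x + z) := by
      calc y ≤ 1 * (x + z) := by linarith
        _ ≤ _ := by gcongr
    have t2 : J * x ≤ C * (u * v * (u * v) * (x + z)) := by
      calc J * x ≤ C * u * (x + z) := by gcongr; linarith
        _ = C * (u * 1 * (1 * 1) * (x + z)) := by ring
        _ ≤ C * (u * v * (u * v) * (x + z)) := by gcongr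
    have t3 : J * (R * (K * (u * v) * (x + z))) ≤ C ^ 2 * K * (u * v * (u * v) * (x + z)) := by
      calc J * (R * (K * (u * v) * (x + z))) ≤ (C * u) * ((C * v) * (K * (u * v) * (x + z))) := by
            gcongr
        _ = _ := by ring
    linarith
  refine step1.trans ?_
  have step2 : (x * y) ^ ε ≤ 4 ^ ε * ((X : ℝ) * Y) ^ ε := by
    rw [← Real.mul_rpow (by positivity) (by positivity)]
    refine Real.rpow_le_rpow (by positivity) ?_ hε.le
    calc x * y ≤ (2 * X) * (2 * Y) := by gcongr
      _ = _ := by ring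
  have step3 : x + y ^ ((3 : ℝ) / 2) ≤ 4 * (X + (Y : ℝ) ^ ((3 : ℝ) / 2)) := by
    have h1 : y ^ ((3 : ℝ) / 2) ≤ (2 * Y) ^ ((3 : ℝ) / 2) :=
      Real.rpow_le_rpow (by positivity) hY2 (by norm_num)
    rw [Real.mul_rpow (by norm_num) (by positivity)] at h1
    have h2 : (2 : ℝ) ^ ((3 : ℝ) / 2) ≤ 2 ^ (2 : ℝ) :=
      Real.rpow_le_rpow_of_exponent_le (by norm_num) (by norm_num)
    have h3 : (0 : ℝ) ≤ (Y : ℝ) ^ ((3 : ℝ) / 2) := by positivity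
    norm_num at h2
    have h4 : (0 : ℝ) ≤ X := by positivity
    nlinarith
  calc _ ≤ (18 + 18 * C + 2 * C ^ 2 * K) * ((4 ^ ε * ((X : ℝ) * Y) ^ ε) *
        (4 * (X + (Y : ℝ) ^ ((3 : ℝ) / 2)))) := by gcongr
    _ = _ := by ring

theorem exists_largeSieve_sq
    (h : ∀ ε : ℝ, 0 < ε → ∃ K : ℝ, 0 ≤ K ∧ ∀ X Y : ℕ, 1 ≤ X → 1 ≤ Y →
      LargeSieve (quarticFamily Y) charEval X
        (K * ((X : ℝ) * Y) ^ ε * (X + (Y : ℝ) ^ ((3 : ℝ) / 2))))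
    {ε : ℝ} (hε : 0 < ε) :
    ∃ K : ℝ, 0 ≤ K ∧ ∀ X Y : ℕ, 1 ≤ X → 1 ≤ Y →
      LargeSieve (quarticFamily Y) charEval X
        (K * ((X : ℝ) * Y) ^ ε * ((Y : ℝ) ^ ((5 : ℝ) / 4) + (Y : ℝ) ^ ((1 : ℝ) / 2) * X)) := by
  obtain ⟨K, hK, h⟩ := h (ε / 6) (by positivity)
  obtain ⟨C, hC1, hC⟩ := exists_card_divisors_le (ε / 6) (by positivity)
  refine ⟨9 * (K + 1) * C ^ 2, by positivity, fun X Y hX hY a => ?_⟩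
  have hX1 : (1 : ℝ) ≤ X := by exact_mod_cast hX
  have hY1 : (1 : ℝ) ≤ Y := by exact_mod_cast hY
  have hx1 : 1 ≤ (X : ℝ) ^ (ε / 6) := Real.one_le_rpow hX1 (by positivity)
  have hy1 : 1 ≤ (Y : ℝ) ^ (ε / 6) := Real.one_le_rpow hY1 (by positivity)
  have h2 := (h (X * X) Y (by nlinarith) hY).sq_le charEval_mul norm_charEval_le
    (T := C * (((X : ℝ) ^ (ε / 6)) ^ 2)) (one_le_mul_of_one_le_of_one_le hC1 (one_le_pow₀ hx1))
    (by positivity) (fun n hn => by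
      obtain ⟨hn1, hn2⟩ := Finset.mem_Icc.mp hn
      refine (hC n (by lia)).trans ?_
      have : (n : ℝ) ≤ (X : ℝ) * X := by exact_mod_cast hn2
      rw [sq, ← Real.mul_rpow (by positivity) (by positivity)]
      gcongr) a
  have hcard : ((quarticFamily Y).card : ℝ) ≤ 9 * Y := by exact_mod_cast card_quarticFamily_le hY
  set S := ∑ i ∈ quarticFamily Y, ‖∑ m ∈ squarefreeUpTo X, a m * charEval i m‖ ^ 2
  set A := ∑ m ∈ squarefreeUpTo X, ‖a m‖ ^ 2
  have hA : 0 ≤ A := Finset.sum_nonneg fun _ _ => by positivity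
  have e1 : ((X : ℝ) * Y) ^ ε = (((X : ℝ) ^ (ε / 6)) * (Y : ℝ) ^ (ε / 6)) ^ 6 := by
    rw [← Real.mul_rpow (by positivity) (by positivity), ← Real.rpow_natCast,
      ← Real.rpow_mul (by positivity)]
    congr 1; push_cast; ring
  have e2 : (((X * X : ℕ) : ℝ) * Y) ^ (ε / 6) =
      ((X : ℝ) ^ (ε / 6)) ^ 2 * (Y : ℝ) ^ (ε / 6) := by
    push_cast
    rw [Real.mul_rpow (by positivity) (by positivity), Real.mul_rpow (by positivity) (by positivity)]
    ring
  rw [e2] at h2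
  rw [e1]
  set y := (Y : ℝ) ^ ((1 : ℝ) / 4) with hy
  have hyp : ∀ n : ℕ, (Y : ℝ) ^ ((n : ℝ) / 4) = y ^ n := by
    intro n
    rw [hy, ← Real.rpow_natCast, ← Real.rpow_mul (by positivity)]
    congr 1; ring
  have hy0 : 0 ≤ y := by positivity
  have y5 : (Y : ℝ) ^ ((5 : ℝ) / 4) = y ^ 5 := by simpa using hyp 5
  have y2 : (Y : ℝ) ^ ((1 : ℝ) / 2) = y ^ 2 := by
    rw [← hyp 2]; congr 1; norm_num
  have y6 : (Y : ℝ) ^ ((3 : ℝ) / 2) = y ^ 6 := by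
    rw [← hyp 6]; congr 1; norm_num
  have y4 : (Y : ℝ) = y ^ 4 := by
    rw [← hyp 4]; norm_num
  rw [y6] at h2
  rw [y5, y2]
  set u := (X : ℝ) ^ (ε / 6)
  set v := (Y : ℝ) ^ (ε / 6)
  refine le_of_sq_le_sq ?_ (by positivity)
  have huv : 1 ≤ u * v := one_le_mul_of_one_le_of_one_le hx1 hy1
  have hKK : 9 * K ≤ (9 * (K + 1)) ^ 2 := by nlinarith
  have hpoly : y ^ 4 * ((X : ℝ) * X + y ^ 6) ≤ (y ^ 5 + y ^ 2 * X) ^ 2 := by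
    have : 0 ≤ y ^ 7 * X := by positivity
    nlinarith
  calc S ^ 2 ≤ _ := h2
    _ ≤ 9 * Y * ((C * u ^ 2) ^ 4 * (K * (u ^ 2 * v) * (((X * X : ℕ) : ℝ) + y ^ 6))) * A ^ 2 := by
        gcongr
    _ = (9 * K) * C ^ 4 * (u ^ 10 * v) * (y ^ 4 * (X * X + y ^ 6)) * A ^ 2 := by
        rw [y4]; push_cast; ring
    _ ≤ (9 * (K + 1)) ^ 2 * C ^ 4 * (u ^ 12 * v ^ 12) * (y ^ 5 + y ^ 2 * X) ^ 2 * A ^ 2 := by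
        have : u ^ 10 * v ≤ u ^ 12 * v ^ 12 := by
          gcongr
          · norm_num
          · exact le_self_pow₀ hy1 (by norm_num)
        gcongr
    _ = _ := by ring

theorem exists_largeSieve_cube
    (h : ∀ ε : ℝ, 0 < ε → ∃ K : ℝ, 0 ≤ K ∧ ∀ X Y : ℕ, 1 ≤ X → 1 ≤ Y →
      LargeSieve (quarticFamily Y) charEval X
        (K * ((X : ℝ) * Y) ^ ε * (X + (Y : ℝ) ^ ((3 : ℝ) / 2))))
    {ε : ℝ} (hε : 0 < ε) :
    ∃ K : ℝ, 0 ≤ K ∧ ∀ X Y : ℕ, 1 ≤ X → 1 ≤ Y →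
      LargeSieve (quarticFamily Y) charEval X
        (K * ((X : ℝ) * Y) ^ ε * ((Y : ℝ) ^ ((7 : ℝ) / 6) + (Y : ℝ) ^ ((2 : ℝ) / 3) * X)) := by
  obtain ⟨K, hK, h⟩ := h (ε / 9) (by positivity)
  obtain ⟨C, hC1, hC⟩ := exists_card_divisors_le (ε / 9) (by positivity)
  refine ⟨81 * (K + 1) * C ^ 3, by positivity, fun X Y hX hY a => ?_⟩
  have hX1 : (1 : ℝ) ≤ X := by exact_mod_cast hX
  have hY1 : (1 : ℝ) ≤ Y := by exact_mod_cast hY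
  have hx1 : 1 ≤ (X : ℝ) ^ (ε / 9) := Real.one_le_rpow hX1 (by positivity)
  have hy1 : 1 ≤ (Y : ℝ) ^ (ε / 9) := Real.one_le_rpow hY1 (by positivity)
  have h2 := (h (X * X * X) Y (by nlinarith [Nat.mul_le_mul hX hX]) hY).cube_le
    charEval_mul norm_charEval_le
    (T := C * (((X : ℝ) ^ (ε / 9)) ^ 3)) (one_le_mul_of_one_le_of_one_le hC1 (one_le_pow₀ hx1))
    hX (by positivity) (fun n hn => by
      obtain ⟨hn1, hn2⟩ := Finset.mem_Icc.mp hn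
      refine (hC n (by lia)).trans ?_
      have : (n : ℝ) ≤ (X : ℝ) * X * X := by exact_mod_cast hn2
      rw [pow_three', ← Real.mul_rpow (by positivity) (by positivity),
        ← Real.mul_rpow (by positivity) (by positivity)]
      gcongr) a
  have hcard : ((quarticFamily Y).card : ℝ) ≤ 9 * Y := by exact_mod_cast card_quarticFamily_le hY
  set S := ∑ i ∈ quarticFamily Y, ‖∑ m ∈ squarefreeUpTo X, a m * charEval i m‖ ^ 2
  set A := ∑ m ∈ squarefreeUpTo X, ‖a m‖ ^ 2
  have hA : 0 ≤ A := Finset.sum_nonneg fun _ _ => by positivity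
  have e1 : ((X : ℝ) * Y) ^ ε = (((X : ℝ) ^ (ε / 9)) * (Y : ℝ) ^ (ε / 9)) ^ 9 := by
    rw [← Real.mul_rpow (by positivity) (by positivity), ← Real.rpow_natCast,
      ← Real.rpow_mul (by positivity)]
    congr 1; push_cast; ring
  have e2 : (((X * X * X : ℕ) : ℝ) * Y) ^ (ε / 9) =
      ((X : ℝ) ^ (ε / 9)) ^ 3 * (Y : ℝ) ^ (ε / 9) := by
    push_cast
    rw [Real.mul_rpow (by positivity) (by positivity), Real.mul_rpow (by positivity) (by positivity),
      Real.mul_rpow (by positivity) (by positivity)]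
    ring
  rw [e2] at h2
  rw [e1]
  set y := (Y : ℝ) ^ ((1 : ℝ) / 6) with hy
  have hyp : ∀ n : ℕ, (Y : ℝ) ^ ((n : ℝ) / 6) = y ^ n := by
    intro n
    rw [hy, ← Real.rpow_natCast, ← Real.rpow_mul (by positivity)]
    congr 1; ring
  have hy0 : 0 ≤ y := by positivity
  have y7 : (Y : ℝ) ^ ((7 : ℝ) / 6) = y ^ 7 := by simpa using hyp 7
  have y4 : (Y : ℝ) ^ ((2 : ℝ) / 3) = y ^ 4 := by
    rw [← hyp 4]; congr 1; norm_num
  have y9 : (Y : ℝ) ^ ((3 : ℝ) / 2) = y ^ 9 := by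
    rw [← hyp 9]; congr 1; norm_num
  have y6 : (Y : ℝ) = y ^ 6 := by
    rw [← hyp 6]; norm_num
  rw [y9] at h2
  rw [y7, y4]
  set u := (X : ℝ) ^ (ε / 9)
  set v := (Y : ℝ) ^ (ε / 9)
  refine le_of_pow_le_pow_left₀ (n := 3) (by norm_num) (by positivity) ?_
  have huv : 1 ≤ u * v := one_le_mul_of_one_le_of_one_le hx1 hy1
  have hKK : 81 * K ≤ (81 * (K + 1)) ^ 3 := by
    nlinarith [mul_nonneg hK hK, mul_nonneg hK (mul_nonneg hK hK)]
  have hpoly : y ^ 12 * ((X : ℝ) * X * X + y ^ 9) ≤ (y ^ 7 + y ^ 4 * X) ^ 3 := by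
    have h1 : 0 ≤ 3 * y ^ 18 * X := by positivity
    have h2 : 0 ≤ 3 * y ^ 15 * X ^ 2 := by positivity
    calc _ ≤ y ^ 12 * ((X : ℝ) * X * X + y ^ 9) + (3 * y ^ 18 * X + 3 * y ^ 15 * X ^ 2) := by
          linarith
      _ = _ := by ring
  calc S ^ 3 ≤ _ := h2
    _ ≤ (9 * Y) ^ 2 * ((C * u ^ 3) ^ 8 *
        (K * (u ^ 3 * v) * (((X * X * X : ℕ) : ℝ) + y ^ 9))) * A ^ 3 :=
        mul_le_mul_of_nonneg_right (mul_le_mul_of_nonneg_right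
          (pow_le_pow_left₀ (Nat.cast_nonneg _) hcard 2) (by positivity)) (pow_nonneg hA 3)
    _ = (81 * K) * C ^ 8 * (u ^ 27 * v) * (y ^ 12 * (X * X * X + y ^ 9)) * A ^ 3 := by
        rw [y6]; push_cast; ring
    _ ≤ (81 * (K + 1)) ^ 3 * C ^ 9 * (u ^ 27 * v ^ 27) * (y ^ 7 + y ^ 4 * X) ^ 3 * A ^ 3 := by
        have : u ^ 27 * v ≤ u ^ 27 * v ^ 27 := by
          gcongr
          exact le_self_pow₀ hy1 (by norm_num)
        gcongr
        · norm_num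
    _ = _ := by ring

theorem sum_inv_le_of_card_le {ι : Type*} (s : Finset ι) (f : ι → ℕ) (D N : ℕ)
    (hf : ∀ i ∈ s, 1 ≤ f i ∧ f i ≤ N)
    (hD : ∀ Y : ℕ, 1 ≤ Y → (s.filter fun i => f i ≤ Y).card ≤ D * Y) :
    ∑ i ∈ s, (1 : ℝ) / f i ≤ 2 * D * (Nat.clog 2 N + 1) := by
  have h1 : ∀ i ∈ s, (1 : ℝ) / f i ≤
      ∑ j ∈ Finset.range (Nat.clog 2 N + 1), if f i ≤ 2 ^ j then 2 / (2 : ℝ) ^ j else 0 := by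
    intro i hi
    obtain ⟨hi1, hi2⟩ := hf i hi
    have hmem : Nat.clog 2 (f i) ∈ Finset.range (Nat.clog 2 N + 1) :=
      Finset.mem_range.mpr (Nat.lt_succ_of_le (Nat.clog_mono_right 2 hi2))
    refine le_trans ?_ (Finset.single_le_sum (fun j _ => by split_ifs <;> positivity) hmem)
    rw [if_pos (Nat.le_pow_clog one_lt_two _)]
    have h2 : (2 : ℝ) ^ Nat.clog 2 (f i) ≤ 2 * f i := by
      rcases hi1.eq_or_lt with h | h
      · rw [← h]; simp
      · have h1 := Nat.pow_pred_clog_lt_self one_lt_two h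
        have h2 := Nat.clog_pos one_lt_two h
        have h3 : 2 ^ Nat.clog 2 (f i) = 2 * 2 ^ (Nat.clog 2 (f i)).pred := by
          rw [← pow_succ']
          exact congrArg _ (Nat.succ_pred_eq_of_pos h2).symm
        have h4 : 2 ^ Nat.clog 2 (f i) ≤ 2 * f i := by rw [h3]; gcongr
        exact_mod_cast h4
    have h3 : (0 : ℝ) < f i := by exact_mod_cast hi1
    rw [div_le_div_iff₀ h3 (by positivity), one_mul]
    exact h2
  refine (Finset.sum_le_sum h1).trans ?_
  rw [Finset.sum_comm]
  have h2 : ∀ j ∈ Finset.range (Nat.clog 2 N + 1),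
      ∑ i ∈ s, (if f i ≤ 2 ^ j then 2 / (2 : ℝ) ^ j else 0) ≤ 2 * D := by
    intro j _
    rw [← Finset.sum_filter, Finset.sum_const, nsmul_eq_mul]
    have h3 : ((s.filter fun i => f i ≤ 2 ^ j).card : ℝ) ≤ D * 2 ^ j := by
      exact_mod_cast hD (2 ^ j) Nat.one_le_two_pow
    calc _ ≤ (D * 2 ^ j) * (2 / (2 : ℝ) ^ j) := by gcongr
      _ = 2 * D := by field_simp
  refine (Finset.sum_le_card_nsmul _ _ _ h2).trans (le_of_eq ?_)
  rw [Finset.card_range, nsmul_eq_mul]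
  push_cast; ring

/-- `psi m x` for odd `m`, and zero for even `m`. -/
def oddPsi (x : GaussianInt) (m : ℕ) : ℂ := if Odd m then psi m x else 0

theorem norm_oddPsi_le (x : GaussianInt) (m : ℕ) : ‖oddPsi x m‖ ≤ 1 := by
  unfold oddPsi
  split_ifs
  · exact norm_psi_le m x
  · simp

theorem oddPsi_mul (x y : GaussianInt) (m : ℕ) : oddPsi (x * y) m = oddPsi x m * oddPsi y m := by
  unfold oddPsi
  split_ifs with h
  · exact psi_mul h x y
  · simp

theorem sum_twist_le {s : Finset (Σ q : ℕ, DirichletCharacter ℂ q)} {X : ℕ} {B : ℝ} (hB : 0 ≤ B)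
    (hs : ∀ i ∈ s, 1 ≤ i.1 ∧ IsPrimitiveQuartic i.2) (h : LargeSieve s charEval X B)
    (c : GaussianInt) (b : ℕ → ℂ) :
    ∑ i ∈ s, ‖∑ m ∈ squarefreeUpTo X, b m * oddPsi (c * jacobiGauss i.2) m‖ ^ 2 ≤
      2 * B * ∑ m ∈ squarefreeUpTo X, ‖b m‖ ^ 2 := by
  set b1 : ℕ → ℂ := fun m => if m % 4 = 1 then b m * oddPsi c m else 0 with hb1
  set b3 : ℕ → ℂ := fun m => if m % 4 = 3 then b m * oddPsi c m else 0 with hb3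
  have hpt : ∀ i ∈ s, ‖∑ m ∈ squarefreeUpTo X, b m * oddPsi (c * jacobiGauss i.2) m‖ ^ 2 ≤
      2 * ‖∑ m ∈ squarefreeUpTo X, b1 m * charEval i m‖ ^ 2 +
        2 * ‖∑ m ∈ squarefreeUpTo X, b3 m * charEval i m‖ ^ 2 := by
    intro i hi
    obtain ⟨hi1, hi2⟩ := hs i hi
    have : NeZero i.1 := ⟨Nat.one_le_iff_ne_zero.mp hi1⟩
    have e : ∑ m ∈ squarefreeUpTo X, b m * oddPsi (c * jacobiGauss i.2) m =
        ∑ m ∈ squarefreeUpTo X, b1 m * charEval i m +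
          i.2 (-1) * ∑ m ∈ squarefreeUpTo X, b3 m * charEval i m := by
      rw [Finset.mul_sum, ← Finset.sum_add_distrib]
      refine Finset.sum_congr rfl fun m hm => ?_
      rw [oddPsi_mul]
      by_cases ho : Odd m
      · have hp := hi2.psi_jacobiGauss ho (mem_squarefreeUpTo.mp hm).2
        have e2 : oddPsi (jacobiGauss i.2) m = i.2 (m : ZMod i.1) *
            if m % 4 = 1 then 1 else i.2 (-1) := by
          rw [oddPsi, if_pos ho, hp]
        have h4 : m % 4 = 1 ∨ m % 4 = 3 := by rcases ho with ⟨k, rfl⟩; lia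
        simp only [e2, hb1, hb3, charEval]
        rcases h4 with h4 | h4
        · simp [h4]; ring
        · simp [h4]; ring
      · have h1 : ¬ m % 4 = 1 := fun h => ho (Nat.odd_iff.mpr (by lia))
        have h3 : ¬ m % 4 = 3 := fun h => ho (Nat.odd_iff.mpr (by lia))
        simp [hb1, hb3, h1, h3, oddPsi, ho]
    rw [e]
    set x := ∑ m ∈ squarefreeUpTo X, b1 m * charEval i m
    set y := ∑ m ∈ squarefreeUpTo X, b3 m * charEval i m
    have h1 : ‖i.2 (-1) * y‖ ≤ ‖y‖ := by
      rw [norm_mul]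
      exact mul_le_of_le_one_left (norm_nonneg _) (DirichletCharacter.norm_le_one _ _)
    calc _ ≤ (‖x‖ + ‖y‖) ^ 2 := by
          gcongr; exact (norm_add_le _ _).trans (by gcongr)
      _ ≤ _ := by nlinarith [sq_nonneg (‖x‖ - ‖y‖)]
  refine (Finset.sum_le_sum hpt).trans ?_
  rw [Finset.sum_add_distrib, ← Finset.mul_sum, ← Finset.mul_sum]
  have hb : ∑ m ∈ squarefreeUpTo X, ‖b1 m‖ ^ 2 + ∑ m ∈ squarefreeUpTo X, ‖b3 m‖ ^ 2 ≤
      ∑ m ∈ squarefreeUpTo X, ‖b m‖ ^ 2 := by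
    rw [← Finset.sum_add_distrib]
    refine Finset.sum_le_sum fun m _ => ?_
    have h1 : ‖b m * oddPsi c m‖ ≤ ‖b m‖ := by
      rw [norm_mul]
      exact mul_le_of_le_one_right (norm_nonneg _) (norm_oddPsi_le _ _)
    simp only [hb1, hb3]
    by_cases m1 : m % 4 = 1
    · have m3 : ¬ m % 4 = 3 := by lia
      simp only [if_pos m1, if_neg m3]
      simpa using pow_le_pow_left₀ (norm_nonneg _) h1 2
    · simp only [if_neg m1]
      split_ifs
      · simpa using pow_le_pow_left₀ (norm_nonneg _) h1 2
      · simp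
  have h1 := h b1
  have h3 := h b3
  nlinarith

theorem card_filter_le_of_gaussBall {N Y : ℕ} (hY : 1 ≤ Y) :
    (((gaussBall N).erase 0).filter fun w => w.norm.natAbs ≤ Y).card ≤ 9 * Y := by
  refine (Finset.card_le_card fun w hw => ?_).trans (card_gaussBall_le hY)
  rw [mem_gaussBall]
  have := (Finset.mem_filter.mp hw).2
  have h0 := GaussianInt.norm_nonneg w
  lia

theorem gauss_norm_one_add_I_pow (e : ℕ) : ((⟨1, 1⟩ : GaussianInt) ^ e).norm = 2 ^ e := by
  induction e with
  | zero => simp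
  | succ e ih => rw [pow_succ, Zsqrtd.norm_mul, ih, pow_succ]; rfl

theorem rpow_mul_le_of_mul_sq_le {Y s N r : ℝ} (hY : 0 ≤ Y) (hs : 1 ≤ s) (h : Y * s ^ 2 ≤ N)
    (hr : 1 / 2 ≤ r) : Y ^ r * s ≤ N ^ r := by
  have h1 : s ≤ (s ^ 2) ^ r := by
    rw [← Real.rpow_natCast, ← Real.rpow_mul (by linarith)]
    refine le_trans (le_of_eq (Real.rpow_one s).symm) (Real.rpow_le_rpow_of_exponent_le hs ?_)
    push_cast; linarith
  calc Y ^ r * s ≤ Y ^ r * (s ^ 2) ^ r := by gcongr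
    _ = (Y * s ^ 2) ^ r := (Real.mul_rpow hY (by positivity)).symm
    _ ≤ N ^ r := Real.rpow_le_rpow (by positivity) h (by linarith)

theorem exists_largeSieve_lattice
    (h : ∀ ε : ℝ, 0 < ε → ∃ K : ℝ, 0 ≤ K ∧ ∀ X Y : ℕ, 1 ≤ X → 1 ≤ Y →
      LargeSieve (quarticFamily Y) charEval X
        (K * ((X : ℝ) * Y) ^ ε * ((Y : ℝ) ^ ((7 : ℝ) / 6) + (Y : ℝ) ^ ((2 : ℝ) / 3) * X)))
    {ε : ℝ} (hε : 0 < ε) :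
    ∃ K : ℝ, 0 ≤ K ∧ ∀ X N : ℕ, 1 ≤ X → 1 ≤ N →
      LargeSieve ((gaussBall N).erase 0) oddPsi X
        (K * ((X : ℝ) * N) ^ ε * ((N : ℝ) ^ ((7 : ℝ) / 6) + (N : ℝ) ^ ((2 : ℝ) / 3) * X)) := by
  obtain ⟨K, hK, h⟩ := h (ε / 4) (by positivity)
  obtain ⟨C, hC1, hC⟩ := exists_log_le (ε / 4) (by positivity)
  refine ⟨2 * K * (144 * (C * 2 ^ (ε / 4) + 1) ^ 3), by positivity, fun X N hX hN b => ?_⟩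
  have hX1 : (1 : ℝ) ≤ X := by exact_mod_cast hX
  have hN1 : (1 : ℝ) ≤ N := by exact_mod_cast hN
  set L := Nat.clog 2 N + 1 with hL_def
  set P := gaussUnits ×ˢ (Finset.range L ×ˢ (Finset.Icc 1 N ×ˢ (gaussBall N).erase 0)) with hP
  set A := ∑ m ∈ squarefreeUpTo X, ‖b m‖ ^ 2
  have hA : 0 ≤ A := Finset.sum_nonneg fun _ _ => by positivity
  set c : GaussianInt × ℕ × ℕ × GaussianInt → GaussianInt :=
    fun p => p.1 * (⟨1, 1⟩ : GaussianInt) ^ p.2.1 * p.2.2.1 * p.2.2.2 ^ 2 with hc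
  set d : GaussianInt × ℕ × ℕ × GaussianInt → ℕ :=
    fun p => 2 ^ p.2.1 * p.2.2.1 ^ 2 * p.2.2.2.norm.natAbs ^ 2 with hd
  have hcover : ∀ k ∈ (gaussBall N).erase 0, ∃ p ∈ P, 1 ≤ N / d p ∧
      ∃ i ∈ quarticFamily (N / d p), k = c p * jacobiGauss i.2 := by
    intro k hk
    obtain ⟨hk0, hkN⟩ := Finset.mem_erase.mp hk
    rw [mem_gaussBall] at hkN
    obtain ⟨u, hu, e, t, w, i, ht, hw, hi1, hi2, hki⟩ := exists_decomposition hk0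
    have : NeZero i.1 := ⟨Nat.one_le_iff_ne_zero.mp hi1⟩
    have hk' : d (u, e, t, w) * i.1 ≤ N := by
      have h1 : u.norm = 1 := by
        have h := mul_star_of_mem_gaussUnits hu
        rw [← Zsqrtd.norm_eq_mul_conj] at h
        exact_mod_cast h
      have h2 := gauss_norm_one_add_I_pow e
      have h3 : k.norm.natAbs = d (u, e, t, w) * i.1 := by
        rw [hki]
        simp only [hd, Zsqrtd.norm_mul, h1, h2, Int.natAbs_mul, sq, Zsqrtd.norm_natCast,
          hi2.norm_jacobiGauss]
        simp [Int.natAbs_pow]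
      have h4 := GaussianInt.norm_nonneg k
      lia
    have hw1 : 1 ≤ w.norm.natAbs := by
      have := gauss_norm_pos hw
      lia
    have hd1 : 1 ≤ d (u, e, t, w) := by simp only [hd]; exact Nat.pos_of_ne_zero (by positivity)
    have hdN : d (u, e, t, w) ≤ N := le_trans (Nat.le_mul_of_pos_right _ hi1) hk'
    have e1 : 2 ^ e ≤ N := by
      refine le_trans ?_ hdN
      simp only [hd, mul_assoc]
      exact Nat.le_mul_of_pos_right _ (by positivity)
    have e2 : t ≤ N := by
      refine le_trans ?_ hdN
      simp only [hd]
      calc t ≤ t ^ 2 := Nat.le_self_pow two_ne_zero t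
        _ ≤ 2 ^ e * t ^ 2 := Nat.le_mul_of_pos_left _ (by positivity)
        _ ≤ _ := Nat.le_mul_of_pos_right _ (by positivity)
    have e3 : w.norm.natAbs ≤ N := by
      refine le_trans ?_ hdN
      simp only [hd]
      calc w.norm.natAbs ≤ w.norm.natAbs ^ 2 := Nat.le_self_pow two_ne_zero _
        _ ≤ _ := Nat.le_mul_of_pos_left _ (by positivity)
    refine ⟨(u, e, t, w), ?_, (Nat.one_le_div_iff hd1).mpr hdN, i, ?_, hki⟩
    · simp only [hP, Finset.mem_product, Finset.mem_range, Finset.mem_Icc, Finset.mem_erase,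
        mem_gaussBall]
      refine ⟨hu, ?_, ⟨ht, e2⟩, hw, ?_⟩
      · have := (Nat.pow_le_pow_iff_right one_lt_two).mp (e1.trans (Nat.le_pow_clog one_lt_two N))
        lia
      · have := GaussianInt.norm_nonneg w
        lia
    · exact mem_quarticFamily.mpr ⟨hi1, (Nat.le_div_iff_mul_le hd1).mpr (by rwa [mul_comm]), hi2⟩
  set F : Finset (Σ _ : GaussianInt × ℕ × ℕ × GaussianInt, Σ q : ℕ, DirichletCharacter ℂ q) :=
    (P.filter fun p => 1 ≤ N / d p).sigma fun p => quarticFamily (N / d p) with hF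
  have hsub : (gaussBall N).erase 0 ⊆ F.image fun x => c x.1 * jacobiGauss x.2.2 := by
    intro k hk
    obtain ⟨p, hp, hp1, i, hi, hki⟩ := hcover k hk
    exact Finset.mem_image.mpr ⟨⟨p, i⟩, Finset.mem_sigma.mpr
      ⟨Finset.mem_filter.mpr ⟨hp, hp1⟩, hi⟩, hki.symm⟩
  set G : GaussianInt → ℝ := fun k => ‖∑ m ∈ squarefreeUpTo X, b m * oddPsi k m‖ ^ 2 with hG
  set W : ℝ := (N : ℝ) ^ ((7 : ℝ) / 6) + (N : ℝ) ^ ((2 : ℝ) / 3) * X with hW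
  set E : ℝ := ((X : ℝ) * N) ^ (ε / 4) with hE
  have hterm : ∀ p ∈ P.filter fun p => 1 ≤ N / d p,
      ∑ i ∈ quarticFamily (N / d p), G (c p * jacobiGauss i.2) ≤
        2 * K * E * W * A * ((1 : ℝ) / p.2.2.1 * (1 / p.2.2.2.norm.natAbs)) := by
    rintro ⟨u, e, t, w⟩ hp
    obtain ⟨hpP, hp1⟩ := Finset.mem_filter.mp hp
    simp only [hP, Finset.mem_product, Finset.mem_range, Finset.mem_Icc, Finset.mem_erase,
      mem_gaussBall] at hpP
    obtain ⟨hu, he, ⟨ht, htN⟩, hw, hwN⟩ := hpP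
    have hn1 : 1 ≤ w.norm.natAbs := by
      have := gauss_norm_pos hw
      lia
    dsimp only
    set n := w.norm.natAbs
    set Y := N / d (u, e, t, w) with hY
    have hs1 : (1 : ℝ) ≤ t * n :=
      one_le_mul_of_one_le_of_one_le (by exact_mod_cast ht) (by exact_mod_cast hn1)
    have hYN : (Y : ℝ) * (t * n) ^ 2 ≤ N := by
      have h1 : Y * d (u, e, t, w) ≤ N := Nat.div_mul_le_self _ _
      have h2 : (t * n) ^ 2 ≤ d (u, e, t, w) := by
        simp only [hd, mul_pow]
        rw [mul_assoc]
        exact Nat.le_mul_of_pos_left _ (by positivity)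
      exact_mod_cast (Nat.mul_le_mul_left Y h2).trans h1
    have hYN' : (Y : ℝ) ≤ N := by exact_mod_cast Nat.div_le_self _ _
    have h7 := rpow_mul_le_of_mul_sq_le (r := 7 / 6) (Nat.cast_nonneg Y) hs1 hYN (by norm_num)
    have h2 := rpow_mul_le_of_mul_sq_le (r := 2 / 3) (Nat.cast_nonneg Y) hs1 hYN (by norm_num)
    refine (sum_twist_le (by positivity) (fun i hi => ?_) (h X Y hX hp1) _ b).trans ?_
    · have := mem_quarticFamily.mp hi
      exact ⟨this.1, this.2.2⟩
    · have h3 : ((X : ℝ) * Y) ^ (ε / 4) ≤ E := by rw [hE]; gcongr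
      have h4 : ((Y : ℝ) ^ ((7 : ℝ) / 6) + (Y : ℝ) ^ ((2 : ℝ) / 3) * X) ≤
          W * ((1 : ℝ) / t * (1 / n)) := by
        rw [one_div_mul_one_div, mul_one_div, le_div_iff₀ (by linarith), hW]
        nlinarith
      calc _ ≤ 2 * (K * E * (W * ((1 : ℝ) / t * (1 / n)))) * A := by gcongr
        _ = _ := by ring
  have hL : (L : ℝ) ≤ (C * 2 ^ (ε / 4) + 1) * E := by
    have h1 := hC (Nat.clog 2 N)
    have h2 : 2 ^ Nat.clog 2 N ≤ 2 * N := by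
      rcases hN.eq_or_lt with h | h
      · rw [← h]; simp
      · have h1 := Nat.pow_pred_clog_lt_self one_lt_two h
        have h2 := Nat.clog_pos one_lt_two h
        have h3 : 2 ^ Nat.clog 2 N = 2 * 2 ^ (Nat.clog 2 N).pred := by
          rw [← pow_succ']
          exact congrArg _ (Nat.succ_pred_eq_of_pos h2).symm
        rw [h3]; gcongr
    have h3 : ((2 ^ Nat.clog 2 N : ℕ) : ℝ) ^ (ε / 4) ≤ 2 ^ (ε / 4) * E := by
      rw [hE, ← Real.mul_rpow (by norm_num) (by positivity)]
      refine Real.rpow_le_rpow (by positivity) ?_ (by positivity)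
      have : ((2 ^ Nat.clog 2 N : ℕ) : ℝ) ≤ 2 * N := by exact_mod_cast h2
      nlinarith
    have h4 : 1 ≤ E := Real.one_le_rpow (by nlinarith) (by positivity)
    rw [hL_def]
    push_cast at h1 h3 ⊢
    calc _ ≤ C * (2 ^ (ε / 4) * E) + E := by
          gcongr
          exact h1.trans (by gcongr)
      _ = _ := by ring
  have hsum : ∑ p ∈ P, ((1 : ℝ) / p.2.2.1 * (1 / p.2.2.2.norm.natAbs)) ≤ 144 * (L : ℝ) ^ 3 := by
    have ht : ∑ t ∈ Finset.Icc 1 N, (1 : ℝ) / t ≤ 2 * L := by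
      have := sum_inv_le_of_card_le (Finset.Icc 1 N) (fun t => t) 1 N
        (fun i hi => Finset.mem_Icc.mp hi) (fun Y _ => by
          refine (Finset.card_le_card (t := Finset.Icc 1 Y) fun i hi => ?_).trans (by simp)
          simp only [Finset.mem_filter, Finset.mem_Icc] at hi ⊢
          exact ⟨hi.1.1, hi.2⟩)
      simpa [hL_def] using this
    have hw : ∑ w ∈ (gaussBall N).erase 0, (1 : ℝ) / w.norm.natAbs ≤ 18 * L := by
      have := sum_inv_le_of_card_le ((gaussBall N).erase 0) (fun w => w.norm.natAbs) 9 N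
        (fun w hw => by
          obtain ⟨h1, h2⟩ := Finset.mem_erase.mp hw
          have h3 := gauss_norm_pos h1
          rw [mem_gaussBall] at h2
          lia) (fun Y hY => card_filter_le_of_gaussBall hY)
      refine this.trans (le_of_eq ?_)
      rw [hL_def]; push_cast; ring
    have hu : gaussUnits.card ≤ 4 := by
      unfold gaussUnits
      exact Finset.card_le_four
    rw [hP, Finset.sum_product]
    simp only [Finset.sum_product, ← Finset.mul_sum, Finset.sum_const, Finset.card_range,
      nsmul_eq_mul]
    rw [← Finset.sum_mul]
    have hu' : (gaussUnits.card : ℝ) ≤ 4 := by exact_mod_cast hu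
    calc _ ≤ (L : ℝ) * (4 * ((2 * L) * (18 * L))) := by gcongr
      _ = _ := by ring
  have hE0 : 0 ≤ E := by positivity
  have hE4 : ((X : ℝ) * N) ^ ε = E ^ 4 := by
    rw [hE, ← Real.rpow_natCast, ← Real.rpow_mul (by positivity)]
    congr 1; push_cast; ring
  calc ∑ k ∈ (gaussBall N).erase 0, G k
      ≤ ∑ k ∈ F.image fun x => c x.1 * jacobiGauss x.2.2, G k :=
        Finset.sum_le_sum_of_subset_of_nonneg hsub fun _ _ _ => by positivity
    _ ≤ ∑ x ∈ F, G (c x.1 * jacobiGauss x.2.2) :=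
        Finset.sum_image_le_of_nonneg fun _ _ => by positivity
    _ = ∑ p ∈ P.filter fun p => 1 ≤ N / d p,
          ∑ i ∈ quarticFamily (N / d p), G (c p * jacobiGauss i.2) := by
        rw [hF, Finset.sum_sigma]
    _ ≤ ∑ p ∈ P.filter fun p => 1 ≤ N / d p,
          2 * K * E * W * A * ((1 : ℝ) / p.2.2.1 * (1 / p.2.2.2.norm.natAbs)) :=
        Finset.sum_le_sum hterm
    _ ≤ ∑ p ∈ P, 2 * K * E * W * A * ((1 : ℝ) / p.2.2.1 * (1 / p.2.2.2.norm.natAbs)) :=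
        Finset.sum_le_sum_of_subset_of_nonneg (Finset.filter_subset _ _)
          fun _ _ _ => by positivity
    _ ≤ 2 * K * E * W * A * (144 * (L : ℝ) ^ 3) := by
        rw [← Finset.mul_sum]
        gcongr
    _ ≤ 2 * K * E * W * A * (144 * ((C * 2 ^ (ε / 4) + 1) * E) ^ 3) := by gcongr
    _ = _ := by rw [hE4]; ring

theorem hasSum_of_forall_eq {ι : Type*} {f g : ι → ℂ} {T : ℂ} (h : HasSum g T)
    (hfg : ∀ i, f i = g i) : HasSum f T := by
  rwa [funext hfg]

theorem hasSum_sum_mul_mul {s : Finset ℕ} {u : ℕ → ℤ → ℂ} {T : ℕ → ℂ}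
    (h : ∀ a ∈ s, HasSum (u a) (T a)) (c : ℕ → ℕ → ℂ) :
    HasSum (fun p : ℤ × ℤ => ∑ a ∈ s, ∑ b ∈ s, c a b * (u a p.1 * u b p.2))
      (∑ a ∈ s, ∑ b ∈ s, c a b * (T a * T b)) := by
  refine hasSum_sum fun a ha => hasSum_sum fun b hb => ?_
  have h1 := summable_mul_of_summable_norm (h a ha).summable.norm (h b hb).summable.norm
  exact ((h a ha).mul (h b hb) h1).mul_left (c a b)

theorem hasSum_poisson_residue {Q : ℝ} (hQ : 0 < Q) {R : ℕ} (hR : 1 ≤ R) {a : ℕ} (ha : a < R) :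
    ∃ T : ℂ,
      HasSum (fun n : ℤ => if n % (R : ℤ) = a then ((Real.exp (-Real.pi * n ^ 2 / Q) : ℝ) : ℂ)
        else 0) T ∧
      HasSum (fun k : ℤ => ((√Q / R : ℝ) : ℂ) * (Complex.exp (2 * Real.pi * I * ((k * a : ℤ) / R)) *
        ((Real.exp (-Real.pi * Q * k ^ 2 / R ^ 2) : ℝ) : ℂ))) T := by
  have hR0 : (0 : ℝ) < R := by exact_mod_cast hR
  have hRc : (R : ℂ) ≠ 0 := by exact_mod_cast hR0.ne'
  have hQc : (Q : ℂ) ≠ 0 := by exact_mod_cast hQ.ne'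
  set τ : ℂ := I * ((Q / R ^ 2 : ℝ) : ℂ) with hτ
  set z : ℂ := (a : ℂ) / R with hz
  have hτ0 : τ ≠ 0 := by
    rw [hτ]
    exact mul_ne_zero I_ne_zero (by exact_mod_cast (by positivity : Q / (R : ℝ) ^ 2 ≠ 0))
  have him : 0 < τ.im := by
    rw [hτ, I_mul_im, ofReal_re]; positivity
  have him' : 0 < (-1 / τ).im := by
    have : -1 / τ = I * ((R ^ 2 / Q : ℝ) : ℂ) := by
      rw [div_eq_iff hτ0, hτ]
      push_cast
      field_simp
      rw [I_sq]
    rw [this, I_mul_im, ofReal_re]; positivity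
  have hsq : (-I * τ) ^ (1 / 2 : ℂ) = ((√Q / R : ℝ) : ℂ) := by
    have h1 : -I * τ = ((Q / R ^ 2 : ℝ) : ℂ) := by
      rw [hτ, ← mul_assoc, neg_mul, I_mul_I, neg_neg, one_mul]
    have h2 : (1 / 2 : ℂ) = ((1 / 2 : ℝ) : ℂ) := by push_cast; rfl
    rw [h1, h2, ← Complex.ofReal_cpow (by positivity), ← Real.sqrt_eq_rpow,
      Real.sqrt_div hQ.le, Real.sqrt_sq hR0.le]
  have hs0 : ((√Q / R : ℝ) : ℂ) ≠ 0 := by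
    exact_mod_cast (div_pos (Real.sqrt_pos.mpr hQ) hR0).ne'
  have key := jacobiTheta₂_functional_equation z τ
  rw [hsq] at key
  refine ⟨((√Q / R : ℝ) : ℂ) * jacobiTheta₂ z τ, ?_, ?_⟩
  · have h := (hasSum_jacobiTheta₂_term (z / τ) him').mul_left (cexp (-Real.pi * I * z ^ 2 / τ))
    have e : ((√Q / R : ℝ) : ℂ) * jacobiTheta₂ z τ =
        cexp (-Real.pi * I * z ^ 2 / τ) * jacobiTheta₂ (z / τ) (-1 / τ) := by
      rw [key]; field_simp
    rw [e]
    have hinj : Function.Injective fun j : ℤ => (a : ℤ) - R * j := by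
      intro i j hij
      have : (R : ℤ) * i = R * j := by simpa using hij
      exact mul_left_cancel₀ (by exact_mod_cast hR0.ne') this
    rw [← hinj.hasSum_iff]
    · refine hasSum_of_forall_eq h fun j => ?_
      have hc : ((a : ℤ) - R * j) % (R : ℤ) = a := by
        rw [Int.sub_mul_emod_self_left]
        exact Int.emod_eq_of_lt (by positivity) (by exact_mod_cast ha)
      simp only [Function.comp, if_pos hc, jacobiTheta₂_term]
      rw [ofReal_exp, ← Complex.exp_add]
      congr 1
      rw [hz, hτ]
      push_cast
      field_simp
      ring_nf
    · intro n hn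
      rw [if_neg]
      intro hc
      refine hn ⟨-(n / R), ?_⟩
      have := Int.emod_add_mul_ediv n R
      simp only
      rw [← hc]
      linarith
  · have h := (hasSum_jacobiTheta₂_term z him).mul_left ((√Q / R : ℝ) : ℂ)
    refine hasSum_of_forall_eq h fun k => ?_
    rw [jacobiTheta₂_term, ofReal_exp, ← Complex.exp_add]
    congr 2
    rw [hz, hτ]
    push_cast
    field_simp
    ring_nf
    simp only [I_sq]
    ring

theorem hasSum_poisson {Q : ℝ} (hQ : 0 < Q) {R : ℕ} (hR : 1 ≤ R) {f : GaussianInt → ℂ}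
    (hf : ∀ x y : GaussianInt, ((R : ℤ) : GaussianInt) ∣ x - y → f x = f y) :
    ∃ T : ℂ,
      HasSum (fun x : GaussianInt => f x * ((Real.exp (-Real.pi * x.norm / Q) : ℝ) : ℂ)) T ∧
      HasSum (fun k : GaussianInt => ((Q / R ^ 2 : ℝ) : ℂ) * (gaussFT R f k *
        ((Real.exp (-Real.pi * Q * k.norm / R ^ 2) : ℝ) : ℂ))) T := by
  have hR0 : (0 : ℤ) < R := by exact_mod_cast hR
  choose! T hT1 hT2 using fun (a : ℕ) (ha : a ∈ Finset.range R) =>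
    hasSum_poisson_residue hQ hR (Finset.mem_range.mp ha)
  let e : ℤ × ℤ ≃ GaussianInt :=
    ⟨fun p => ⟨p.1, p.2⟩, fun x => (x.re, x.im), fun _ => rfl, fun _ => rfl⟩
  refine ⟨∑ a ∈ Finset.range R, ∑ b ∈ Finset.range R, f ⟨a, b⟩ * (T a * T b), ?_, ?_⟩
  · rw [← e.hasSum_iff]
    have h := hasSum_sum_mul_mul hT1 fun a b => f ⟨a, b⟩
    refine hasSum_of_forall_eq h fun p => ?_
    obtain ⟨m, n⟩ := p
    have hm : ((m % (R : ℤ)).toNat : ℤ) = m % R := Int.toNat_of_nonneg (Int.emod_nonneg _ hR0.ne')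
    have hn : ((n % (R : ℤ)).toNat : ℤ) = n % R := Int.toNat_of_nonneg (Int.emod_nonneg _ hR0.ne')
    have hm' : (m % (R : ℤ)).toNat ∈ Finset.range R := by
      rw [Finset.mem_range]; have := Int.emod_lt_of_pos m hR0; lia
    have hn' : (n % (R : ℤ)).toNat ∈ Finset.range R := by
      rw [Finset.mem_range]; have := Int.emod_lt_of_pos n hR0; lia
    rw [Finset.sum_eq_single_of_mem _ hm', Finset.sum_eq_single_of_mem _ hn']
    · simp only [Function.comp, e, Equiv.coe_fn_mk]
      rw [if_pos hm.symm, if_pos hn.symm, hm, hn, ← ofReal_mul, ← Real.exp_add]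
      congr 1
      · refine hf _ _ ?_
        rw [Zsqrtd.intCast_dvd]
        exact ⟨Int.dvd_self_sub_emod, Int.dvd_self_sub_emod⟩
      · congr 2
        rw [Zsqrtd.norm_def]
        push_cast
        ring
    · intro b _ hb
      rw [if_neg (c := n % (R : ℤ) = b), mul_zero, mul_zero]
      intro h
      exact hb (by lia)
    · intro a _ ha
      refine Finset.sum_eq_zero fun b _ => ?_
      rw [if_neg (c := m % (R : ℤ) = a), zero_mul, mul_zero]
      intro h
      exact ha (by lia)
  · rw [← e.hasSum_iff]
    have h := hasSum_sum_mul_mul hT2 fun a b => f ⟨a, b⟩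
    refine hasSum_of_forall_eq h fun p => ?_
    obtain ⟨m, n⟩ := p
    simp only [Function.comp, e, Equiv.coe_fn_mk, gaussFT]
    rw [Finset.sum_mul, Finset.mul_sum]
    refine Finset.sum_congr rfl fun a _ => ?_
    rw [Finset.sum_mul, Finset.mul_sum]
    refine Finset.sum_congr rfl fun b _ => ?_
    have e1 : ((Q / R ^ 2 : ℝ) : ℂ) = ((√Q / R : ℝ) : ℂ) * ((√Q / R : ℝ) : ℂ) := by
      rw [← ofReal_mul]
      congr 1
      rw [div_mul_div_comm, Real.mul_self_sqrt hQ.le, sq]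
    have e2 : Real.exp (-Real.pi * Q * (⟨m, n⟩ : GaussianInt).norm / R ^ 2) =
        Real.exp (-Real.pi * Q * m ^ 2 / R ^ 2) * Real.exp (-Real.pi * Q * n ^ 2 / R ^ 2) := by
      rw [← Real.exp_add]
      congr 1
      rw [Zsqrtd.norm_def]
      push_cast
      ring
    have e3 : Complex.exp (2 * Real.pi * I * ((m * a + n * b : ℤ) / R)) =
        Complex.exp (2 * Real.pi * I * ((m * a : ℤ) / R)) *
          Complex.exp (2 * Real.pi * I * ((n * b : ℤ) / R)) := by
      rw [← Complex.exp_add]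
      congr 1
      push_cast
      ring
    rw [e1, e2, e3, ofReal_mul]
    ring

theorem sum_weight_mul_bilinear_le {ι κ : Type*} {P : Finset ι} {s : Finset κ} {Ψ : κ → ι → ℂ}
    {w : κ → ℝ} (hw : ∀ k ∈ s, 0 ≤ w k) {α : ι → ℂ} {C η : ℝ} (hη : 0 ≤ η)
    (hC : ∀ (c : ℝ) (β : ι → ℂ), 0 ≤ c → (∀ p ∈ P, ‖β p‖ ≤ c * ‖α p‖) →
      ∑ k ∈ s, w k * ‖∑ p ∈ P, β p * Ψ k p‖ ^ 2 ≤ c ^ 2 * C) (hC0 : 0 ≤ C)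
    {v : ι → ℝ} (hv : ∀ p ∈ P, 0 ≤ v p ∧ v p ≤ η) (n : ℕ) :
    ∀ (c d : ℝ) (β γ : ι → ℂ), 0 ≤ c → 0 ≤ d → (∀ p ∈ P, ‖β p‖ ≤ c * ‖α p‖) →
      (∀ p ∈ P, ‖γ p‖ ≤ d * ‖α p‖) →
      ∑ k ∈ s, w k * ‖∑ p ∈ P, ∑ q ∈ P, β p * Ψ k p * conj (γ q * Ψ k q) *
        ((v p + v q - v p * v q : ℝ) : ℂ) ^ n‖ ≤ (2 * η + η ^ 2) ^ n * (c * d * C) := by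
  induction n with
  | zero =>
    intro c d β γ hc hd hβ hγ
    have e : ∀ k, ∑ p ∈ P, ∑ q ∈ P, β p * Ψ k p * conj (γ q * Ψ k q) =
        (∑ p ∈ P, β p * Ψ k p) * conj (∑ q ∈ P, γ q * Ψ k q) := by
      intro k
      rw [map_sum, Finset.sum_mul_sum]
    simp only [pow_zero, mul_one, one_mul, e, norm_mul, RCLike.norm_conj]
    have h1 := Real.sum_mul_le_sqrt_mul_sqrt s
      (fun k => √(w k) * ‖∑ p ∈ P, β p * Ψ k p‖) (fun k => √(w k) * ‖∑ q ∈ P, γ q * Ψ k q‖)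
    have e1 : ∑ k ∈ s, √(w k) * ‖∑ p ∈ P, β p * Ψ k p‖ * (√(w k) * ‖∑ q ∈ P, γ q * Ψ k q‖) =
        ∑ k ∈ s, w k * (‖∑ p ∈ P, β p * Ψ k p‖ * ‖∑ q ∈ P, γ q * Ψ k q‖) := by
      refine Finset.sum_congr rfl fun k hk => ?_
      rw [mul_mul_mul_comm, Real.mul_self_sqrt (hw k hk)]
    have e2 : ∀ β : ι → ℂ, ∑ k ∈ s, (√(w k) * ‖∑ p ∈ P, β p * Ψ k p‖) ^ 2 =
        ∑ k ∈ s, w k * ‖∑ p ∈ P, β p * Ψ k p‖ ^ 2 := by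
      intro β
      refine Finset.sum_congr rfl fun k hk => ?_
      rw [mul_pow, Real.sq_sqrt (hw k hk)]
    rw [e1, e2, e2] at h1
    have h2 : ∀ (c : ℝ) (β : ι → ℂ), 0 ≤ c → (∀ p ∈ P, ‖β p‖ ≤ c * ‖α p‖) →
        √(∑ k ∈ s, w k * ‖∑ p ∈ P, β p * Ψ k p‖ ^ 2) ≤ c * √C := by
      intro c β hc hβ
      rw [← Real.sqrt_sq hc, ← Real.sqrt_mul (sq_nonneg c)]
      exact Real.sqrt_le_sqrt (hC c β hc hβ)
    calc _ ≤ _ := h1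
      _ ≤ (c * √C) * (d * √C) := by
          gcongr
          · exact h2 c β hc hβ
          · exact h2 d γ hd hγ
      _ = _ := by rw [mul_mul_mul_comm, Real.mul_self_sqrt hC0]
  | succ n ih =>
    intro c d β γ hc hd hβ hγ
    have hvn : ∀ (c : ℝ) (β : ι → ℂ), 0 ≤ c → (∀ p ∈ P, ‖β p‖ ≤ c * ‖α p‖) →
        ∀ p ∈ P, ‖(v p : ℂ) * β p‖ ≤ η * c * ‖α p‖ := by
      intro c β hc hβ p hp
      rw [norm_mul, Complex.norm_real, Real.norm_of_nonneg (hv p hp).1, mul_assoc]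
      exact mul_le_mul (hv p hp).2 (hβ p hp) (norm_nonneg _) hη
    have i1 := ih (η * c) d (fun p => v p * β p) γ (by positivity) hd (hvn c β hc hβ) hγ
    have i2 := ih c (η * d) β (fun p => v p * γ p) hc (by positivity) hβ (hvn d γ hd hγ)
    have i3 := ih (η * c) (η * d) (fun p => v p * β p) (fun p => v p * γ p) (by positivity)
      (by positivity) (hvn c β hc hβ) (hvn d γ hd hγ)
    have hk : ∀ k ∈ s, w k * ‖∑ p ∈ P, ∑ q ∈ P, β p * Ψ k p * conj (γ q * Ψ k q) *
          ((v p + v q - v p * v q : ℝ) : ℂ) ^ (n + 1)‖ ≤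
        w k * ‖∑ p ∈ P, ∑ q ∈ P, v p * β p * Ψ k p * conj (γ q * Ψ k q) *
          ((v p + v q - v p * v q : ℝ) : ℂ) ^ n‖ +
        w k * ‖∑ p ∈ P, ∑ q ∈ P, β p * Ψ k p * conj (v q * γ q * Ψ k q) *
          ((v p + v q - v p * v q : ℝ) : ℂ) ^ n‖ +
        w k * ‖∑ p ∈ P, ∑ q ∈ P, v p * β p * Ψ k p * conj (v q * γ q * Ψ k q) *
          ((v p + v q - v p * v q : ℝ) : ℂ) ^ n‖ := by
      intro k hk
      rw [← mul_add, ← mul_add]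
      refine mul_le_mul_of_nonneg_left ?_ (hw k hk)
      refine le_trans (le_of_eq ?_) ((norm_sub_le _ _).trans (by gcongr; exact norm_add_le _ _))
      congr 1
      rw [← Finset.sum_add_distrib, ← Finset.sum_sub_distrib]
      refine Finset.sum_congr rfl fun p _ => ?_
      rw [← Finset.sum_add_distrib, ← Finset.sum_sub_distrib]
      refine Finset.sum_congr rfl fun q _ => ?_
      simp only [map_mul, Complex.conj_ofReal]
      push_cast
      ring
    refine (Finset.sum_le_sum hk).trans ?_
    rw [Finset.sum_add_distrib, Finset.sum_add_distrib]
    calc _ ≤ _ := add_le_add (add_le_add i1 i2) i3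
      _ = _ := by ring

theorem exp_neg_mul_pow_div_factorial_le {z : ℝ} (hz : 0 ≤ z) (n : ℕ) :
    Real.exp (-z) * (z ^ n / n.factorial) ≤ (4 / 3) ^ n * Real.exp (-(z / 4)) := by
  have h := Real.pow_div_factorial_le_exp (3 / 4 * z) (by positivity) n
  have e : z ^ n / n.factorial = (4 / 3 : ℝ) ^ n * ((3 / 4 * z) ^ n / n.factorial) := by
    rw [mul_pow, ← mul_div_assoc, ← mul_assoc, ← mul_pow]
    norm_num
  calc _ ≤ Real.exp (-z) * ((4 / 3 : ℝ) ^ n * Real.exp (3 / 4 * z)) := by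
        rw [e]; gcongr
    _ = (4 / 3 : ℝ) ^ n * (Real.exp (-z) * Real.exp (3 / 4 * z)) := by ring
    _ = _ := by rw [← Real.exp_add]; congr 2; ring

/-- Separation of variables in the weight `exp (-z s(p) s(q))`. -/
theorem norm_sum_exp_bilinear_le {ι κ : Type*} {P : Finset ι} {s : Finset κ} {Ψ : κ → ι → ℂ}
    {z : κ → ℝ} (hz : ∀ k ∈ s, 0 ≤ z k) {α : ι → ℂ} {C : ℝ} (hC0 : 0 ≤ C)
    (hC : ∀ (c : ℝ) (β : ι → ℂ), 0 ≤ c → (∀ p ∈ P, ‖β p‖ ≤ c * ‖α p‖) →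
      ∑ k ∈ s, Real.exp (-(z k / 4)) * ‖∑ p ∈ P, β p * Ψ k p‖ ^ 2 ≤ c ^ 2 * C)
    {σ : ι → ℝ} (hσ : ∀ p ∈ P, 64 / 81 ≤ σ p ∧ σ p ≤ 1) {ρ : κ → ℂ} (hρ : ∀ k ∈ s, ‖ρ k‖ ≤ 1) :
    ‖∑ k ∈ s, ρ k * ∑ p ∈ P, ∑ q ∈ P, α p * Ψ k p * conj (α q * Ψ k q) *
      (Real.exp (-(z k * (σ p * σ q))) : ℝ)‖ ≤ 3 * C := by
  set v : ι → ℝ := fun p => 1 - σ p with hv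
  set B : ℕ → κ → ℂ := fun n k => ∑ p ∈ P, ∑ q ∈ P, α p * Ψ k p * conj (α q * Ψ k q) *
    ((v p + v q - v p * v q : ℝ) : ℂ) ^ n with hB
  have hsum : HasSum (fun n : ℕ => ∑ k ∈ s, ρ k *
      (((Real.exp (-z k) * (z k ^ n / n.factorial) : ℝ) : ℂ) * B n k))
      (∑ k ∈ s, ρ k * ∑ p ∈ P, ∑ q ∈ P, α p * Ψ k p * conj (α q * Ψ k q) *
      (Real.exp (-(z k * (σ p * σ q))) : ℝ)) := by
    refine hasSum_sum fun k _ => HasSum.mul_left _ ?_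
    have h1 : ∀ p q : ι, HasSum (fun n : ℕ => ((Real.exp (-z k) * (z k ^ n / n.factorial) : ℝ) : ℂ) *
        ((v p + v q - v p * v q : ℝ) : ℂ) ^ n) ((Real.exp (-(z k * (σ p * σ q))) : ℝ) : ℂ) := by
      intro p q
      have h := (NormedSpace.expSeries_div_hasSum_exp (z k * (v p + v q - v p * v q))).mul_left
        (Real.exp (-z k))
      rw [← Real.exp_eq_exp_ℝ, ← Real.exp_add] at h
      have e : -z k + z k * (v p + v q - v p * v q) = -(z k * (σ p * σ q)) := by
        simp only [hv]; ring
      rw [e] at h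
      refine hasSum_of_forall_eq (Complex.hasSum_ofReal.mpr h) fun n => ?_
      push_cast
      rw [mul_pow]
      ring
    have h2 : HasSum (fun n : ℕ => ∑ p ∈ P, ∑ q ∈ P, α p * Ψ k p * conj (α q * Ψ k q) *
        (((Real.exp (-z k) * (z k ^ n / n.factorial) : ℝ) : ℂ) *
        ((v p + v q - v p * v q : ℝ) : ℂ) ^ n)) (∑ p ∈ P, ∑ q ∈ P, α p * Ψ k p *
          conj (α q * Ψ k q) * (Real.exp (-(z k * (σ p * σ q))) : ℝ)) :=
      hasSum_sum fun p _ => hasSum_sum fun q _ => (h1 p q).mul_left _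
    refine hasSum_of_forall_eq h2 fun n => ?_
    simp only [hB, Finset.mul_sum]
    refine Finset.sum_congr rfl fun p _ => Finset.sum_congr rfl fun q _ => ?_
    ring
  have hr : HasSum (fun n : ℕ => C * (3043 * 4 / (6561 * 3) : ℝ) ^ n)
      (C * (1 - 3043 * 4 / (6561 * 3) : ℝ)⁻¹) :=
    (hasSum_geometric_of_lt_one (by norm_num) (by norm_num)).mul_left C
  rw [← hsum.tsum_eq]
  refine (tsum_of_norm_bounded hr fun n => ?_).trans ?_
  · have h1 := sum_weight_mul_bilinear_le (P := P) (s := s) (Ψ := Ψ) (α := α) (η := 17 / 81)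
      (w := fun k => Real.exp (-(z k / 4))) (fun _ _ => (Real.exp_pos _).le) (by norm_num) hC hC0
      (v := v) (fun p hp => by
        have := hσ p hp
        simp only [hv]
        constructor <;> linarith) n 1 1 α α zero_le_one zero_le_one
      (fun p _ => by rw [one_mul]) (fun p _ => by rw [one_mul])
    calc _ ≤ ∑ k ∈ s, (4 / 3 : ℝ) ^ n * (Real.exp (-(z k / 4)) * ‖B n k‖) := by
          refine (norm_sum_le _ _).trans (Finset.sum_le_sum fun k hk => ?_)
          rw [norm_mul, norm_mul, Complex.norm_real, Real.norm_of_nonneg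
            (mul_nonneg (Real.exp_pos _).le (div_nonneg (pow_nonneg (hz k hk) n) (by positivity))),
            ← mul_assoc ((4 / 3 : ℝ) ^ n)]
          have h2 := exp_neg_mul_pow_div_factorial_le (hz k hk) n
          have h3 := mul_le_mul_of_nonneg_right h2 (norm_nonneg (B n k))
          exact (mul_le_of_le_one_left (mul_nonneg (mul_nonneg (Real.exp_pos _).le
            (div_nonneg (pow_nonneg (hz k hk) n) (by positivity))) (norm_nonneg _))
            (hρ k hk)).trans h3
      _ = (4 / 3 : ℝ) ^ n * ∑ k ∈ s, Real.exp (-(z k / 4)) * ‖B n k‖ := by rw [Finset.mul_sum]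
      _ ≤ (4 / 3 : ℝ) ^ n * ((2 * (17 / 81) + (17 / 81) ^ 2) ^ n * (1 * 1 * C)) := by
          gcongr
      _ = _ := by
          rw [← mul_assoc, ← mul_pow]
          norm_num
          ring
  · rw [mul_comm]
    gcongr
    norm_num

theorem exp_neg_le_sum_range {u : ℝ} (hu : 0 ≤ u) {J : ℕ} (hJ : u < J) :
    Real.exp (-u) ≤ ∑ j ∈ Finset.range J, if u < j + 1 then Real.exp (-j) else 0 := by
  have h1 : ⌊u⌋₊ ∈ Finset.range J := Finset.mem_range.mpr ((Nat.floor_lt hu).mpr hJ)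
  refine le_trans ?_ (Finset.single_le_sum (fun j _ => by split_ifs <;> positivity) h1)
  rw [if_pos (Nat.lt_floor_add_one u)]
  gcongr
  exact Nat.floor_le hu

theorem exists_exp_weight_lattice_le :
    ∃ κ : ℝ, 0 ≤ κ ∧ ∀ (K ε : ℝ), 0 ≤ K → 0 < ε → ε ≤ 1 → ∀ X : ℕ, 1 ≤ X →
      (∀ N : ℕ, 1 ≤ N → LargeSieve ((gaussBall N).erase 0) oddPsi X
        (K * ((X : ℝ) * N) ^ ε * ((N : ℝ) ^ ((7 : ℝ) / 6) + (N : ℝ) ^ ((2 : ℝ) / 3) * X))) →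
      ∀ (Z : ℝ), 0 < Z → ∀ s : Finset GaussianInt, 0 ∉ s → ∀ b : ℕ → ℂ,
        ∑ k ∈ s, Real.exp (-((k.norm : ℝ) / Z)) *
          ‖∑ m ∈ squarefreeUpTo X, b m * oddPsi k m‖ ^ 2 ≤
        κ * (K * ((X : ℝ) * Z) ^ ε * (Z ^ ((7 : ℝ) / 6) + Z ^ ((2 : ℝ) / 3) * X)) *
          ∑ m ∈ squarefreeUpTo X, ‖b m‖ ^ 2 := by
  have hsm : Summable fun j : ℕ => ((j + 1 : ℕ) : ℝ) ^ 3 * Real.exp (-(1 : ℝ) * (j + 1 : ℕ)) :=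
    (summable_nat_add_iff 1).mpr (Real.summable_pow_mul_exp_neg_nat_mul 3 one_pos)
  have hsm2 : Summable fun j : ℕ => Real.exp (-j) * ((j : ℝ) + 1) ^ 3 := by
    refine (hsm.mul_left (Real.exp 1)).congr fun j => ?_
    rw [mul_left_comm, ← Real.exp_add, mul_comm]
    push_cast
    congr 2
    ring
  refine ⟨∑' j : ℕ, Real.exp (-j) * ((j : ℝ) + 1) ^ 3, tsum_nonneg fun _ => by positivity,
    fun K ε hK hε hε1 X hX h Z hZ s hs b => ?_⟩
  set S : GaussianInt → ℝ := fun k => ‖∑ m ∈ squarefreeUpTo X, b m * oddPsi k m‖ ^ 2 with hS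
  have hS0 : ∀ k, 0 ≤ S k := fun k => by positivity
  set A := ∑ m ∈ squarefreeUpTo X, ‖b m‖ ^ 2
  have hA : 0 ≤ A := Finset.sum_nonneg fun _ _ => by positivity
  set W := K * ((X : ℝ) * Z) ^ ε * (Z ^ ((7 : ℝ) / 6) + Z ^ ((2 : ℝ) / 3) * X) with hW
  have hW0 : 0 ≤ W := by positivity
  obtain ⟨J, hJ⟩ : ∃ J : ℕ, ∀ k ∈ s, (k.norm : ℝ) / Z < J := by
    obtain ⟨J, hJ⟩ := exists_nat_gt (∑ k ∈ s, (k.norm : ℝ) / Z)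
    refine ⟨J, fun k hk => lt_of_le_of_lt ?_ hJ⟩
    exact Finset.single_le_sum (f := fun k : GaussianInt => (k.norm : ℝ) / Z)
      (fun k _ => div_nonneg (by exact_mod_cast GaussianInt.norm_nonneg k) hZ.le) hk
  have hn0 : ∀ k : GaussianInt, 0 ≤ (k.norm : ℝ) / Z := fun k =>
    div_nonneg (by exact_mod_cast GaussianInt.norm_nonneg k) hZ.le
  have hj : ∀ j ∈ Finset.range J, ∑ k ∈ s, (if (k.norm : ℝ) / Z < j + 1 then S k else 0) ≤
      ((j : ℝ) + 1) ^ 3 * (W * A) := by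
    intro j _
    rw [← Finset.sum_filter]
    set N := ⌊((j : ℝ) + 1) * Z⌋₊
    have hsub : (s.filter fun k => (k.norm : ℝ) / Z < j + 1) ⊆ (gaussBall N).erase 0 := by
      intro k hk
      obtain ⟨hk1, hk2⟩ := Finset.mem_filter.mp hk
      refine Finset.mem_erase.mpr ⟨fun h => hs (h ▸ hk1), mem_gaussBall.mpr ?_⟩
      rw [div_lt_iff₀ hZ] at hk2
      have h0 := GaussianInt.norm_nonneg k
      have h1 : k.norm.toNat ≤ N := by
        refine Nat.le_floor ?_
        have : ((k.norm.toNat : ℤ) : ℝ) = (k.norm : ℝ) := by rw [Int.toNat_of_nonneg h0]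
        rw [Int.cast_natCast] at this
        rw [this]; exact hk2.le
      lia
    refine (Finset.sum_le_sum_of_subset_of_nonneg hsub fun _ _ _ => hS0 _).trans ?_
    rcases Nat.eq_zero_or_pos N with hN | hN
    · have : (gaussBall N).erase 0 = ∅ := by
        ext k
        simp only [Finset.mem_erase, mem_gaussBall, hN, Finset.notMem_empty, iff_false, not_and]
        intro hk h
        have := gauss_norm_pos hk
        push_cast at h
        lia
      rw [this, Finset.sum_empty]
      positivity
    · refine (h N hN b).trans ?_
      rw [← mul_assoc]
      refine mul_le_mul_of_nonneg_right ?_ hA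
      have hNZ : (N : ℝ) ≤ ((j : ℝ) + 1) * Z := Nat.floor_le (by positivity)
      have hj1 : (1 : ℝ) ≤ (j : ℝ) + 1 := by linarith [(Nat.cast_nonneg j : (0 : ℝ) ≤ j)]
      have h1 : ((X : ℝ) * N) ^ ε ≤ ((j : ℝ) + 1) * ((X : ℝ) * Z) ^ ε := by
        calc ((X : ℝ) * N) ^ ε ≤ (((j : ℝ) + 1) * ((X : ℝ) * Z)) ^ ε := by
              refine Real.rpow_le_rpow (by positivity) ?_ hε.le
              calc (X : ℝ) * N ≤ X * (((j : ℝ) + 1) * Z) := by gcongr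
                _ = _ := by ring
          _ = ((j : ℝ) + 1) ^ ε * ((X : ℝ) * Z) ^ ε := Real.mul_rpow (by positivity) (by positivity)
          _ ≤ _ := by
              gcongr
              exact (Real.rpow_le_rpow_of_exponent_le hj1 hε1).trans (Real.rpow_one _).le
      have h2 : ∀ r : ℝ, 0 ≤ r → r ≤ 2 → (N : ℝ) ^ r ≤ ((j : ℝ) + 1) ^ 2 * Z ^ r := by
        intro r hr hr2
        calc (N : ℝ) ^ r ≤ (((j : ℝ) + 1) * Z) ^ r := Real.rpow_le_rpow (by positivity) hNZ hr
          _ = ((j : ℝ) + 1) ^ r * Z ^ r := Real.mul_rpow (by positivity) hZ.le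
          _ ≤ _ := by
              gcongr
              refine (Real.rpow_le_rpow_of_exponent_le hj1 hr2).trans (le_of_eq ?_)
              exact Real.rpow_two _
      have h7 := h2 (7 / 6) (by norm_num) (by norm_num)
      have h3 := h2 (2 / 3) (by norm_num) (by norm_num)
      calc _ ≤ K * (((j : ℝ) + 1) * ((X : ℝ) * Z) ^ ε) *
            (((j : ℝ) + 1) ^ 2 * Z ^ ((7 : ℝ) / 6) + ((j : ℝ) + 1) ^ 2 * Z ^ ((2 : ℝ) / 3) * X) := by
            gcongr
        _ = _ := by rw [hW]; ring
  calc ∑ k ∈ s, Real.exp (-((k.norm : ℝ) / Z)) * S k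
      ≤ ∑ k ∈ s, ∑ j ∈ Finset.range J,
          Real.exp (-j) * (if (k.norm : ℝ) / Z < j + 1 then S k else 0) := by
        refine Finset.sum_le_sum fun k hk => ?_
        refine (mul_le_mul_of_nonneg_right (exp_neg_le_sum_range (hn0 k) (hJ k hk)) (hS0 k)).trans
          (le_of_eq ?_)
        rw [Finset.sum_mul]
        refine Finset.sum_congr rfl fun j _ => ?_
        split_ifs <;> simp
    _ = ∑ j ∈ Finset.range J, Real.exp (-j) *
          ∑ k ∈ s, (if (k.norm : ℝ) / Z < j + 1 then S k else 0) := by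
        rw [Finset.sum_comm]
        simp only [Finset.mul_sum]
    _ ≤ ∑ j ∈ Finset.range J, Real.exp (-j) * (((j : ℝ) + 1) ^ 3 * (W * A)) :=
        Finset.sum_le_sum fun j hj' => mul_le_mul_of_nonneg_left (hj j hj') (Real.exp_pos _).le
    _ = (∑ j ∈ Finset.range J, Real.exp (-j) * ((j : ℝ) + 1) ^ 3) * (W * A) := by
        rw [Finset.sum_mul]
        exact Finset.sum_congr rfl fun _ _ => by ring
    _ ≤ _ := by
        rw [mul_assoc _ W A]
        refine mul_le_mul_of_nonneg_right ?_ (mul_nonneg hW0 hA)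
        exact hsm2.sum_le_tsum _ fun j _ => mul_nonneg (Real.exp_pos _).le (by positivity)

/-- The normalised coefficient `ψ_{m/g}(i) / (m/g)` on the dual side of Poisson summation. -/
def dualCoeff (g m : ℕ) : ℂ := psi (m / g) ⟨0, 1⟩ / ((m / g : ℕ) : ℂ)

theorem norm_dualCoeff_le (g m : ℕ) : ‖dualCoeff g m‖ ≤ 1 / ((m / g : ℕ) : ℝ) := by
  rw [dualCoeff, norm_div, Complex.norm_natCast]
  exact div_le_div_of_nonneg_right (norm_psi_I_le _) (by positivity)

theorem hasSum_poisson_psi {Q : ℝ} (hQ : 0 < Q) {m n : ℕ} (hm : Squarefree m) (hn : Squarefree n)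
    (hmo : Odd m) (hno : Odd n) :
    ∃ T : ℂ,
      HasSum (fun x : GaussianInt => psi m x * conj (psi n x) *
        ((Real.exp (-Real.pi * x.norm / Q) : ℝ) : ℂ)) T ∧
      HasSum (fun k : GaussianInt => (Q : ℂ) * (psiNormFT (m.gcd n) k / (m.gcd n : ℂ) ^ 2 *
        (dualCoeff (m.gcd n) m * psi (m / m.gcd n) k *
          conj (dualCoeff (m.gcd n) n * psi (n / m.gcd n) k) *
        ((Real.exp (-(Real.pi * Q * k.norm * (m.gcd n) ^ 2 / ((m : ℝ) ^ 2 * n ^ 2))) : ℝ) : ℂ)))) T := by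
  set g := m.gcd n with hg
  have hg0 : 0 < g := Nat.gcd_pos_of_pos_left _ (Nat.pos_of_ne_zero hm.ne_zero)
  set p := m / g with hp
  set q := n / g with hq
  have hmp : m = g * p := (Nat.mul_div_cancel' (Nat.gcd_dvd_left m n)).symm
  have hnq : n = g * q := (Nat.mul_div_cancel' (Nat.gcd_dvd_right m n)).symm
  have hpq : p.Coprime q := Nat.coprime_div_gcd_div_gcd hg0
  have hgq : g.Coprime q := Nat.coprime_of_squarefree_mul (hnq ▸ hn)
  have hsq : Squarefree (g * p * q) := by
    rw [Nat.squarefree_mul (Nat.Coprime.mul_left hgq hpq)]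
    exact ⟨hmp ▸ hm, hn.squarefree_of_dvd ⟨g, by rw [mul_comm]; exact hnq⟩⟩
  have hpo : Odd (g * p * q) := by
    rw [hnq, Nat.odd_mul] at hno
    exact (hmp ▸ hmo : Odd (g * p)).mul hno.2
  have hp0 : p ≠ 0 := fun h => hm.ne_zero (by rw [hmp, h, mul_zero])
  have hq0 : q ≠ 0 := fun h => hn.ne_zero (by rw [hnq, h, mul_zero])
  obtain ⟨T, hT1, hT2⟩ := hasSum_poisson hQ (R := g * p * q) (Nat.pos_of_ne_zero hsq.ne_zero)
    (f := fun x => psi (g * p) x * conj (psi (g * q) x)) (fun x y hxy => by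
      have h1 : ((m : ℤ) : GaussianInt) ∣ x - y :=
        (map_dvd (Int.castRingHom GaussianInt) (Int.natCast_dvd_natCast.mpr
          (Dvd.intro q (by rw [hmp] : m * q = g * p * q)))).trans hxy
      have h2 : ((n : ℤ) : GaussianInt) ∣ x - y :=
        (map_dvd (Int.castRingHom GaussianInt) (Int.natCast_dvd_natCast.mpr
          (Dvd.intro p (by rw [hnq]; ring : n * p = g * p * q)))).trans hxy
      rw [← hmp, ← hnq, psi_congr hmo h1, psi_congr hno h2])
  refine ⟨T, ?_, ?_⟩
  · refine hasSum_of_forall_eq hT1 fun x => ?_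
    rw [← hmp, ← hnq]
  · refine hasSum_of_forall_eq hT2 fun k => ?_
    rw [gaussFT_psi_mul_conj_psi hsq hpo]
    have e1 : -Real.pi * Q * k.norm / ((g * p * q : ℕ) : ℝ) ^ 2 =
        -(Real.pi * Q * k.norm * g ^ 2 / ((m : ℝ) ^ 2 * n ^ 2)) := by
      have h1 : (m : ℝ) = g * p := by exact_mod_cast hmp
      have h2 : (n : ℝ) = g * q := by exact_mod_cast hnq
      have hg' : (g : ℝ) ≠ 0 := by exact_mod_cast hg0.ne'
      have hp' : (p : ℝ) ≠ 0 := by exact_mod_cast hp0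
      have hq' : (q : ℝ) ≠ 0 := by exact_mod_cast hq0
      rw [h1, h2]
      push_cast
      field_simp
    rw [e1]
    have hg' : (g : ℂ) ≠ 0 := by exact_mod_cast hg0.ne'
    have hp' : (p : ℂ) ≠ 0 := by exact_mod_cast hp0
    have hq' : (q : ℂ) ≠ 0 := by exact_mod_cast hq0
    simp only [dualCoeff, ← hp, ← hq, map_mul, map_div₀, Complex.conj_natCast]
    push_cast
    field_simp

theorem sum_multiples_eq {E : Type*} [AddCommMonoid E] {g X : ℕ} (hg : 1 ≤ g) {P : Finset ℕ}
    (hP : ∀ m ∈ P, g ∣ m ∧ m ≤ g * X ∧ Squarefree m) (F : ℕ → ℕ → E) :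
    ∑ m ∈ P, F m (m / g) = ∑ p ∈ squarefreeUpTo X, if g * p ∈ P then F (g * p) p else 0 := by
  rw [← Finset.sum_filter]
  refine Finset.sum_nbij' (fun m => m / g) (fun p => g * p) (fun m hm => ?_) (fun p hp => ?_)
    (fun m hm => ?_) (fun p hp => ?_) (fun m hm => ?_)
  · obtain ⟨⟨p, rfl⟩, h2, h3⟩ := hP m hm
    rw [Finset.mem_filter, mem_squarefreeUpTo, Nat.mul_div_cancel_left p hg]
    refine ⟨⟨⟨Nat.pos_of_ne_zero fun h => h3.ne_zero (by rw [h, mul_zero]),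
      Nat.le_of_mul_le_mul_left h2 hg⟩, h3.squarefree_of_dvd ⟨g, mul_comm _ _⟩⟩, hm⟩
  · exact (Finset.mem_filter.mp hp).2
  · exact Nat.mul_div_cancel' (hP m hm).1
  · exact Nat.mul_div_cancel_left p hg
  · rw [Nat.mul_div_cancel' (hP m hm).1]

theorem norm_dual_sum_le {A Q D Z : ℝ} (hA : 0 < A) (hQ : 0 < Q) (hD : 0 ≤ D) {g X : ℕ} (hg : 1 ≤ g)
    (hZ : Z = 2 * A ^ 4 / (Q * g ^ 2))
    (h : ∀ s : Finset GaussianInt, 0 ∉ s → ∀ b : ℕ → ℂ,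
      ∑ k ∈ s, Real.exp (-((k.norm : ℝ) / Z)) *
        ‖∑ m ∈ squarefreeUpTo X, b m * oddPsi k m‖ ^ 2 ≤ D * ∑ m ∈ squarefreeUpTo X, ‖b m‖ ^ 2)
    {P : Finset ℕ} (hP : ∀ m ∈ P, g ∣ m ∧ m ≤ g * X ∧ Squarefree m) (hPo : ∀ m ∈ P, Odd m)
    (hPA : ∀ m ∈ P, A ≤ m ∧ (m : ℝ) ≤ 9 / 8 * A) (a : ℕ → ℂ) {s : Finset GaussianInt} (hs : 0 ∉ s)
    {ρ : GaussianInt → ℂ} (hρ : ∀ k ∈ s, ‖ρ k‖ ≤ 1) :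
    ‖∑ k ∈ s, ρ k * ∑ m ∈ P, ∑ n ∈ P, a m * dualCoeff g m * psi (m / g) k *
      conj (a n * dualCoeff g n * psi (n / g) k) *
      ((Real.exp (-(Real.pi * Q * k.norm * g ^ 2 / ((m : ℝ) ^ 2 * n ^ 2))) : ℝ) : ℂ)‖ ≤
      3 * (D * ((g / A) ^ 2 * ∑ m ∈ P, ‖a m‖ ^ 2)) := by
  have hg0 : (0 : ℝ) < g := by exact_mod_cast hg
  have hn0 : ∀ k : GaussianInt, (0 : ℝ) ≤ k.norm := fun k => by
    exact_mod_cast GaussianInt.norm_nonneg k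
  have hZ0 : 0 < Z := by rw [hZ]; positivity
  have key := norm_sum_exp_bilinear_le (P := P) (s := s) (Ψ := fun k m => psi (m / g) k)
    (z := fun k : GaussianInt => Real.pi * Q * k.norm * g ^ 2 / A ^ 4)
    (fun k _ => by have := hn0 k; positivity)
    (α := fun m => a m * dualCoeff g m) (C := D * ((g / A) ^ 2 * ∑ m ∈ P, ‖a m‖ ^ 2))
    (by positivity) ?_ (σ := fun m => A ^ 2 / (m : ℝ) ^ 2) ?_ hρ
  · refine le_trans (le_of_eq ?_) key
    refine congrArg _ (Finset.sum_congr rfl fun k _ => congrArg _ (Finset.sum_congr rfl fun m hm =>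
      Finset.sum_congr rfl fun n hn => ?_))
    have hm0 : (0 : ℝ) < m := hA.trans_le (hPA m hm).1
    have hn0 : (0 : ℝ) < n := hA.trans_le (hPA n hn).1
    congr 4
    field_simp
  · intro c β hc hβ
    have e1 : ∀ k, ∑ m ∈ P, β m * psi (m / g) k = ∑ p ∈ squarefreeUpTo X,
        (if g * p ∈ P then β (g * p) else 0) * oddPsi k p := by
      intro k
      rw [sum_multiples_eq hg hP fun m p => β m * psi p k]
      refine Finset.sum_congr rfl fun p _ => ?_
      split_ifs with h
      · have := (Nat.odd_mul.mp (hPo _ h)).2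
        rw [oddPsi, if_pos this]
      · simp
    have e2 : ∑ p ∈ squarefreeUpTo X, ‖if g * p ∈ P then β (g * p) else 0‖ ^ 2 =
        ∑ m ∈ P, ‖β m‖ ^ 2 := by
      rw [sum_multiples_eq hg hP fun m _ => ‖β m‖ ^ 2]
      refine Finset.sum_congr rfl fun p _ => ?_
      split_ifs <;> simp
    have e3 : ∑ m ∈ P, ‖β m‖ ^ 2 ≤ c ^ 2 * ((g / A) ^ 2 * ∑ m ∈ P, ‖a m‖ ^ 2) := by
      rw [Finset.mul_sum, Finset.mul_sum]
      refine Finset.sum_le_sum fun m hm => ?_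
      rw [← mul_pow, ← mul_pow]
      refine pow_le_pow_left₀ (norm_nonneg _) ((hβ m hm).trans ?_) 2
      refine mul_le_mul_of_nonneg_left ?_ hc
      rw [norm_mul, mul_comm]
      refine mul_le_mul_of_nonneg_right ((norm_dualCoeff_le g m).trans ?_) (norm_nonneg _)
      rw [Nat.cast_div (hP m hm).1 hg0.ne', one_div_div]
      exact div_le_div_of_nonneg_left hg0.le hA (hPA m hm).1
    calc ∑ k ∈ s, Real.exp (-(Real.pi * Q * k.norm * g ^ 2 / A ^ 4 / 4)) *
          ‖∑ m ∈ P, β m * psi (m / g) k‖ ^ 2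
        ≤ ∑ k ∈ s, Real.exp (-((k.norm : ℝ) / Z)) * ‖∑ p ∈ squarefreeUpTo X,
          (if g * p ∈ P then β (g * p) else 0) * oddPsi k p‖ ^ 2 := by
          refine Finset.sum_le_sum fun k _ => ?_
          rw [e1]
          refine mul_le_mul_of_nonneg_right (Real.exp_le_exp.mpr (neg_le_neg ?_)) (by positivity)
          have h0 := hn0 k
          have h2 : (k.norm : ℝ) / Z = 2 * (Q * k.norm * g ^ 2 / A ^ 4 / 4) := by
            rw [hZ]; field_simp; ring
          have h3 : Real.pi * Q * k.norm * g ^ 2 / A ^ 4 / 4 =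
            Real.pi * (Q * k.norm * g ^ 2 / A ^ 4 / 4) := by ring
          rw [h2, h3]
          exact mul_le_mul_of_nonneg_right Real.two_le_pi (by positivity)
      _ ≤ _ := h s hs _
      _ ≤ _ := by
          rw [e2]
          calc _ ≤ D * (c ^ 2 * ((g / A) ^ 2 * ∑ m ∈ P, ‖a m‖ ^ 2)) := by gcongr
            _ = _ := by ring
  · intro m hm
    obtain ⟨h1, h2⟩ := hPA m hm
    have hm0 : (0 : ℝ) < m := hA.trans_le h1
    constructor
    · rw [le_div_iff₀ (by positivity)]
      nlinarith
    · rw [div_le_one (by positivity)]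
      gcongr

theorem sum_moebius_of_dvd {g m n Y : ℕ} (hg : 1 ≤ g) (hm : 1 ≤ m) (hmY : m ≤ Y) :
    ∑ d ∈ Finset.Icc 1 Y, (if g * d ∣ m ∧ g * d ∣ n then ArithmeticFunction.moebius d else 0) =
      if m.gcd n = g then 1 else 0 := by
  simp only [← Nat.dvd_gcd_iff]
  have hG : 0 < m.gcd n := Nat.gcd_pos_of_pos_left _ hm
  by_cases h : g ∣ m.gcd n
  · obtain ⟨e, he⟩ := h
    have he0 : 0 < e := Nat.pos_of_ne_zero fun h => by rw [he, h, mul_zero] at hG; exact hG.false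
    have heY : e ≤ Y := (Nat.le_mul_of_pos_left e hg).trans
      (he ▸ (Nat.le_of_dvd hm (Nat.gcd_dvd_left m n)).trans hmY)
    have hsum : ∑ d ∈ e.divisors, ArithmeticFunction.moebius d = if e = 1 then 1 else 0 := by
      rw [← ArithmeticFunction.coe_mul_zeta_apply, ArithmeticFunction.moebius_mul_coe_zeta,
        ArithmeticFunction.one_apply]
    rw [he, ← Finset.sum_filter]
    have hf : (Finset.Icc 1 Y).filter (fun d => g * d ∣ g * e) = e.divisors := by
      ext d
      rw [Finset.mem_filter, Finset.mem_Icc, Nat.mem_divisors, Nat.mul_dvd_mul_iff_left hg]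
      exact ⟨fun h => ⟨h.2, he0.ne'⟩, fun h => ⟨⟨Nat.pos_of_dvd_of_pos h.1 he0,
        (Nat.le_of_dvd he0 h.1).trans heY⟩, h.1⟩⟩
    rw [hf, hsum]
    refine if_congr ?_ rfl rfl
    constructor
    · rintro rfl
      rw [mul_one]
    · intro h
      exact Nat.eq_of_mul_eq_mul_left hg (by rw [h, mul_one])
  · rw [if_neg fun h' => h (by rw [h'])]
    exact Finset.sum_eq_zero fun d _ => if_neg fun h' => h ((Dvd.intro d rfl).trans h')

theorem sum_offdiag_eq_sum_moebius {G Y : ℕ} {T : Finset ℕ} (hT : ∀ m ∈ T, m ≤ Y ∧ G < m)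
    (hgcd : ∀ m ∈ T, ∀ n ∈ T, m ≠ n → m.gcd n ≤ G) (R : ℕ → ℂ) (F : ℕ → ℕ → ℕ → ℂ) :
    ∑ m ∈ T, ∑ n ∈ T, (if m = n then 0 else R (m.gcd n) * F (m.gcd n) m n) =
      ∑ g ∈ Finset.Icc 1 G, ∑ d ∈ Finset.Icc 1 Y, ((ArithmeticFunction.moebius d : ℤ) * R g) *
        ∑ m ∈ T.filter (g * d ∣ ·), ∑ n ∈ T.filter (g * d ∣ ·), F g m n := by
  have hpt : ∀ m ∈ T, ∀ n ∈ T, (if m = n then 0 else R (m.gcd n) * F (m.gcd n) m n) =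
      ∑ g ∈ Finset.Icc 1 G, ∑ d ∈ Finset.Icc 1 Y, ((ArithmeticFunction.moebius d : ℤ) * R g) *
        (if g * d ∣ m ∧ g * d ∣ n then F g m n else 0) := by
    intro m hm n hn
    have hm1 : 1 ≤ m := (Nat.zero_le G).trans_lt (hT m hm).2
    have e : ∀ g ∈ Finset.Icc 1 G, ∑ d ∈ Finset.Icc 1 Y,
        ((ArithmeticFunction.moebius d : ℤ) * R g) *
          (if g * d ∣ m ∧ g * d ∣ n then F g m n else 0) =
        if m.gcd n = g then R g * F g m n else 0 := by
      intro g hg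
      have h1 := congrArg (fun z : ℤ => (z : ℂ) * (R g * F g m n))
        (sum_moebius_of_dvd (n := n) (Finset.mem_Icc.mp hg).1 hm1 (hT m hm).1)
      simp only [Int.cast_sum, Finset.sum_mul] at h1
      refine (Finset.sum_congr rfl fun d _ => ?_).trans (h1.trans ?_)
      · split_ifs <;> simp [mul_assoc]
      · split_ifs <;> simp
    rw [Finset.sum_congr rfl e, Finset.sum_ite_eq]
    by_cases h : m = n
    · subst h
      rw [if_pos rfl, if_neg]
      rw [Nat.gcd_self, Finset.mem_Icc]
      have := (hT m hm).2
      omega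
    · rw [if_neg h, if_pos]
      exact Finset.mem_Icc.mpr ⟨Nat.gcd_pos_of_pos_left _ hm1, hgcd m hm n hn h⟩
  rw [Finset.sum_congr rfl fun m hm => Finset.sum_congr rfl (hpt m hm)]
  simp only [Finset.sum_filter, ite_and]
  rw [Finset.sum_congr rfl fun m _ => Finset.sum_comm, Finset.sum_comm]
  refine Finset.sum_congr rfl fun g _ => ?_
  rw [Finset.sum_congr rfl fun m _ => Finset.sum_comm, Finset.sum_comm]
  refine Finset.sum_congr rfl fun d _ => ?_
  rw [Finset.mul_sum]
  refine Finset.sum_congr rfl fun m _ => ?_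
  split_ifs with h
  · rw [Finset.mul_sum]
  · simp

/-- The Fourier-side summand attached to a pair `(m, n)` in Poisson summation. -/
def dualTerm (Q : ℝ) (k : GaussianInt) (m n : ℕ) : ℂ :=
  (Q : ℂ) * (psiNormFT (m.gcd n) k / (m.gcd n : ℂ) ^ 2 *
    (dualCoeff (m.gcd n) m * psi (m / m.gcd n) k *
      conj (dualCoeff (m.gcd n) n * psi (n / m.gcd n) k) *
    ((Real.exp (-(Real.pi * Q * k.norm * (m.gcd n) ^ 2 / ((m : ℝ) ^ 2 * n ^ 2))) : ℝ) : ℂ)))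

theorem norm_sum_dualTerm_le {A Q : ℝ} (hA : 0 < A) (hQ : 0 < Q) {D : ℕ → ℝ} (hD : ∀ g, 0 ≤ D g)
    {G Y : ℕ}
    (h : ∀ g ∈ Finset.Icc 1 G, ∀ s : Finset GaussianInt, 0 ∉ s → ∀ b : ℕ → ℂ,
      ∑ k ∈ s, Real.exp (-((k.norm : ℝ) / (2 * A ^ 4 / (Q * g ^ 2)))) *
        ‖∑ m ∈ squarefreeUpTo (Y / g), b m * oddPsi k m‖ ^ 2 ≤
        D g * ∑ m ∈ squarefreeUpTo (Y / g), ‖b m‖ ^ 2)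
    {T : Finset ℕ} (hT : ∀ m ∈ T, m ≤ Y ∧ G < m) (hTs : ∀ m ∈ T, Squarefree m ∧ Odd m)
    (hTA : ∀ m ∈ T, A ≤ m ∧ (m : ℝ) ≤ 9 / 8 * A)
    (hgcd : ∀ m ∈ T, ∀ n ∈ T, m ≠ n → m.gcd n ≤ G) (a : ℕ → ℂ) (s : Finset GaussianInt) :
    ‖∑ k ∈ s, ∑ m ∈ T, ∑ n ∈ T, if m = n then 0 else a m * conj (a n) * dualTerm Q k m n‖ ≤
      Q * ∑ g ∈ Finset.Icc 1 G, ∑ d ∈ Finset.Icc 1 Y,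
        3 * (D g * ((g / A) ^ 2 * ∑ m ∈ T.filter (g * d ∣ ·), ‖a m‖ ^ 2)) := by
  set F : GaussianInt → ℕ → ℕ → ℕ → ℂ := fun k g m n => a m * dualCoeff g m * psi (m / g) k *
      conj (a n * dualCoeff g n * psi (n / g) k) *
      ((Real.exp (-(Real.pi * Q * k.norm * g ^ 2 / ((m : ℝ) ^ 2 * n ^ 2))) : ℝ) : ℂ) with hF
  have e1 : ∀ k, (∑ m ∈ T, ∑ n ∈ T, if m = n then 0 else a m * conj (a n) * dualTerm Q k m n) =
      Q * ∑ g ∈ Finset.Icc 1 G, ∑ d ∈ Finset.Icc 1 Y,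
        ((ArithmeticFunction.moebius d : ℤ) * (psiNormFT g k / (g : ℂ) ^ 2)) *
        ∑ m ∈ T.filter (g * d ∣ ·), ∑ n ∈ T.filter (g * d ∣ ·), F k g m n := by
    intro k
    rw [← sum_offdiag_eq_sum_moebius hT hgcd (fun g => psiNormFT g k / (g : ℂ) ^ 2) (F k),
      Finset.mul_sum]
    refine Finset.sum_congr rfl fun m _ => ?_
    rw [Finset.mul_sum]
    refine Finset.sum_congr rfl fun n _ => ?_
    split_ifs
    · simp
    · simp only [hF, dualTerm, map_mul]
      ring
  have e0 : (∑ m ∈ T, ∑ n ∈ T, if m = n then 0 else a m * conj (a n) * dualTerm Q 0 m n) = 0 := by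
    refine Finset.sum_eq_zero fun m hm => Finset.sum_eq_zero fun n hn => ?_
    split_ifs with hmn
    · rfl
    · have hlt : 1 < m / m.gcd n := by
        have h1 := hgcd m hm n hn hmn
        have h2 := (hT m hm).2
        have h3 : m.gcd n * (m / m.gcd n) = m := Nat.mul_div_cancel' (Nat.gcd_dvd_left m n)
        by_contra h4
        have := Nat.mul_le_mul_left (m.gcd n) (not_lt.mp h4)
        omega
      rw [dualTerm, psi_zero hlt]
      simp
  have e2 : (∑ k ∈ s, ∑ m ∈ T, ∑ n ∈ T, if m = n then 0 else a m * conj (a n) * dualTerm Q k m n) =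
      Q * ∑ g ∈ Finset.Icc 1 G, ∑ d ∈ Finset.Icc 1 Y, ∑ k ∈ s.erase 0,
        ((ArithmeticFunction.moebius d : ℤ) * (psiNormFT g k / (g : ℂ) ^ 2)) *
        ∑ m ∈ T.filter (g * d ∣ ·), ∑ n ∈ T.filter (g * d ∣ ·), F k g m n := by
    rw [← Finset.sum_erase s e0, Finset.sum_congr rfl fun k _ => e1 k, ← Finset.mul_sum,
      Finset.sum_comm]
    exact congrArg _ (Finset.sum_congr rfl fun g _ => Finset.sum_comm)
  rw [e2, norm_mul, Complex.norm_real, Real.norm_of_nonneg hQ.le]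
  refine mul_le_mul_of_nonneg_left ?_ hQ.le
  refine (norm_sum_le _ _).trans (Finset.sum_le_sum fun g hg => (norm_sum_le _ _).trans
    (Finset.sum_le_sum fun d hd => ?_))
  have hg1 := (Finset.mem_Icc.mp hg).1
  obtain hemp | ⟨m₀, hm₀⟩ := (T.filter (g * d ∣ ·)).eq_empty_or_nonempty
  · simp [hemp]
  have hsq : Squarefree g := (hTs m₀ (Finset.mem_filter.mp hm₀).1).1.squarefree_of_dvd
    ((Dvd.intro d rfl).trans (Finset.mem_filter.mp hm₀).2)
  refine norm_dual_sum_le hA hQ (hD g) hg1 rfl (h g hg) (X := Y / g) (fun m hm => ?_)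
    (fun m hm => (hTs m (Finset.mem_filter.mp hm).1).2)
    (fun m hm => hTA m (Finset.mem_filter.mp hm).1) a (Finset.notMem_erase 0 s) fun k _ => ?_
  · obtain ⟨hm, hd⟩ := Finset.mem_filter.mp hm
    obtain ⟨p, rfl⟩ : g ∣ m := (Dvd.intro d rfl).trans hd
    exact ⟨Dvd.intro p rfl, Nat.mul_le_mul_left g
      ((Nat.le_div_iff_mul_le hg1).mpr (by rw [mul_comm]; exact (hT _ hm).1)), (hTs _ hm).1⟩
  · have h1 : ‖((ArithmeticFunction.moebius d : ℤ) : ℂ)‖ ≤ 1 := by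
      rw [Complex.norm_intCast]
      exact_mod_cast ArithmeticFunction.abs_moebius_le_one
    have h2 : ‖psiNormFT g k / (g : ℂ) ^ 2‖ ≤ 1 := by
      rw [norm_div, norm_pow, Complex.norm_natCast]
      exact div_le_one_of_le₀ (norm_psiNormFT_le hsq k) (by positivity)
    rw [norm_mul]
    exact mul_le_one₀ h1 (norm_nonneg _) h2

theorem norm_le_of_hasSum_of_norm_sum_le {ι : Type*} {f : ι → ℂ} {T : ℂ} {B : ℝ} (h : HasSum f T)
    (hB : ∀ s : Finset ι, ‖∑ i ∈ s, f i‖ ≤ B) : ‖T‖ ≤ B :=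
  le_of_tendsto (Filter.Tendsto.norm h) (Filter.Eventually.of_forall hB)

theorem exists_sum_exp_norm_le :
    ∃ C : ℝ, 0 ≤ C ∧ ∀ Q : ℝ, 1 ≤ Q → ∀ s : Finset GaussianInt,
      ∑ x ∈ s, Real.exp (-Real.pi * x.norm / Q) ≤ C * Q := by
  have hpos : ∀ Q : ℝ, 0 < Q → ∃ T : ℝ,
      HasSum (fun x : GaussianInt => Real.exp (-Real.pi * x.norm / Q)) T ∧
      HasSum (fun k : GaussianInt => (Q : ℂ) * (gaussFT 1 (fun _ => 1) k *
        ((Real.exp (-Real.pi * Q * k.norm) : ℝ) : ℂ))) T := by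
    intro Q hQ
    obtain ⟨T, h1, h2⟩ := hasSum_poisson hQ le_rfl (f := fun _ => 1) fun _ _ _ => rfl
    have h3 : HasSum (fun x : GaussianInt => ((Real.exp (-Real.pi * x.norm / Q) : ℝ) : ℂ)) T :=
      hasSum_of_forall_eq h1 fun x => (one_mul _).symm
    have h4 := Complex.hasSum_re h3
    simp only [Complex.ofReal_re] at h4
    have h5 : T = (T.re : ℂ) := h3.unique (Complex.hasSum_ofReal.mpr h4)
    refine ⟨T.re, h4, ?_⟩
    rw [← h5]
    refine hasSum_of_forall_eq h2 fun k => ?_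
    simp
  obtain ⟨C, hC, -⟩ := hpos 1 one_pos
  refine ⟨C, hC.nonneg fun _ => (Real.exp_pos _).le, fun Q hQ s => ?_⟩
  have hQ0 : 0 < Q := one_pos.trans_le hQ
  obtain ⟨T, hT1, hT2⟩ := hpos Q hQ0
  refine (sum_le_hasSum s (fun _ _ => (Real.exp_pos _).le) hT1).trans ((le_abs_self T).trans ?_)
  rw [← Real.norm_eq_abs, ← Complex.norm_real]
  refine norm_le_of_hasSum_of_norm_sum_le hT2 fun s => ?_
  refine (norm_sum_le _ _).trans ?_
  calc ∑ k ∈ s, ‖(Q : ℂ) * (gaussFT 1 (fun _ => 1) k *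
        ((Real.exp (-Real.pi * Q * k.norm) : ℝ) : ℂ))‖
      ≤ ∑ k ∈ s, Q * Real.exp (-Real.pi * k.norm / 1) := by
        refine Finset.sum_le_sum fun k _ => ?_
        have h0 : (0 : ℝ) ≤ k.norm := by exact_mod_cast GaussianInt.norm_nonneg k
        have h1 : ‖gaussFT 1 (fun _ => 1) k‖ ≤ 1 := by
          simpa using norm_gaussFT_le (m := 1) (f := fun _ => 1) (by simp) k
        rw [norm_mul, norm_mul, Complex.norm_real, Complex.norm_real, Real.norm_of_nonneg hQ0.le,
          Real.norm_of_nonneg (Real.exp_pos _).le]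
        refine mul_le_mul_of_nonneg_left ?_ hQ0.le
        refine (mul_le_of_le_one_left (Real.exp_pos _).le h1).trans (Real.exp_le_exp.mpr ?_)
        nlinarith [mul_nonneg Real.pi_pos.le h0, mul_nonneg (mul_nonneg Real.pi_pos.le h0)
          (sub_nonneg.mpr hQ)]
    _ = Q * ∑ k ∈ s, Real.exp (-Real.pi * k.norm / 1) := by rw [Finset.mul_sum]
    _ ≤ Q * C := mul_le_mul_of_nonneg_left
        (sum_le_hasSum s (fun _ _ => (Real.exp_pos _).le) hC) hQ0.le
    _ = C * Q := mul_comm _ _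

theorem sum_exp_mul_sq_le {Q W B : ℝ} (hQ : 0 < Q)
    (hW : ∀ s : Finset GaussianInt, ∑ x ∈ s, Real.exp (-Real.pi * x.norm / Q) ≤ W)
    {T : Finset ℕ} (hT : ∀ m ∈ T, Squarefree m ∧ Odd m) (a : ℕ → ℂ)
    (hB : ∀ s : Finset GaussianInt,
      ‖∑ k ∈ s, ∑ m ∈ T, ∑ n ∈ T, if m = n then 0 else a m * conj (a n) * dualTerm Q k m n‖ ≤ B)
    (s : Finset GaussianInt) :
    ∑ x ∈ s, Real.exp (-Real.pi * x.norm / Q) * ‖∑ m ∈ T, a m * psi m x‖ ^ 2 ≤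
      W * ∑ m ∈ T, ‖a m‖ ^ 2 + B := by
  choose! U hU1 hU2 using fun (p : ℕ × ℕ) (hp : p ∈ T ×ˢ T) =>
    hasSum_poisson_psi hQ (hT p.1 (Finset.mem_product.mp hp).1).1
      (hT p.2 (Finset.mem_product.mp hp).2).1 (hT p.1 (Finset.mem_product.mp hp).1).2
      (hT p.2 (Finset.mem_product.mp hp).2).2
  have hU1' : HasSum (fun x : GaussianInt => ∑ m ∈ T, ∑ n ∈ T, a m * conj (a n) *
      (psi m x * conj (psi n x) * ((Real.exp (-Real.pi * x.norm / Q) : ℝ) : ℂ)))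
      (∑ m ∈ T, ∑ n ∈ T, a m * conj (a n) * U (m, n)) :=
    hasSum_sum fun m hm => hasSum_sum fun n hn =>
      (hU1 (m, n) (Finset.mk_mem_product hm hn)).mul_left _
  have hre : HasSum (fun x : GaussianInt =>
      Real.exp (-Real.pi * x.norm / Q) * ‖∑ m ∈ T, a m * psi m x‖ ^ 2)
      (∑ m ∈ T, ∑ n ∈ T, a m * conj (a n) * U (m, n)).re := by
    have h := Complex.hasSum_re hU1'
    have e : ∀ x : GaussianInt, ((Real.exp (-Real.pi * x.norm / Q) *
        ‖∑ m ∈ T, a m * psi m x‖ ^ 2 : ℝ) : ℂ) = ∑ m ∈ T, ∑ n ∈ T, a m * conj (a n) *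
      (psi m x * conj (psi n x) * ((Real.exp (-Real.pi * x.norm / Q) : ℝ) : ℂ)) := by
      intro x
      push_cast
      rw [← Complex.mul_conj', map_sum, Finset.sum_mul_sum, Finset.mul_sum]
      refine Finset.sum_congr rfl fun m _ => ?_
      rw [Finset.mul_sum]
      refine Finset.sum_congr rfl fun n _ => ?_
      rw [map_mul]
      ring
    simp only [← e, Complex.ofReal_re] at h
    exact h
  refine (sum_le_hasSum s (fun x _ => by positivity) hre).trans ((Complex.re_le_norm _).trans ?_)
  have hsplit : ∑ m ∈ T, ∑ n ∈ T, a m * conj (a n) * U (m, n) =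
      ∑ m ∈ T, a m * conj (a m) * U (m, m) +
        ∑ m ∈ T, ∑ n ∈ T, if m = n then 0 else a m * conj (a n) * U (m, n) := by
    rw [← Finset.sum_add_distrib]
    refine Finset.sum_congr rfl fun m hm => ?_
    have : ∀ n ∈ T, a m * conj (a n) * U (m, n) =
        (if m = n then a m * conj (a n) * U (m, n) else 0) +
          if m = n then 0 else a m * conj (a n) * U (m, n) := fun n _ => by split_ifs <;> simp
    rw [Finset.sum_congr rfl this, Finset.sum_add_distrib, Finset.sum_ite_eq, if_pos hm]
  rw [hsplit]
  refine (norm_add_le _ _).trans (add_le_add ?_ ?_)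
  · rw [Finset.mul_sum]
    refine (norm_sum_le _ _).trans (Finset.sum_le_sum fun m hm => ?_)
    rw [Complex.mul_conj', norm_mul, norm_pow, Complex.norm_real, norm_norm, mul_comm]
    refine mul_le_mul_of_nonneg_right ?_ (by positivity)
    refine norm_le_of_hasSum_of_norm_sum_le (hU1 (m, m) (Finset.mk_mem_product hm hm))
      fun s => (norm_sum_le _ _).trans (le_trans (Finset.sum_le_sum fun x _ => ?_) (hW s))
    rw [norm_mul, norm_mul, Complex.norm_real, Real.norm_of_nonneg (Real.exp_pos _).le,
      Complex.norm_conj]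
    exact mul_le_of_le_one_left (Real.exp_pos _).le
      (mul_le_one₀ (norm_psi_le _ _) (norm_nonneg _) (norm_psi_le _ _))
  · refine norm_le_of_hasSum_of_norm_sum_le (f := fun k => ∑ m ∈ T, ∑ n ∈ T,
      if m = n then 0 else a m * conj (a n) * dualTerm Q k m n) ?_ hB
    refine hasSum_sum fun m hm => hasSum_sum fun n hn => ?_
    split_ifs
    · exact hasSum_zero
    · exact (hU2 (m, n) (Finset.mk_mem_product hm hn)).mul_left _

theorem pow_rpow_div {x : ℝ} (hx : 0 ≤ x) (n k : ℕ) {r : ℝ} (h : n * r = k) :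
    (x ^ n) ^ r = x ^ k := by
  rw [← Real.rpow_natCast x n, ← Real.rpow_mul hx, h, Real.rpow_natCast]

theorem dual_main_term_le {A Q g X Z : ℝ} (hA : 0 < A) (hQ : 0 < Q) (hg : 1 ≤ g)
    (hAQ : A ^ 2 ≤ 4 * Q) (hX : X ≤ 9 / 8 * A / g) (hZ : Z = 2 * A ^ 4 / (Q * g ^ 2)) :
    Q * ((g / A) ^ 2 * (Z ^ ((7 : ℝ) / 6) + Z ^ ((2 : ℝ) / 3) * X)) ≤
      11 * (Q ^ ((1 : ℝ) / 3) * A ^ ((5 : ℝ) / 3)) := by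
  have hroot : ∀ (z : ℝ), 0 < z → ∀ n : ℕ, n ≠ 0 → ∃ r : ℝ, 0 < r ∧ z = r ^ n := fun z hz n hn =>
    ⟨z ^ ((n : ℝ)⁻¹), Real.rpow_pos_of_pos hz _, (Real.rpow_inv_natCast_pow hz.le hn).symm⟩
  obtain ⟨x, hx, rfl⟩ := hroot A hA 3 (by norm_num)
  obtain ⟨y, hy, rfl⟩ := hroot Q hQ 6 (by norm_num)
  obtain ⟨h, hh, rfl⟩ := hroot g (one_pos.trans_le hg) 3 (by norm_num)
  have hh1 : 1 ≤ h := by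
    by_contra hlt
    exact absurd hg (not_le.mpr (pow_lt_one₀ hh.le (not_le.mp hlt) (by norm_num)))
  have hxy : x ^ 3 ≤ 2 * y ^ 3 := by
    refine (sq_le_sq₀ (by positivity) (by positivity)).mp ?_
    linarith [hAQ]
  rw [pow_rpow_div hy.le 6 2 (by norm_num), pow_rpow_div hx.le 3 5 (by norm_num)]
  set ζ := x ^ 2 / (y * h) with hζ
  have hζ0 : 0 < ζ := by positivity
  have hZ' : Z = 2 * ζ ^ 6 := by
    rw [hZ, hζ]
    field_simp
  have h2a : (2 : ℝ) ^ ((7 : ℝ) / 6) ≤ 4 :=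
    (Real.rpow_le_rpow_of_exponent_le one_le_two (by norm_num : (7 : ℝ) / 6 ≤ 2)).trans
      (by norm_num)
  have h2b : (2 : ℝ) ^ ((2 : ℝ) / 3) ≤ 2 :=
    (Real.rpow_le_rpow_of_exponent_le one_le_two (by norm_num : (2 : ℝ) / 3 ≤ 1)).trans
      (by norm_num)
  have e1 : Z ^ ((7 : ℝ) / 6) ≤ 4 * ζ ^ 7 := by
    rw [hZ', Real.mul_rpow zero_le_two (by positivity), pow_rpow_div hζ0.le 6 7 (by norm_num)]
    exact mul_le_mul_of_nonneg_right h2a (by positivity)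
  have e2 : Z ^ ((2 : ℝ) / 3) ≤ 2 * ζ ^ 4 := by
    rw [hZ', Real.mul_rpow zero_le_two (by positivity), pow_rpow_div hζ0.le 6 4 (by norm_num)]
    exact mul_le_mul_of_nonneg_right h2b (by positivity)
  have hZ0 : 0 < Z := by rw [hZ']; positivity
  calc y ^ 6 * ((h ^ 3 / x ^ 3) ^ 2 * (Z ^ ((7 : ℝ) / 6) + Z ^ ((2 : ℝ) / 3) * X))
      ≤ y ^ 6 * ((h ^ 3 / x ^ 3) ^ 2 * (4 * ζ ^ 7 + 2 * ζ ^ 4 * (9 / 8 * x ^ 3 / h ^ 3))) := by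
        refine mul_le_mul_of_nonneg_left (mul_le_mul_of_nonneg_left (add_le_add e1 ?_)
          (by positivity)) (by positivity)
        exact (mul_le_mul_of_nonneg_left hX (by positivity)).trans
          (mul_le_mul_of_nonneg_right e2 (by positivity))
    _ = (4 * x ^ 5 / y * x ^ 3 + 9 / 4 * x ^ 5 * y ^ 2) / h := by
        rw [hζ]
        field_simp
        ring
    _ ≤ 4 * x ^ 5 / y * x ^ 3 + 9 / 4 * x ^ 5 * y ^ 2 := div_le_self (by positivity) hh1
    _ ≤ 4 * x ^ 5 / y * (2 * y ^ 3) + 9 / 4 * x ^ 5 * y ^ 2 := by gcongr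
    _ = (8 + 9 / 4) * (y ^ 2 * x ^ 5) := by
        field_simp
        norm_num
    _ ≤ 11 * (y ^ 2 * x ^ 5) := mul_le_mul_of_nonneg_right (by norm_num) (by positivity)

theorem sum_sum_sum_dvd_le {G Y : ℕ} {τ : ℝ} {T : Finset ℕ} {f : ℕ → ℝ} (hf : ∀ m, 0 ≤ f m)
    (hT : ∀ m ∈ T, m ≠ 0 ∧ (m.divisors.card : ℝ) ≤ τ) :
    ∑ g ∈ Finset.Icc 1 G, ∑ d ∈ Finset.Icc 1 Y, ∑ m ∈ T.filter (g * d ∣ ·), f m ≤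
      τ ^ 2 * ∑ m ∈ T, f m := by
  simp only [Finset.sum_filter]
  rw [Finset.sum_congr rfl fun g _ => Finset.sum_comm, Finset.sum_comm, Finset.mul_sum]
  refine Finset.sum_le_sum fun m hm => ?_
  obtain ⟨hm0, hτ⟩ := hT m hm
  rw [← Finset.sum_product', ← Finset.sum_filter, Finset.sum_const, nsmul_eq_mul]
  refine mul_le_mul_of_nonneg_right ?_ (hf m)
  calc _ ≤ (((m.divisors ×ˢ m.divisors).card : ℕ) : ℝ) := by
        refine Nat.cast_le.mpr (Finset.card_le_card fun p hp => ?_)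
        have := (Finset.mem_filter.mp hp).2
        exact Finset.mem_product.mpr ⟨Nat.mem_divisors.mpr ⟨(Dvd.intro _ rfl).trans this, hm0⟩,
          Nat.mem_divisors.mpr ⟨(Dvd.intro_left _ rfl).trans this, hm0⟩⟩
    _ ≤ τ ^ 2 := by
        rw [Finset.card_product, Nat.cast_mul, sq]
        exact mul_le_mul hτ hτ (by positivity) ((Nat.cast_nonneg _).trans hτ)

theorem exists_poisson_bound
    (h : ∀ ε : ℝ, 0 < ε → ∃ K : ℝ, 0 ≤ K ∧ ∀ X N : ℕ, 1 ≤ X → 1 ≤ N →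
      LargeSieve ((gaussBall N).erase 0) oddPsi X
        (K * ((X : ℝ) * N) ^ ε * ((N : ℝ) ^ ((7 : ℝ) / 6) + (N : ℝ) ^ ((2 : ℝ) / 3) * X)))
    {ε : ℝ} (hε : 0 < ε) :
    ∃ C : ℝ, 0 ≤ C ∧ ∀ (M Q : ℕ) (A : ℝ), 1 ≤ M → M ^ 2 ≤ Q → 0 < A → A ≤ 2 * M →
      ∀ T : Finset ℕ, (∀ m ∈ T, Squarefree m ∧ Odd m) →
        (∀ m ∈ T, A ≤ m ∧ (m : ℝ) ≤ 9 / 8 * A) → ∀ (a : ℕ → ℂ) (s : Finset GaussianInt),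
        ∑ x ∈ s, Real.exp (-Real.pi * x.norm / Q) * ‖∑ m ∈ T, a m * psi m x‖ ^ 2 ≤
          C * ((Q : ℝ) * M) ^ ε * ((Q : ℝ) + (Q : ℝ) ^ ((1 : ℝ) / 3) * (M : ℝ) ^ ((5 : ℝ) / 3)) *
            ∑ m ∈ T, ‖a m‖ ^ 2 := by
  set δ := min ε 1 / 7 with hδ
  have hδ0 : 0 < δ := by positivity
  have hδ1 : δ ≤ 1 := by
    rw [hδ]; linarith [min_le_right ε 1]
  have hδε : 7 * δ ≤ ε := by
    rw [hδ]; linarith [min_le_left ε 1]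
  obtain ⟨K, hK0, hK⟩ := h δ hδ0
  obtain ⟨κ, hκ0, hκ⟩ := exists_exp_weight_lattice_le
  obtain ⟨W, hW0, hW⟩ := exists_sum_exp_norm_le
  obtain ⟨Cd, hCd1, hCd⟩ := exists_card_divisors_le δ hδ0
  have hCd0 : 0 ≤ Cd := zero_le_one.trans hCd1
  refine ⟨W + 85536 * (κ * K * Cd ^ 2), by positivity,
    fun M Q A hM hMQ hA hAM T hTs hTA a s => ?_⟩
  have hM1 : (1 : ℝ) ≤ M := by exact_mod_cast hM
  have hQ1 : (1 : ℝ) ≤ Q := by exact_mod_cast (Nat.one_le_pow 2 M hM).trans hMQ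
  have hQ0 : (0 : ℝ) < Q := one_pos.trans_le hQ1
  have hMQ' : (M : ℝ) ^ 2 ≤ Q := by exact_mod_cast hMQ
  set t : ℝ := (M : ℝ) ^ δ with ht
  have ht1 : 1 ≤ t := Real.one_le_rpow hM1 hδ0.le
  have ht0 : 0 < t := one_pos.trans_le ht1
  set S := ∑ m ∈ T, ‖a m‖ ^ 2 with hS
  have hS0 : 0 ≤ S := Finset.sum_nonneg fun _ _ => by positivity
  set Y := ⌊9 / 8 * A⌋₊ with hY
  set G := ⌊A / 8⌋₊ with hG
  have hYA : (Y : ℝ) ≤ 9 / 8 * A := Nat.floor_le (by positivity)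
  have hGY : G ≤ Y := Nat.floor_le_floor (by linarith)
  have hTG : ∀ m ∈ T, m ≤ Y ∧ G < m := by
    intro m hm
    obtain ⟨h1, h2⟩ := hTA m hm
    refine ⟨Nat.le_floor h2, ?_⟩
    rw [hG, Nat.floor_lt (by positivity)]
    linarith
  have hgcd : ∀ m ∈ T, ∀ n ∈ T, m ≠ n → m.gcd n ≤ G := by
    have key : ∀ m ∈ T, ∀ n ∈ T, m < n → m.gcd n ≤ G := by
      intro m hm n hn hmn
      have h1 : m.gcd n ∣ n - m := Nat.dvd_sub (Nat.gcd_dvd_right m n) (Nat.gcd_dvd_left m n)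
      have h2 : m.gcd n ≤ n - m := Nat.le_of_dvd (Nat.sub_pos_of_lt hmn) h1
      refine Nat.le_floor ?_
      have h3 : ((m.gcd n : ℕ) : ℝ) ≤ n - m := by
        rw [← Nat.cast_sub hmn.le]
        exact_mod_cast h2
      linarith [(hTA m hm).1, (hTA n hn).2]
    intro m hm n hn hmn
    rcases lt_or_gt_of_ne hmn with hlt | hlt
    · exact key m hm n hn hlt
    · rw [Nat.gcd_comm]
      exact key n hn m hm hlt
  set Z : ℕ → ℝ := fun g => 2 * A ^ 4 / (Q * g ^ 2) with hZ
  set D : ℕ → ℝ := fun g => κ * (K * (((Y / g : ℕ) : ℝ) * Z g) ^ δ *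
    ((Z g) ^ ((7 : ℝ) / 6) + (Z g) ^ ((2 : ℝ) / 3) * ((Y / g : ℕ) : ℝ))) with hD
  have hZ0 : ∀ g, 0 ≤ Z g := fun g => by positivity
  have hD0 : ∀ g, 0 ≤ D g := by
    intro g
    have := hZ0 g
    positivity
  have hoff := norm_sum_dualTerm_le hA hQ0 hD0 (G := G) (Y := Y) (fun g hg s hs b => by
      obtain ⟨hg1, hgG⟩ := Finset.mem_Icc.mp hg
      have hX1 : 1 ≤ Y / g := (Nat.one_le_div_iff hg1).mpr (hgG.trans hGY)
      have hg0 : (0 : ℝ) < g := by exact_mod_cast hg1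
      exact hκ K δ hK0 hδ0 hδ1 (Y / g) hX1 (fun N hN => hK (Y / g) N hX1 hN) (Z g) (by positivity)
        s hs b) hTG hTs hTA hgcd a
  have hoff' : ∀ s : Finset GaussianInt,
      ‖∑ k ∈ s, ∑ m ∈ T, ∑ n ∈ T, if m = n then 0 else a m * conj (a n) * dualTerm Q k m n‖ ≤
        85536 * (κ * K * Cd ^ 2) * t ^ 7 * ((Q : ℝ) ^ ((1 : ℝ) / 3) * (M : ℝ) ^ ((5 : ℝ) / 3)) *
          S := by
    intro s
    refine (hoff s).trans ?_
    set E := 3 * (κ * (K * (72 * t ^ 5)) *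
      (11 * ((Q : ℝ) ^ ((1 : ℝ) / 3) * (4 * (M : ℝ) ^ ((5 : ℝ) / 3))))) with hE
    have hterm : ∀ g ∈ Finset.Icc 1 G, ∀ B : ℝ, 0 ≤ B →
        Q * (3 * (D g * ((g / A) ^ 2 * B))) ≤ E * B := by
      intro g hg B hB
      have hg1 : (1 : ℝ) ≤ g := by exact_mod_cast (Finset.mem_Icc.mp hg).1
      have hg0 : (0 : ℝ) < g := one_pos.trans_le hg1
      have hX : ((Y / g : ℕ) : ℝ) ≤ 9 / 8 * A / g :=
        Nat.cast_div_le.trans (div_le_div_of_nonneg_right hYA hg0.le)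
      have hX' : ((Y / g : ℕ) : ℝ) ≤ 9 / 8 * (2 * M) :=
        hX.trans ((div_le_self (by positivity) hg1).trans (by linarith))
      have hZ' : Z g ≤ 2 * (2 * M) ^ 4 := by
        refine (div_le_self (by positivity) (one_le_mul_of_one_le_of_one_le hQ1
          (one_le_pow₀ hg1))).trans ?_
        gcongr
      have hXZ : (((Y / g : ℕ) : ℝ) * Z g) ^ δ ≤ 72 * t ^ 5 := by
        have e1 : ((Y / g : ℕ) : ℝ) * Z g ≤ 72 * (M : ℝ) ^ 5 :=
          (mul_le_mul hX' hZ' (hZ0 g) (by positivity)).trans (by nlinarith)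
        refine (Real.rpow_le_rpow (mul_nonneg (by positivity) (hZ0 g)) e1 hδ0.le).trans ?_
        rw [Real.mul_rpow (by norm_num) (by positivity)]
        refine mul_le_mul ?_ (le_of_eq ?_) (by positivity) (by norm_num)
        · exact (Real.rpow_le_rpow_of_exponent_le (by norm_num) hδ1).trans (by norm_num)
        · rw [ht, ← Real.rpow_natCast, ← Real.rpow_natCast, ← Real.rpow_mul (by positivity),
            ← Real.rpow_mul (by positivity), mul_comm]
      have hmain := dual_main_term_le hA hQ0 hg1 (by nlinarith) hX (rfl : Z g = Z g)
      have hA53 : A ^ ((5 : ℝ) / 3) ≤ 4 * (M : ℝ) ^ ((5 : ℝ) / 3) := by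
        refine (Real.rpow_le_rpow hA.le hAM (by norm_num)).trans ?_
        rw [Real.mul_rpow (by norm_num) (by positivity)]
        refine mul_le_mul_of_nonneg_right ?_ (by positivity)
        exact (Real.rpow_le_rpow_of_exponent_le one_le_two
          (by norm_num : (5 : ℝ) / 3 ≤ 2)).trans (by norm_num)
      have hZg := hZ0 g
      calc Q * (3 * (D g * ((g / A) ^ 2 * B)))
          = 3 * (κ * (K * (((Y / g : ℕ) : ℝ) * Z g) ^ δ) * (Q * ((g / A) ^ 2 *
            ((Z g) ^ ((7 : ℝ) / 6) + (Z g) ^ ((2 : ℝ) / 3) * ((Y / g : ℕ) : ℝ))))) * B := by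
            rw [hD]; ring
        _ ≤ E * B := by
            rw [hE]
            refine mul_le_mul_of_nonneg_right (mul_le_mul_of_nonneg_left (mul_le_mul
              (mul_le_mul_of_nonneg_left (mul_le_mul_of_nonneg_left hXZ hK0) hκ0)
              (hmain.trans (mul_le_mul_of_nonneg_left (mul_le_mul_of_nonneg_left hA53
                (by positivity)) (by norm_num))) (by positivity) (by positivity))
              (by norm_num)) hB
    have hE0 : 0 ≤ E := by positivity
    calc _ ≤ ∑ g ∈ Finset.Icc 1 G, ∑ d ∈ Finset.Icc 1 Y,
          E * ∑ m ∈ T.filter (g * d ∣ ·), ‖a m‖ ^ 2 := by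
          rw [Finset.mul_sum]
          refine Finset.sum_le_sum fun g hg => ?_
          rw [Finset.mul_sum]
          exact Finset.sum_le_sum fun d _ =>
            hterm g hg _ (Finset.sum_nonneg fun _ _ => by positivity)
      _ = E * ∑ g ∈ Finset.Icc 1 G, ∑ d ∈ Finset.Icc 1 Y,
          ∑ m ∈ T.filter (g * d ∣ ·), ‖a m‖ ^ 2 := by
          simp only [Finset.mul_sum]
      _ ≤ E * ((Cd * (3 * t)) ^ 2 * S) := by
          refine mul_le_mul_of_nonneg_left (sum_sum_sum_dvd_le (fun _ => by positivity)
            fun m hm => ?_) hE0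
          have hm0 : m ≠ 0 := (hTs m hm).1.ne_zero
          refine ⟨hm0, (hCd m hm0).trans (mul_le_mul_of_nonneg_left ?_ hCd0)⟩
          have h1 : (m : ℝ) ≤ 3 * M := by linarith [(hTA m hm).2]
          refine (Real.rpow_le_rpow (by positivity) h1 hδ0.le).trans ?_
          rw [Real.mul_rpow (by norm_num) (by positivity)]
          refine mul_le_mul_of_nonneg_right ?_ ht0.le
          exact (Real.rpow_le_rpow_of_exponent_le (by norm_num) hδ1).trans (by norm_num)
      _ = _ := by
          rw [hE]
          ring
  refine (sum_exp_mul_sq_le hQ0 (W := W * Q) (hW Q hQ1) hTs a hoff' s).trans ?_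
  have hE7 : t ^ 7 ≤ ((Q : ℝ) * M) ^ ε := by
    rw [ht, ← Real.rpow_natCast, ← Real.rpow_mul (by positivity)]
    refine (Real.rpow_le_rpow_of_exponent_le hM1 (?_ : δ * (7 : ℕ) ≤ ε)).trans
      (Real.rpow_le_rpow (by positivity) (le_mul_of_one_le_left (by positivity) hQ1) hε.le)
    push_cast
    linarith
  have hE1 : 1 ≤ ((Q : ℝ) * M) ^ ε := (one_le_pow₀ ht1).trans hE7
  set H := ((Q : ℝ) * M) ^ ε with hH
  set V := (Q : ℝ) ^ ((1 : ℝ) / 3) * (M : ℝ) ^ ((5 : ℝ) / 3) with hV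
  have hV0 : 0 ≤ V := by positivity
  set c := 85536 * (κ * K * Cd ^ 2) with hc
  have hc0 : 0 ≤ c := by positivity
  have f1 : W * Q * S ≤ W * H * Q * S := by
    refine mul_le_mul_of_nonneg_right (mul_le_mul_of_nonneg_right ?_ hQ0.le) hS0
    exact le_mul_of_one_le_right hW0 hE1
  have f2 : c * t ^ 7 * V * S ≤ c * H * V * S := by gcongr
  have f3 : 0 ≤ W * H * V * S := by positivity
  have f4 : 0 ≤ c * H * Q * S := by positivity
  linarith

theorem injOn_jacobiGauss (Y : ℕ) :
    Set.InjOn (fun i : Σ q : ℕ, DirichletCharacter ℂ q => jacobiGauss i.2) (quarticFamily Y) := by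
  rintro ⟨q, χ⟩ hi ⟨q', χ'⟩ hi' h
  obtain ⟨h1, -, h3⟩ := mem_quarticFamily.mp hi
  obtain ⟨h1', -, h3'⟩ := mem_quarticFamily.mp hi'
  simp only at h1 h3 h1' h3' h
  have : NeZero q := ⟨Nat.one_le_iff_ne_zero.mp h1⟩
  have : NeZero q' := ⟨Nat.one_le_iff_ne_zero.mp h1'⟩
  have hn := h3.norm_jacobiGauss
  rw [h, h3'.norm_jacobiGauss] at hn
  obtain rfl : q' = q := by exact_mod_cast hn
  exact congrArg (Sigma.mk q') (h3.eq_of_jacobiGauss_eq h3' h)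

theorem norm_sum_psi_jacobiGauss {T : Finset ℕ} (hT : ∀ m ∈ T, Squarefree m ∧ Odd m) {r : ℕ}
    (hr : ∀ m ∈ T, m % 4 = r) (b : ℕ → ℂ) {Y : ℕ} {i : Σ q : ℕ, DirichletCharacter ℂ q}
    (hi : i ∈ quarticFamily Y) :
    ‖∑ m ∈ T, b m * psi m (jacobiGauss i.2)‖ = ‖∑ m ∈ T, b m * charEval i m‖ := by
  obtain ⟨h1, -, h3⟩ := mem_quarticFamily.mp hi
  have : NeZero i.1 := ⟨Nat.one_le_iff_ne_zero.mp h1⟩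
  have hu : ‖(if r = 1 then 1 else i.2 (-1) : ℂ)‖ = 1 := by
    split_ifs
    · exact norm_one
    · have hss : i.2 (-1) * i.2 (-1) = 1 := by rw [← map_mul]; simp
      have := congrArg norm hss
      rw [norm_mul, norm_one] at this
      nlinarith [norm_nonneg (i.2 (-1))]
  have e : ∑ m ∈ T, b m * psi m (jacobiGauss i.2) =
      (∑ m ∈ T, b m * charEval i m) * if r = 1 then 1 else i.2 (-1) := by
    rw [Finset.sum_mul]
    refine Finset.sum_congr rfl fun m hm => ?_
    rw [h3.psi_jacobiGauss (hT m hm).2 (hT m hm).1, hr m hm, charEval, mul_assoc]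
  rw [e, norm_mul, hu, mul_one]

theorem sum_norm_charEval_sq_le_of_exp_weight {T : Finset ℕ}
    (hT : ∀ m ∈ T, Squarefree m ∧ Odd m) {r : ℕ} (hr : ∀ m ∈ T, m % 4 = r) {b : ℕ → ℂ} {Q : ℕ}
    (hQ : 1 ≤ Q) {B : ℝ}
    (hB : ∀ s : Finset GaussianInt,
      ∑ x ∈ s, Real.exp (-Real.pi * x.norm / Q) * ‖∑ m ∈ T, b m * psi m x‖ ^ 2 ≤ B) :
    ∑ i ∈ quarticFamily (2 * Q), ‖∑ m ∈ T, b m * charEval i m‖ ^ 2 ≤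
      Real.exp (2 * Real.pi) * B := by
  have h := hB ((quarticFamily (2 * Q)).image fun i => jacobiGauss i.2)
  rw [Finset.sum_image (injOn_jacobiGauss _)] at h
  refine le_trans ?_ (mul_le_mul_of_nonneg_left h (Real.exp_pos _).le)
  rw [Finset.mul_sum]
  refine Finset.sum_le_sum fun i hi => ?_
  rw [norm_sum_psi_jacobiGauss hT hr b hi, ← mul_assoc, ← Real.exp_add]
  refine le_mul_of_one_le_left (by positivity) (Real.one_le_exp ?_)
  obtain ⟨h1, h2, h3⟩ := mem_quarticFamily.mp hi
  have : NeZero i.1 := ⟨Nat.one_le_iff_ne_zero.mp h1⟩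
  rw [h3.norm_jacobiGauss]
  have hQ0 : (0 : ℝ) < Q := by exact_mod_cast hQ
  have h4 : (i.1 : ℝ) ≤ 2 * Q := by exact_mod_cast h2
  have h5 : (i.1 : ℝ) / Q ≤ 2 := by rwa [div_le_iff₀ hQ0]
  push_cast
  rw [neg_mul, neg_div, mul_div_assoc]
  nlinarith [Real.pi_pos]

theorem sum_norm_charEval_sq_le_of_residue {M Q : ℕ} (hM : 1 ≤ M) (hQ : 1 ≤ Q) {H : ℝ}
    (hH : ∀ A : ℝ, 0 < A → A ≤ 2 * M → ∀ T : Finset ℕ, (∀ m ∈ T, Squarefree m ∧ Odd m) →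
      (∀ m ∈ T, A ≤ m ∧ (m : ℝ) ≤ 9 / 8 * A) → ∀ (a : ℕ → ℂ) (s : Finset GaussianInt),
      ∑ x ∈ s, Real.exp (-Real.pi * x.norm / Q) * ‖∑ m ∈ T, a m * psi m x‖ ^ 2 ≤
        H * ∑ m ∈ T, ‖a m‖ ^ 2) {r c : ℕ} (hc8 : 8 ≤ c) (hc16 : c ≤ 16) {T : Finset ℕ}
    (hT : ∀ m ∈ T, Squarefree m ∧ m % 8 = r ∧ 8 * m / M = c) (a : ℕ → ℂ) :
    ∑ i ∈ quarticFamily (2 * Q), ‖∑ m ∈ T, a m * charEval i m‖ ^ 2 ≤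
      Real.exp (2 * Real.pi) * (H * ∑ m ∈ T, ‖a m‖ ^ 2) := by
  have hM0 : (0 : ℝ) < M := by exact_mod_cast hM
  have hc8' : (8 : ℝ) ≤ c := by exact_mod_cast hc8
  have hc16' : (c : ℝ) ≤ 16 := by exact_mod_cast hc16
  have hbounds : ∀ m ∈ T, (M : ℝ) * c ≤ 8 * m ∧ (8 : ℝ) * m ≤ 9 / 8 * (M * c) := by
    intro m hm
    obtain ⟨-, -, h⟩ := hT m hm
    have h1 : M * c ≤ 8 * m := by rw [← h]; exact Nat.mul_div_le _ _
    have h2 : 8 * m < M * (c + 1) := by rw [← h]; exact Nat.lt_mul_div_succ _ hM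
    have h1' : (M : ℝ) * c ≤ 8 * m := by exact_mod_cast h1
    have h2' : (8 : ℝ) * m < M * (c + 1) := by exact_mod_cast h2
    exact ⟨h1', by nlinarith⟩
  by_cases hr : Odd r
  · have hodd : ∀ m ∈ T, Squarefree m ∧ Odd m := fun m hm => by
      obtain ⟨h1, h2, -⟩ := hT m hm
      exact ⟨h1, by rw [Nat.odd_iff] at hr ⊢; lia⟩
    refine sum_norm_charEval_sq_le_of_exp_weight hodd (r := r % 4)
      (fun m hm => by have := (hT m hm).2.1; lia) hQ
      (hH (M * c / 8) (by positivity) (by nlinarith) T hodd (fun m hm => ?_) a)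
    have := hbounds m hm
    constructor <;> linarith
  · rw [Nat.not_odd_iff_even, Nat.even_iff] at hr
    have heven : ∀ m ∈ T, 2 ∣ m := fun m hm => by
      have := (hT m hm).2.1
      lia
    have hinj : Set.InjOn (fun m => m / 2) (T : Set ℕ) := fun m hm n hn h => by
      have h1 := heven m hm
      have h2 := heven n hn
      simp only at h
      lia
    set P := T.image fun m => m / 2 with hP
    have hPT : ∀ {E : Type} [AddCommMonoid E] (f : ℕ → E), ∑ p ∈ P, f (2 * p) = ∑ m ∈ T, f m := by
      intro E _ f
      rw [hP, Finset.sum_image hinj]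
      exact Finset.sum_congr rfl fun m hm => by rw [Nat.mul_div_cancel' (heven m hm)]
    have hmem : ∀ p ∈ P, 2 * p ∈ T := by
      intro p hp
      obtain ⟨m, hm, rfl⟩ := Finset.mem_image.mp hp
      rwa [Nat.mul_div_cancel' (heven m hm)]
    have hodd : ∀ p ∈ P, Squarefree p ∧ Odd p := by
      intro p hp
      have h1 := (hT _ (hmem p hp)).1
      refine ⟨h1.squarefree_of_dvd (Dvd.intro_left 2 rfl), ?_⟩
      exact Nat.coprime_two_left.mp (Nat.coprime_of_squarefree_mul h1)
    have key := sum_norm_charEval_sq_le_of_exp_weight hodd (r := r / 2 % 4)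
      (fun p hp => by have := (hT _ (hmem p hp)).2.1; lia) hQ
      (hH (M * c / 16) (by positivity) (by nlinarith) P hodd (fun p hp => by
        have := hbounds _ (hmem p hp)
        push_cast at this
        constructor <;> linarith) fun p => a (2 * p))
    rw [hPT fun m => ‖a m‖ ^ 2] at key
    refine (Finset.sum_le_sum fun i _ => ?_).trans key
    refine pow_le_pow_left₀ (norm_nonneg _) ?_ 2
    rw [← hPT fun m => a m * charEval i m]
    have e : ∑ p ∈ P, a (2 * p) * charEval i (2 * p) =
        charEval i 2 * ∑ p ∈ P, a (2 * p) * charEval i p := by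
      rw [Finset.mul_sum]
      refine Finset.sum_congr rfl fun p _ => ?_
      rw [charEval_mul]
      ring
    rw [e, norm_mul]
    exact mul_le_of_le_one_left (norm_nonneg _) (norm_charEval_le i 2)

theorem sum_norm_charEval_sq_le_of_psi {M Q : ℕ} (hM : 1 ≤ M) (hQ : 1 ≤ Q) {H : ℝ}
    (hH : ∀ A : ℝ, 0 < A → A ≤ 2 * M → ∀ T : Finset ℕ, (∀ m ∈ T, Squarefree m ∧ Odd m) →
      (∀ m ∈ T, A ≤ m ∧ (m : ℝ) ≤ 9 / 8 * A) → ∀ (a : ℕ → ℂ) (s : Finset GaussianInt),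
      ∑ x ∈ s, Real.exp (-Real.pi * x.norm / Q) * ‖∑ m ∈ T, a m * psi m x‖ ^ 2 ≤
        H * ∑ m ∈ T, ‖a m‖ ^ 2) (a : ℕ → ℂ) :
    ∑ i ∈ quarticFamily (2 * Q),
      ‖∑ m ∈ (Finset.Ioc M (2 * M)).filter Squarefree, a m * charEval i m‖ ^ 2 ≤
      72 * Real.exp (2 * Real.pi) * H *
        ∑ m ∈ (Finset.Ioc M (2 * M)).filter Squarefree, ‖a m‖ ^ 2 := by
  set T := (Finset.Ioc M (2 * M)).filter Squarefree with hT
  set κ : ℕ → ℕ × ℕ := fun m => (m % 8, 8 * m / M) with hκ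
  set C := Finset.range 8 ×ˢ Finset.Icc 8 16 with hC
  have hmaps : ∀ m ∈ T, κ m ∈ C := by
    intro m hm
    obtain ⟨hm1, hm2⟩ := Finset.mem_Ioc.mp (Finset.mem_filter.mp hm).1
    refine Finset.mem_product.mpr ⟨Finset.mem_range.mpr (Nat.mod_lt _ (by norm_num)),
      Finset.mem_Icc.mpr ⟨(Nat.le_div_iff_mul_le hM).mpr (by lia), ?_⟩⟩
    exact Nat.div_le_of_le_mul (by lia)
  have hcard : (C.card : ℝ) = 72 := by
    rw [hC, Finset.card_product]
    norm_num
  calc ∑ i ∈ quarticFamily (2 * Q), ‖∑ m ∈ T, a m * charEval i m‖ ^ 2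
      ≤ ∑ i ∈ quarticFamily (2 * Q),
          72 * ∑ p ∈ C, ‖∑ m ∈ T.filter (κ · = p), a m * charEval i m‖ ^ 2 := by
        refine Finset.sum_le_sum fun i _ => ?_
        rw [← Finset.sum_fiberwise_of_maps_to hmaps, ← hcard]
        exact (pow_le_pow_left₀ (norm_nonneg _) (norm_sum_le _ _) 2).trans
          sq_sum_le_card_mul_sum_sq
    _ = 72 * ∑ p ∈ C, ∑ i ∈ quarticFamily (2 * Q),
          ‖∑ m ∈ T.filter (κ · = p), a m * charEval i m‖ ^ 2 := by
        rw [← Finset.mul_sum, Finset.sum_comm]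
    _ ≤ 72 * ∑ p ∈ C, Real.exp (2 * Real.pi) * (H * ∑ m ∈ T.filter (κ · = p), ‖a m‖ ^ 2) := by
        refine mul_le_mul_of_nonneg_left (Finset.sum_le_sum fun p hp => ?_) (by norm_num)
        have hp2 := Finset.mem_Icc.mp (Finset.mem_product.mp hp).2
        refine sum_norm_charEval_sq_le_of_residue hM hQ hH (r := p.1) (c := p.2) hp2.1 hp2.2
          (fun m hm => ?_) a
        obtain ⟨h1, h2⟩ := Finset.mem_filter.mp hm
        exact ⟨(Finset.mem_filter.mp h1).2, congrArg Prod.fst h2, congrArg Prod.snd h2⟩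
    _ = _ := by
        rw [← Finset.mul_sum, ← Finset.mul_sum, Finset.sum_fiberwise_of_maps_to hmaps]
        ring

theorem sum_ioc_le_of_largeSieve {M Q : ℕ} {B : ℝ}
    (h : LargeSieve (quarticFamily (2 * Q)) charEval (2 * M) B) (a : ℕ → ℂ) :
    ∑ i ∈ quarticFamily (2 * Q),
      ‖∑ m ∈ (Finset.Ioc M (2 * M)).filter Squarefree, a m * charEval i m‖ ^ 2 ≤
      B * ∑ m ∈ (Finset.Ioc M (2 * M)).filter Squarefree, ‖a m‖ ^ 2 := by
  have hset : (squarefreeUpTo (2 * M)).filter (M < ·) =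
      (Finset.Ioc M (2 * M)).filter Squarefree := by
    ext m
    rw [Finset.mem_filter, mem_squarefreeUpTo, Finset.mem_filter, Finset.mem_Ioc]
    constructor
    · rintro ⟨⟨⟨h1, h2⟩, h3⟩, h4⟩
      exact ⟨⟨h4, h2⟩, h3⟩
    · rintro ⟨⟨h1, h2⟩, h3⟩
      exact ⟨⟨⟨by lia, h2⟩, h3⟩, h1⟩
  have key := h fun m => if M < m then a m else 0
  rw [← hset]
  simp only [Finset.sum_filter]
  refine le_trans (Finset.sum_le_sum fun i _ => le_of_eq ?_) (key.trans (le_of_eq ?_))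
  · congr 2
    refine Finset.sum_congr rfl fun m _ => ?_
    split_ifs <;> simp
  · congr 1
    refine Finset.sum_congr rfl fun m _ => ?_
    split_ifs <;> simp

theorem quartSieveSum_le_sum_quarticFamily {Q M : ℕ} (a : ℕ → ℂ) :
    quartSieveSum Q M a ≤ ∑ i ∈ quarticFamily (2 * Q),
      ‖∑ m ∈ (Finset.Ioc M (2 * M)).filter Squarefree, a m * charEval i m‖ ^ 2 := by
  rw [quartSieveSum_eq, quarticFamily, Finset.sum_sigma]
  refine Finset.sum_le_sum_of_subset_of_nonneg (fun q hq => ?_)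
    fun _ _ _ => Finset.sum_nonneg fun _ _ => by positivity
  rw [Finset.mem_Ioc] at hq
  rw [Finset.mem_Icc]
  lia

theorem dyadic_bound_le {Q M : ℕ} {K ε α β : ℝ} (hK : 0 ≤ K) (hα : α ≤ 2) (hβ : β ≤ 2) :
    K * (((2 * M : ℕ) : ℝ) * (2 * Q : ℕ)) ^ ε *
        (((2 * Q : ℕ) : ℝ) ^ α + ((2 * Q : ℕ) : ℝ) ^ β * (2 * M : ℕ)) ≤
      8 * 4 ^ ε * K * ((Q : ℝ) * M) ^ ε * ((Q : ℝ) ^ α + (Q : ℝ) ^ β * M) := by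
  have h2 : ∀ γ : ℝ, γ ≤ 2 → ((2 * Q : ℕ) : ℝ) ^ γ ≤ 4 * (Q : ℝ) ^ γ := by
    intro γ hγ
    rw [Nat.cast_mul, Real.mul_rpow (by positivity) (by positivity)]
    refine mul_le_mul_of_nonneg_right ?_ (by positivity)
    exact (Real.rpow_le_rpow_of_exponent_le (by norm_num) hγ).trans (by norm_num)
  have e1 : (((2 * M : ℕ) : ℝ) * (2 * Q : ℕ)) ^ ε = 4 ^ ε * ((Q : ℝ) * M) ^ ε := by
    rw [← Real.mul_rpow (by norm_num) (by positivity)]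
    congr 1
    push_cast
    ring
  have e2 : ((2 * Q : ℕ) : ℝ) ^ α + ((2 * Q : ℕ) : ℝ) ^ β * (2 * M : ℕ) ≤
      8 * ((Q : ℝ) ^ α + (Q : ℝ) ^ β * M) := by
    have h3 : ((2 * Q : ℕ) : ℝ) ^ β * (2 * M : ℕ) ≤ 4 * (Q : ℝ) ^ β * (2 * M : ℕ) :=
      mul_le_mul_of_nonneg_right (h2 β hβ) (by positivity)
    have h4 : (0 : ℝ) ≤ (Q : ℝ) ^ α := by positivity
    have h5 := h2 α hα
    push_cast at h3 h5 ⊢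
    linarith
  rw [e1]
  calc _ ≤ K * (4 ^ ε * ((Q : ℝ) * M) ^ ε) * (8 * ((Q : ℝ) ^ α + (Q : ℝ) ^ β * M)) :=
        mul_le_mul_of_nonneg_left e2 (by positivity)
    _ = _ := by ring

theorem cube_bound_le_of_le_sq {Q M : ℕ} (h : Q ≤ M ^ 2) :
    (Q : ℝ) ^ ((7 : ℝ) / 6) + (Q : ℝ) ^ ((2 : ℝ) / 3) * M ≤
      2 * ((Q : ℝ) ^ ((1 : ℝ) / 3) * (M : ℝ) ^ ((5 : ℝ) / 3)) := by
  have hQM : (Q : ℝ) ≤ (M : ℝ) ^ (2 : ℝ) := by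
    rw [Real.rpow_two]
    exact_mod_cast h
  have hQ0 : (0 : ℝ) ≤ Q := Nat.cast_nonneg Q
  have hM0 : (0 : ℝ) ≤ M := Nat.cast_nonneg M
  have h1 : (Q : ℝ) ^ ((5 : ℝ) / 6) ≤ (M : ℝ) ^ ((5 : ℝ) / 3) := by
    refine (Real.rpow_le_rpow hQ0 hQM (by norm_num)).trans (le_of_eq ?_)
    rw [← Real.rpow_mul hM0]
    norm_num
  have h2 : (Q : ℝ) ^ ((1 : ℝ) / 3) * M ≤ (M : ℝ) ^ ((5 : ℝ) / 3) := by
    refine (mul_le_mul_of_nonneg_right (Real.rpow_le_rpow hQ0 hQM (by norm_num)) hM0).trans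
      (le_of_eq ?_)
    rw [← Real.rpow_mul hM0]
    nth_rewrite 2 [← Real.rpow_one (M : ℝ)]
    rw [← Real.rpow_add_of_nonneg hM0 (by norm_num) (by norm_num)]
    norm_num
  have e1 : (Q : ℝ) ^ ((7 : ℝ) / 6) = (Q : ℝ) ^ ((1 : ℝ) / 3) * (Q : ℝ) ^ ((5 : ℝ) / 6) := by
    rw [← Real.rpow_add_of_nonneg hQ0 (by norm_num) (by norm_num)]
    norm_num
  have e2 : (Q : ℝ) ^ ((2 : ℝ) / 3) = (Q : ℝ) ^ ((1 : ℝ) / 3) * (Q : ℝ) ^ ((1 : ℝ) / 3) := by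
    rw [← Real.rpow_add_of_nonneg hQ0 (by norm_num) (by norm_num)]
    norm_num
  rw [e1, e2, mul_assoc, two_mul]
  gcongr

theorem exists_quarticFamily_bound_dual
    (h : ∀ ε : ℝ, 0 < ε → ∃ K : ℝ, 0 ≤ K ∧ ∀ X Y : ℕ, 1 ≤ X → 1 ≤ Y →
      LargeSieve (quarticFamily Y) charEval X
        (K * ((X : ℝ) * Y) ^ ε * ((Y : ℝ) ^ ((7 : ℝ) / 6) + (Y : ℝ) ^ ((2 : ℝ) / 3) * X)))
    {ε : ℝ} (hε : 0 < ε) :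
    ∃ K : ℝ, 0 ≤ K ∧ ∀ M Q : ℕ, 1 ≤ M → 1 ≤ Q → ∀ a : ℕ → ℂ,
      ∑ i ∈ quarticFamily (2 * Q),
        ‖∑ m ∈ (Finset.Ioc M (2 * M)).filter Squarefree, a m * charEval i m‖ ^ 2 ≤
      K * ((Q : ℝ) * M) ^ ε * ((Q : ℝ) + (Q : ℝ) ^ ((1 : ℝ) / 3) * (M : ℝ) ^ ((5 : ℝ) / 3)) *
        ∑ m ∈ (Finset.Ioc M (2 * M)).filter Squarefree, ‖a m‖ ^ 2 := by
  obtain ⟨C, hC0, hC⟩ := exists_poisson_bound (fun ε hε => exists_largeSieve_lattice h hε) hε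
  obtain ⟨K, hK0, hK⟩ := h ε hε
  refine ⟨72 * Real.exp (2 * Real.pi) * C + 16 * 4 ^ ε * K, by positivity,
    fun M Q hM hQ a => ?_⟩
  set S := ∑ m ∈ (Finset.Ioc M (2 * M)).filter Squarefree, ‖a m‖ ^ 2 with hS
  have hS0 : 0 ≤ S := Finset.sum_nonneg fun _ _ => by positivity
  set E := ((Q : ℝ) * M) ^ ε with hE
  have hE0 : 0 ≤ E := by positivity
  set V := (Q : ℝ) ^ ((1 : ℝ) / 3) * (M : ℝ) ^ ((5 : ℝ) / 3) with hV
  have hV0 : 0 ≤ V := by positivity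
  have hQ0 : (0 : ℝ) ≤ Q := Nat.cast_nonneg Q
  rcases le_total (M ^ 2) Q with hMQ | hMQ
  · have key := sum_norm_charEval_sq_le_of_psi hM hQ
      (fun A hA hAM T hTs hTA b s => hC M Q A hM hMQ hA hAM T hTs hTA b s) a
    refine key.trans ?_
    have : 0 ≤ 16 * 4 ^ ε * K * E * (Q + V) * S := by positivity
    linarith
  · have key := sum_ioc_le_of_largeSieve (hK (2 * M) (2 * Q) (by lia) (by lia)) a
    have h1 := dyadic_bound_le (Q := Q) (M := M) (ε := ε) hK0 (α := 7 / 6) (β := 2 / 3) (by norm_num)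
      (by norm_num)
    have h2 := cube_bound_le_of_le_sq hMQ
    refine key.trans (mul_le_mul_of_nonneg_right (h1.trans ?_) hS0)
    have h3 : 8 * 4 ^ ε * K * E * ((Q : ℝ) ^ ((7 : ℝ) / 6) + (Q : ℝ) ^ ((2 : ℝ) / 3) * M) ≤
        8 * 4 ^ ε * K * E * (2 * V) := mul_le_mul_of_nonneg_left h2 (by positivity)
    have h4 : 0 ≤ 72 * Real.exp (2 * Real.pi) * C * E * (Q + V) := by positivity
    have h5 : 0 ≤ 16 * 4 ^ ε * K * E * Q := by positivity
    refine h3.trans ?_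
    linarith

/-- assuming `C₂(M,Q) ≪ (QM)^ε (M + Q^{3/2})` and `C₁ ≤ C₂`, the quartic
large sieve holds with the bound
`(QM)^ε min{Q^{3/2}+M, Q^{5/4}+Q^{1/2}M, Q^{7/6}+Q^{2/3}M, Q+Q^{1/3}M^{5/3}+M^{7/3}}`. -/
theorem quartic_large_sieve (C₁ C₂ : ℕ → ℕ → ℝ)
    (hC1 : ∀ (Q M : ℕ) (a : ℕ → ℂ),
      quartSieveSum Q M a ≤
        C₁ M Q * ∑ m ∈ Finset.Ioc M (2 * M), if Squarefree m then ‖a m‖ ^ 2 else 0)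
    (hC12 : ∀ M Q : ℕ, C₁ M Q ≤ C₂ M Q)
    (hC2 : ∀ ε : ℝ, 0 < ε → ∃ K : ℝ, ∀ M Q : ℕ, 1 ≤ M → 1 ≤ Q →
      C₂ M Q ≤ K * ((Q : ℝ) * M) ^ ε * ((M : ℝ) + (Q : ℝ) ^ ((3 : ℝ) / 2))) :
    ∀ ε : ℝ, 0 < ε → ∃ K : ℝ, ∀ M Q : ℕ, 1 ≤ M → 1 ≤ Q → ∀ a : ℕ → ℂ,
      quartSieveSum Q M a ≤
        K * ((Q : ℝ) * M) ^ ε *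
          min (min ((Q : ℝ) ^ ((3 : ℝ) / 2) + M)
                ((Q : ℝ) ^ ((5 : ℝ) / 4) + (Q : ℝ) ^ ((1 : ℝ) / 2) * M))
              (min ((Q : ℝ) ^ ((7 : ℝ) / 6) + (Q : ℝ) ^ ((2 : ℝ) / 3) * M)
                ((Q : ℝ) + (Q : ℝ) ^ ((1 : ℝ) / 3) * (M : ℝ) ^ ((5 : ℝ) / 3) +
                  (M : ℝ) ^ ((7 : ℝ) / 3))) *
          ∑ m ∈ Finset.Ioc M (2 * M), if Squarefree m then ‖a m‖ ^ 2 else 0 := by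
  intro ε hε
  have hbase : ∀ ε : ℝ, 0 < ε → ∃ K : ℝ, 0 ≤ K ∧
      ∀ Q M : ℕ, 1 ≤ M → 1 ≤ Q → ∀ a : ℕ → ℂ, quartSieveSum Q M a ≤
        K * ((Q : ℝ) * M) ^ ε * ((M : ℝ) + (Q : ℝ) ^ ((3 : ℝ) / 2)) *
          ∑ m ∈ Finset.Ioc M (2 * M), if Squarefree m then ‖a m‖ ^ 2 else 0 := by
    intro ε hε
    obtain ⟨K, hK⟩ := hC2 ε hε
    refine ⟨max K 0, le_max_right _ _, fun Q M hM hQ a => (hC1 Q M a).trans ?_⟩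
    refine mul_le_mul_of_nonneg_right ?_
      (Finset.sum_nonneg fun _ _ => by split_ifs <;> positivity)
    refine ((hC12 M Q).trans (hK M Q hM hQ)).trans ?_
    exact mul_le_mul_of_nonneg_right (mul_le_mul_of_nonneg_right (le_max_left _ _)
      (by positivity)) (by positivity)
  have hlin := fun (ε : ℝ) (hε : 0 < ε) => exists_largeSieve_base hbase hε
  have hcube := fun (ε : ℝ) (hε : 0 < ε) => exists_largeSieve_cube hlin hε
  obtain ⟨K₁, hK₁, h₁⟩ := hbase ε hε
  obtain ⟨K₂, hK₂, h₂⟩ := exists_largeSieve_sq hlin hε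
  obtain ⟨K₃, hK₃, h₃⟩ := hcube ε hε
  obtain ⟨K₄, hK₄, h₄⟩ := exists_quarticFamily_bound_dual hcube hε
  refine ⟨K₁ + 8 * 4 ^ ε * K₂ + 8 * 4 ^ ε * K₃ + K₄, fun M Q hM hQ a => ?_⟩
  have hS0 : 0 ≤ ∑ m ∈ Finset.Ioc M (2 * M), if Squarefree m then ‖a m‖ ^ 2 else 0 :=
    Finset.sum_nonneg fun _ _ => by split_ifs <;> positivity
  have b₁ := h₁ Q M hM hQ a
  have b₂ := (quartSieveSum_le_sum_quarticFamily a).trans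
    (sum_ioc_le_of_largeSieve (h₂ (2 * M) (2 * Q) (by lia) (by lia)) a)
  have b₃ := (quartSieveSum_le_sum_quarticFamily a).trans
    (sum_ioc_le_of_largeSieve (h₃ (2 * M) (2 * Q) (by lia) (by lia)) a)
  have b₄ := (quartSieveSum_le_sum_quarticFamily a).trans (h₄ M Q hM hQ a)
  rw [Finset.sum_filter] at b₂ b₃ b₄
  set S := ∑ m ∈ Finset.Ioc M (2 * M), if Squarefree m then ‖a m‖ ^ 2 else 0
  set E := ((Q : ℝ) * M) ^ ε
  have hE0 : 0 ≤ E := by positivity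
  have h4 : (0 : ℝ) ≤ 4 ^ ε := by positivity
  have c₂ := b₂.trans (mul_le_mul_of_nonneg_right (dyadic_bound_le (Q := Q) (M := M) (ε := ε) hK₂
    (α := 5 / 4) (β := 1 / 2) (by norm_num) (by norm_num)) hS0)
  have c₃ := b₃.trans (mul_le_mul_of_nonneg_right (dyadic_bound_le (Q := Q) (M := M) (ε := ε) hK₃
    (α := 7 / 6) (β := 2 / 3) (by norm_num) (by norm_num)) hS0)
  have mono : ∀ {c V U : ℝ}, quartSieveSum Q M a ≤ c * E * V * S →
      c ≤ K₁ + 8 * 4 ^ ε * K₂ + 8 * 4 ^ ε * K₃ + K₄ → 0 ≤ c → 0 ≤ V → V ≤ U →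
      quartSieveSum Q M a ≤ (K₁ + 8 * 4 ^ ε * K₂ + 8 * 4 ^ ε * K₃ + K₄) * E * U * S := by
    intro c V U h hc hc0 hV hVU
    refine h.trans (mul_le_mul_of_nonneg_right ?_ hS0)
    exact mul_le_mul (mul_le_mul_of_nonneg_right hc hE0) hVU hV
      (mul_nonneg (hc0.trans hc) hE0)
  have k₂ : 0 ≤ 8 * 4 ^ ε * K₂ := by positivity
  have k₃ : 0 ≤ 8 * 4 ^ ε * K₃ := by positivity
  rcases min_choice (min ((Q : ℝ) ^ ((3 : ℝ) / 2) + M)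
      ((Q : ℝ) ^ ((5 : ℝ) / 4) + (Q : ℝ) ^ ((1 : ℝ) / 2) * M))
      (min ((Q : ℝ) ^ ((7 : ℝ) / 6) + (Q : ℝ) ^ ((2 : ℝ) / 3) * M)
        ((Q : ℝ) + (Q : ℝ) ^ ((1 : ℝ) / 3) * (M : ℝ) ^ ((5 : ℝ) / 3) +
          (M : ℝ) ^ ((7 : ℝ) / 3))) with h | h <;> rw [h]
  · rcases min_choice ((Q : ℝ) ^ ((3 : ℝ) / 2) + M)
      ((Q : ℝ) ^ ((5 : ℝ) / 4) + (Q : ℝ) ^ ((1 : ℝ) / 2) * M) with h' | h' <;> rw [h']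
    · exact mono b₁ (by linarith) hK₁ (by positivity) (add_comm _ _).le
    · exact mono c₂ (by linarith) k₂ (by positivity) le_rfl
  · rcases min_choice ((Q : ℝ) ^ ((7 : ℝ) / 6) + (Q : ℝ) ^ ((2 : ℝ) / 3) * M)
        ((Q : ℝ) + (Q : ℝ) ^ ((1 : ℝ) / 3) * (M : ℝ) ^ ((5 : ℝ) / 3) +
          (M : ℝ) ^ ((7 : ℝ) / 3)) with h' | h' <;> rw [h']
    · exact mono c₃ (by linarith) k₃ (by positivity) le_rfl
    · exact mono b₄ (by linarith) hK₄ (by positivity)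
        (le_add_of_nonneg_right (by positivity))
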